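/- arXiv:2307.16428 — 3 statements merged into one kernel-verified Lean document; each statement's English description precedes it below -/
import Mathlib

section
/- For every α with −3/2 < α ≤ 0 there is a constant C > 0 such that for all t ≠ 0 and all x, y ∈ ℝ³ with x ≠ y, for either choice of sign: ∑_{N∈ℤ} |∫₀^∞ e^{−i t λ²} λ^{3+2α} φ₀(2^{−N} λ) R₀^±(λ⁴)(x, y) dλ| ≤ C |t|^{−(3+2α)/2}. In particular, the Littlewood–Paley regularized integral ∫₀^∞ e^{−i t λ²} λ^{3+2α} R₀^±(λ⁴)(x, y) dλ, defined as the sum over N ∈ ℤ of the dyadic pieces above, converges absolutely and is bounded in absolute value by C |t|^{−(3+2α)/2}, uniformly in x and y. -/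
noncomputable section

open MeasureTheory Real

/-- The free fourth-order resolvent kernel `R₀^±(λ⁴)(x,y)` on `ℝ³`, where the sign is
encoded by `sgn ∈ {1, -1}`. -/
noncomputable def R0ker (sgn lam : ℝ) (x y : EuclideanSpace ℝ (Fin 3)) : ℂ :=
  (1 / (2 * (lam : ℂ) ^ 2)) *
    (Complex.exp ((sgn : ℂ) * Complex.I * (lam : ℂ) * (‖x - y‖ : ℂ)) /
        (4 * (Real.pi : ℂ) * (‖x - y‖ : ℂ)) -
      Complex.exp (-((lam : ℂ) * (‖x - y‖ : ℂ))) / (4 * (Real.pi : ℂ) * (‖x - y‖ : ℂ)))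

open Set

/-- `g` is twice differentiable on `[1/8, 2]` with derivatives `g₁` and `g₂` (the latter
continuous), all bounded by `M` there, and `g`, `g₁` vanish at the end points. -/
structure IsAmplitude (g g₁ g₂ : ℝ → ℂ) (M : ℝ) : Prop where
  hasDerivAt : ∀ s ∈ Icc (1 / 8 : ℝ) 2, HasDerivAt g (g₁ s) s
  hasDerivAt₁ : ∀ s ∈ Icc (1 / 8 : ℝ) 2, HasDerivAt g₁ (g₂ s) s
  continuousOn₂ : ContinuousOn g₂ (Icc (1 / 8 : ℝ) 2)
  norm_le : ∀ s ∈ Icc (1 / 8 : ℝ) 2, ‖g s‖ ≤ M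
  norm_le₁ : ∀ s ∈ Icc (1 / 8 : ℝ) 2, ‖g₁ s‖ ≤ M
  norm_le₂ : ∀ s ∈ Icc (1 / 8 : ℝ) 2, ‖g₂ s‖ ≤ M
  left : g (1 / 8) = 0
  right : g 2 = 0
  left₁ : g₁ (1 / 8) = 0
  right₁ : g₁ 2 = 0

namespace IsAmplitude

variable {g g₁ g₂ : ℝ → ℂ} {M : ℝ}

theorem nonneg (h : IsAmplitude g g₁ g₂ M) : 0 ≤ M :=
  (norm_nonneg _).trans (h.norm_le 1 (by norm_num))

theorem continuousOn (h : IsAmplitude g g₁ g₂ M) : ContinuousOn g (Icc (1 / 8 : ℝ) 2) :=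
  fun s hs => (h.hasDerivAt s hs).continuousAt.continuousWithinAt

theorem continuousOn₁ (h : IsAmplitude g g₁ g₂ M) : ContinuousOn g₁ (Icc (1 / 8 : ℝ) 2) :=
  fun s hs => (h.hasDerivAt₁ s hs).continuousAt.continuousWithinAt

theorem exists_of_contDiffOn (hg : ContDiffOn ℝ 2 g (Ioi 0))
    (h0 : ∀ s ∈ Ioo (0 : ℝ) (1 / 4), g s = 0) (h1 : ∀ s, 1 < s → g s = 0) :
    ∃ g₁ g₂ M, IsAmplitude g g₁ g₂ M := by
  have hsub : Icc (1 / 8 : ℝ) 2 ⊆ Ioi 0 := fun s hs => lt_of_lt_of_le (by norm_num) hs.1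
  have hg1 : ContDiffOn ℝ 1 (deriv g) (Ioi 0) :=
    hg.deriv_of_isOpen isOpen_Ioi (by norm_num)
  have hg2 : ContDiffOn ℝ 0 (deriv (deriv g)) (Ioi 0) :=
    hg1.deriv_of_isOpen isOpen_Ioi (by norm_num)
  obtain ⟨A, hA⟩ := isCompact_Icc.exists_bound_of_continuousOn (hg.continuousOn.mono hsub)
  obtain ⟨B, hB⟩ := isCompact_Icc.exists_bound_of_continuousOn (hg1.continuousOn.mono hsub)
  obtain ⟨C, hC⟩ := isCompact_Icc.exists_bound_of_continuousOn (hg2.continuousOn.mono hsub)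
  have e0 : g =ᶠ[nhds (1 / 8)] fun _ => 0 := by
    filter_upwards [Ioo_mem_nhds (a := (0 : ℝ)) (b := 1 / 4) (by norm_num) (by norm_num)] with s hs
    exact h0 s hs
  have e1 : g =ᶠ[nhds 2] fun _ => 0 := by
    filter_upwards [Ioi_mem_nhds (a := (1 : ℝ)) (b := 2) (by norm_num)] with s hs
    exact h1 s hs
  refine ⟨deriv g, deriv (deriv g), max A (max B C), ?_, ?_, hg2.continuousOn.mono hsub,
    fun s hs => (hA s hs).trans (by simp), fun s hs => (hB s hs).trans (by simp),
    fun s hs => (hC s hs).trans (by simp), e0.eq_of_nhds, e1.eq_of_nhds, ?_, ?_⟩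
  · intro s hs
    exact ((hg.differentiableOn (by norm_num)).differentiableAt
      (isOpen_Ioi.mem_nhds (hsub hs))).hasDerivAt
  · intro s hs
    exact ((hg1.differentiableOn (by norm_num)).differentiableAt
      (isOpen_Ioi.mem_nhds (hsub hs))).hasDerivAt
  · rw [e0.deriv_eq]; simp
  · rw [e1.deriv_eq]; simp

end IsAmplitude

/-- The oscillatory factor `exp (-i T s² + ζ s)`. -/
noncomputable def oscFactor (T : ℝ) (ζ : ℂ) (s : ℝ) : ℂ :=
  Complex.exp (-Complex.I * T * (s : ℂ) ^ 2 + ζ * s)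

/-- The oscillatory integral `∫ exp (-i T s² + ζ s) g(s) ds` over `[1/8, 2]`. -/
noncomputable def oscIntegral (g : ℝ → ℂ) (T : ℝ) (ζ : ℂ) : ℂ :=
  ∫ s in (1 / 8 : ℝ)..2, oscFactor T ζ s * g s

theorem norm_oscFactor_le (T : ℝ) {ζ : ℂ} (hζ : ζ.re ≤ 0) {s : ℝ} (hs : 0 ≤ s) :
    ‖oscFactor T ζ s‖ ≤ 1 := by
  rw [oscFactor, Complex.norm_exp, Real.exp_le_one_iff]
  have : (-Complex.I * T * (s : ℂ) ^ 2 + ζ * s).re = ζ.re * s := by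
    simp [← Complex.ofReal_pow]
  rw [this]
  exact mul_nonpos_of_nonpos_of_nonneg hζ hs

theorem hasDerivAt_oscFactor (T : ℝ) (ζ : ℂ) (s : ℝ) :
    HasDerivAt (oscFactor T ζ) ((-2 * Complex.I * T * s + ζ) * oscFactor T ζ s) s := by
  have h : HasDerivAt (fun z : ℂ => Complex.exp (-Complex.I * T * z ^ 2 + ζ * z))
      (Complex.exp (-Complex.I * T * (s : ℂ) ^ 2 + ζ * s) *
        (-Complex.I * T * (2 * (s : ℂ)) + ζ)) (s : ℂ) := by
    have := ((((hasDerivAt_id (s : ℂ)).pow 2).const_mul (-Complex.I * T)).add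
      ((hasDerivAt_id (s : ℂ)).const_mul ζ)).cexp
    exact this.congr_deriv (by simp)
  refine h.comp_ofReal.congr_deriv ?_
  simp only [oscFactor]
  ring

theorem continuous_oscFactor (T : ℝ) (ζ : ℂ) : Continuous (oscFactor T ζ) := by
  unfold oscFactor; fun_prop

variable {g g₁ g₂ : ℝ → ℂ} {M : ℝ}

theorem norm_oscIntegral_le (h : IsAmplitude g g₁ g₂ M) (T : ℝ) {ζ : ℂ} (hζ : ζ.re ≤ 0) :
    ‖oscIntegral g T ζ‖ ≤ 2 * M := by
  have := intervalIntegral.norm_integral_le_of_norm_le_const (a := (1 / 8 : ℝ)) (b := 2)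
    (f := fun s => oscFactor T ζ s * g s) (C := M) (by
      intro s hs
      rw [uIoc_of_le (by norm_num)] at hs
      rw [norm_mul]
      have h1 := norm_oscFactor_le T hζ (s := s) (by linarith [hs.1])
      have h2 := h.norm_le s (Ioc_subset_Icc_self hs)
      nlinarith [norm_nonneg (g s), norm_nonneg (oscFactor T ζ s)])
  rw [abs_of_pos (by norm_num)] at this
  have := h.nonneg
  unfold oscIntegral
  linarith

theorem norm_oscIntegral_le_div_sq (h : IsAmplitude g g₁ g₂ M) {T : ℝ} (hT : T ≠ 0) {ζ : ℂ}
    (hζ : ζ.re ≤ 0)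
    (hP : ∀ s ∈ Icc (1 / 8 : ℝ) 2, |T| / 8 ≤ ‖-2 * Complex.I * T * s + ζ‖) :
    ‖oscIntegral g T ζ‖ ≤ 110000 * M / T ^ 2 := by
  have hTp : 0 < |T| := abs_pos.2 hT
  set P : ℝ → ℂ := fun s => -2 * Complex.I * T * s + ζ with hPdef
  set c : ℂ := -2 * Complex.I * T with hc
  have hP0 : ∀ s ∈ Icc (1 / 8 : ℝ) 2, P s ≠ 0 := fun s hs h0 => by
    have h1 := hP s hs
    change _ ≤ ‖P s‖ at h1
    rw [h0, norm_zero] at h1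
    linarith
  have hPd : ∀ s, HasDerivAt P c s := fun s => by
    simpa [hPdef, hc] using ((hasDerivAt_id (s : ℂ)).comp_ofReal.const_mul c).add_const ζ
  have hPc : Continuous P := continuous_iff_continuousAt.2 fun s => (hPd s).continuousAt
  have hEc := continuous_oscFactor T ζ
  set R : ℝ → ℂ := fun s => oscFactor T ζ s *
    (g₂ s / P s ^ 2 - 3 * c * (g₁ s / P s ^ 3) + 3 * c ^ 2 * (g s / P s ^ 4)) with hR
  have hsub : uIcc (1 / 8 : ℝ) 2 = Icc (1 / 8 : ℝ) 2 := uIcc_of_le (by norm_num)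
  have hgc := h.continuousOn
  have hg1c := h.continuousOn₁
  have hg2c := h.continuousOn₂
  have hRc : ContinuousOn R (Icc (1 / 8 : ℝ) 2) := by
    refine hEc.continuousOn.mul (((hg2c.div (hPc.pow 2).continuousOn ?_).sub
      (continuousOn_const.mul (hg1c.div (hPc.pow 3).continuousOn ?_))).add
      (continuousOn_const.mul (hgc.div (hPc.pow 4).continuousOn ?_))) <;>
    exact fun s hs => pow_ne_zero _ (hP0 s hs)
  have hEg : ContinuousOn (fun s => oscFactor T ζ s * g s) (Icc (1 / 8 : ℝ) 2) :=
    hEc.continuousOn.mul hgc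
  have hiR : IntervalIntegrable R volume (1 / 8) 2 :=
    ContinuousOn.intervalIntegrable (by rwa [hsub])
  have hiE : IntervalIntegrable (fun s => oscFactor T ζ s * g s) volume (1 / 8) 2 :=
    ContinuousOn.intervalIntegrable (by rwa [hsub])
  have key := intervalIntegral.integral_eq_sub_of_hasDerivAt (a := (1 / 8 : ℝ)) (b := 2)
    (f := fun s => oscFactor T ζ s * (g s / P s - g₁ s / P s ^ 2 + c * (g s / P s ^ 3)))
    (f' := fun s => oscFactor T ζ s * g s - R s) (by
      intro s hs
      rw [hsub] at hs
      have hp := hP0 s hs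
      have hg := h.hasDerivAt s hs
      have hg1 := h.hasDerivAt₁ s hs
      have hd := (hasDerivAt_oscFactor T ζ s).mul
        (((hg.div (hPd s) hp).sub (hg1.div ((hPd s).pow 2) (pow_ne_zero _ hp))).add
          ((hg.div ((hPd s).pow 3) (pow_ne_zero _ hp)).const_mul c))
      refine hd.congr_deriv ?_
      simp only [hR, Pi.pow_apply, Pi.div_apply, Pi.sub_apply, Pi.add_apply]
      change P s * _ * _ + _ = _
      field_simp
      ring) (hiE.sub hiR)
  rw [intervalIntegral.integral_sub hiE hiR] at key
  simp only [h.left, h.right, h.left₁, h.right₁, zero_div, sub_zero, mul_zero, add_zero] at key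
  have hEq : oscIntegral g T ζ = ∫ s in (1 / 8 : ℝ)..2, R s := sub_eq_zero.1 key
  have hM := h.nonneg
  have hcn : ‖c‖ = 2 * |T| := by simp [hc]
  have := intervalIntegral.norm_integral_le_of_norm_le_const (a := (1 / 8 : ℝ)) (b := 2)
    (f := R) (C := 52288 * M / |T| ^ 2) (by
      intro s hs
      rw [uIoc_of_le (by norm_num)] at hs
      replace hs := Ioc_subset_Icc_self hs
      have hp := hP s hs
      change _ ≤ ‖P s‖ at hp
      have hp8 : 0 < |T| / 8 := by positivity
      have h0 := norm_oscFactor_le T hζ (s := s) (by linarith [hs.1])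
      have b2 : ‖g₂ s / P s ^ 2‖ ≤ M / (|T| / 8) ^ 2 := by
        rw [norm_div, norm_pow]; gcongr; exact h.norm_le₂ s hs
      have b1 : ‖3 * c * (g₁ s / P s ^ 3)‖ ≤ 3 * (2 * |T|) * (M / (|T| / 8) ^ 3) := by
        rw [norm_mul, norm_mul, norm_div, norm_pow, hcn, Complex.norm_ofNat]
        gcongr; exact h.norm_le₁ s hs
      have b0 : ‖3 * c ^ 2 * (g s / P s ^ 4)‖ ≤ 3 * (2 * |T|) ^ 2 * (M / (|T| / 8) ^ 4) := by
        rw [norm_mul, norm_mul, norm_div, norm_pow, norm_pow, hcn, Complex.norm_ofNat]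
        gcongr; exact h.norm_le s hs
      have e : M / (|T| / 8) ^ 2 + 3 * (2 * |T|) * (M / (|T| / 8) ^ 3) +
          3 * (2 * |T|) ^ 2 * (M / (|T| / 8) ^ 4) = 52288 * M / |T| ^ 2 := by
        field_simp; ring
      rw [hR, norm_mul, ← e]
      refine (mul_le_of_le_one_left (norm_nonneg _) h0).trans ?_
      exact (norm_add_le _ _).trans (add_le_add ((norm_sub_le _ _).trans (add_le_add b2 b1)) b0))
  rw [hEq]
  refine this.trans ?_
  rw [sq_abs, abs_of_pos (by norm_num), div_mul_eq_mul_div]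
  exact div_le_div_of_nonneg_right (by linarith) (sq_nonneg T)

theorem integral_inv_one_add_sq_le {v : ℝ} (hv : 0 < v) (s₀ : ℝ) :
    ∫ s in (1 / 8 : ℝ)..2, (1 + (v * (s - s₀)) ^ 2)⁻¹ ≤ π / v := by
  rw [intervalIntegral.integral_eq_sub_of_hasDerivAt
    (f := fun s => arctan (v * (s - s₀)) / v)]
  · rw [← sub_div]
    gcongr
    linarith [arctan_lt_pi_div_two (v * (2 - s₀)), neg_pi_div_two_lt_arctan (v * (1 / 8 - s₀))]
  · intro s _
    have := ((((hasDerivAt_id s).sub_const s₀).const_mul v).arctan).div_const v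
    refine this.congr_deriv ?_
    simp
    field_simp
  · refine Continuous.intervalIntegrable (Continuous.inv₀ (by fun_prop) fun s => ?_) _ _
    positivity

theorem norm_oscIntegral_le_div (h : IsAmplitude g g₁ g₂ M) {T v : ℝ} (hv : 0 < v)
    (hT : |T| = v ^ 2) (κ : ℝ) :
    ‖oscIntegral g T (Complex.I * κ)‖ ≤ 9 * M / v := by
  have hT0 : T ≠ 0 := abs_pos.1 (hT ▸ by positivity)
  have hTc : (T : ℂ) ≠ 0 := by exact_mod_cast hT0
  set s₀ : ℝ := κ / (2 * T) with hs₀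
  set u : ℝ → ℂ := fun s => (s : ℂ) - s₀ with hu
  set D : ℝ → ℂ := fun s => 1 - 2 * Complex.I * T * u s ^ 2 with hD
  have hM := h.nonneg
  have hun : ∀ s : ℝ, ‖u s‖ = |s - s₀| := fun s => by
    rw [hu]; simp only; rw [← Complex.ofReal_sub, Complex.norm_real, Real.norm_eq_abs]
  have hDn : ∀ s : ℝ, ‖D s‖ ^ 2 = 1 + 4 * (v * (s - s₀)) ^ 4 := fun s => by
    have e : D s = 1 - ((2 * T * (s - s₀) ^ 2 : ℝ) : ℂ) * Complex.I := by
      simp only [hD, hu]; push_cast; ring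
    rw [← Complex.normSq_eq_norm_sq, e, Complex.normSq_apply]
    simp only [Complex.sub_re, Complex.one_re, Complex.re_ofReal_mul, Complex.I_re,
      Complex.sub_im, Complex.one_im, Complex.im_ofReal_mul, Complex.I_im]
    have : T ^ 2 = v ^ 4 := by rw [← sq_abs, hT]; ring
    linear_combination (4 * (s - s₀) ^ 4) * this
  have hDpos : ∀ s : ℝ, 0 < ‖D s‖ := fun s => by
    rcases (norm_nonneg (D s)).eq_or_lt with h0 | h0
    · have := hDn s; rw [← h0] at this; nlinarith [sq_nonneg ((v * (s - s₀)) ^ 2)]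
    · exact h0
  have hD0 : ∀ s, D s ≠ 0 := fun s => norm_pos_iff.1 (hDpos s)
  have hud : ∀ s, HasDerivAt u 1 s := fun s =>
    (hasDerivAt_id (s : ℂ)).comp_ofReal.sub_const _
  have hDd : ∀ s, HasDerivAt D (-(4 * Complex.I * T * u s)) s := fun s => by
    have := (((hud s).pow 2).const_mul (2 * Complex.I * T)).const_sub 1
    refine this.congr_deriv ?_
    simp
    ring
  have huc : Continuous u := continuous_iff_continuousAt.2 fun s => (hud s).continuousAt
  have hDc : Continuous D := continuous_iff_continuousAt.2 fun s => (hDd s).continuousAt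
  set ζ : ℂ := Complex.I * κ with hζ
  have hEc := continuous_oscFactor T ζ
  set R : ℝ → ℂ := fun s => oscFactor T ζ s *
    (u s * g₁ s / D s + 4 * Complex.I * T * u s ^ 2 * g s / D s ^ 2) with hR
  have hsub : uIcc (1 / 8 : ℝ) 2 = Icc (1 / 8 : ℝ) 2 := uIcc_of_le (by norm_num)
  have hgc := h.continuousOn
  have hg1c := h.continuousOn₁
  have hRc : ContinuousOn R (Icc (1 / 8 : ℝ) 2) := by
    refine hEc.continuousOn.mul (((huc.continuousOn.mul hg1c).div hDc.continuousOn ?_).add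
      (((by fun_prop : Continuous fun s => 4 * Complex.I * T * u s ^ 2).continuousOn.mul hgc).div
        (hDc.pow 2).continuousOn ?_))
    · exact fun s _ => hD0 s
    · exact fun s _ => pow_ne_zero _ (hD0 s)
  have hiR : IntervalIntegrable R volume (1 / 8) 2 :=
    ContinuousOn.intervalIntegrable (by rwa [hsub])
  have hiE : IntervalIntegrable (fun s => oscFactor T ζ s * g s) volume (1 / 8) 2 :=
    ContinuousOn.intervalIntegrable (by rw [hsub]; exact hEc.continuousOn.mul hgc)
  have key := intervalIntegral.integral_eq_sub_of_hasDerivAt (a := (1 / 8 : ℝ)) (b := 2)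
    (f := fun s => oscFactor T ζ s * (u s * g s / D s))
    (f' := fun s => oscFactor T ζ s * g s + R s) (by
      intro s hs
      rw [hsub] at hs
      have hp := hD0 s
      have hd := (hasDerivAt_oscFactor T ζ s).mul
        (((hud s).mul (h.hasDerivAt s hs)).div (hDd s) hp)
      refine hd.congr_deriv ?_
      simp only [hR, Pi.mul_apply, Pi.div_apply]
      have e1 : -2 * Complex.I * T * s + ζ = -(2 * Complex.I * T * u s) := by
        simp only [hζ, hu, hs₀]
        push_cast
        field_simp
        ring
      have e2 : 2 * Complex.I * T * u s ^ 2 = 1 - D s := by simp [hD]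
      rw [e1]
      field_simp
      linear_combination (-(g s * D s)) * e2) (hiE.add hiR)
  rw [intervalIntegral.integral_add hiE hiR] at key
  simp only [h.left, h.right, mul_zero, zero_div, sub_zero] at key
  have hEq : oscIntegral g T ζ = -∫ s in (1 / 8 : ℝ)..2, R s := eq_neg_of_add_eq_zero_left key
  have hbc : Continuous fun s : ℝ => (1 + (v * (s - s₀)) ^ 2)⁻¹ :=
    Continuous.inv₀ (by fun_prop) fun s => by positivity
  have hbound := intervalIntegral.norm_integral_le_of_norm_le (a := (1 / 8 : ℝ)) (b := 2)
    (f := R) (g := fun s => M / (2 * v) + 2 * M * (1 + (v * (s - s₀)) ^ 2)⁻¹)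
    (by norm_num) (Filter.Eventually.of_forall fun s hs => by
      replace hs := Ioc_subset_Icc_self hs
      have h0 := norm_oscFactor_le T (ζ := ζ) (by simp [hζ]) (s := s) (by linarith [hs.1])
      have hd := hDpos s
      set w := v * (s - s₀) with hw
      have hwa : |w| = v * |s - s₀| := by rw [hw, abs_mul, abs_of_pos hv]
      have b1 : ‖u s * g₁ s / D s‖ ≤ M / (2 * v) := by
        rw [norm_div, norm_mul, hun, div_le_div_iff₀ hd (by positivity)]
        have h2 : 2 * |w| ≤ ‖D s‖ := by
          refine abs_le_of_sq_le_sq' ?_ hd.le |>.2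
          rw [hDn, mul_pow, sq_abs]
          nlinarith [sq_nonneg (2 * w ^ 2 - 1)]
        have h3 := h.norm_le₁ s hs
        calc |s - s₀| * ‖g₁ s‖ * (2 * v) = ‖g₁ s‖ * (2 * |w|) := by rw [hwa]; ring
          _ ≤ M * ‖D s‖ := by gcongr
      have b2 : ‖4 * Complex.I * T * u s ^ 2 * g s / D s ^ 2‖ ≤ 2 * M * (1 + w ^ 2)⁻¹ := by
        rw [norm_div, norm_pow, hDn, norm_mul, norm_mul, norm_mul, norm_mul, norm_pow, hun,
          Complex.norm_I, Complex.norm_real, Real.norm_eq_abs, hT, ← div_eq_mul_inv,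
          Complex.norm_ofNat, sq_abs, div_le_div_iff₀ (by positivity) (by positivity)]
        have h3 := h.norm_le s hs
        calc 4 * 1 * v ^ 2 * (s - s₀) ^ 2 * ‖g s‖ * (1 + w ^ 2)
            = ‖g s‖ * (4 * w ^ 2 * (1 + w ^ 2)) := by rw [hw]; ring
          _ ≤ M * (2 * (1 + 4 * w ^ 4)) :=
            mul_le_mul h3 (by nlinarith [sq_nonneg (2 * w ^ 2 - 1)]) (by positivity) hM
          _ = _ := by ring
      rw [hR, norm_mul]
      refine (mul_le_of_le_one_left (norm_nonneg _) h0).trans ?_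
      exact (norm_add_le _ _).trans (add_le_add b1 b2))
    ((continuous_const.add (continuous_const.mul hbc)).intervalIntegrable (μ := volume) _ _)
  have hib : IntervalIntegrable (fun s : ℝ => 2 * M * (1 + (v * (s - s₀)) ^ 2)⁻¹) volume
      (1 / 8) 2 := (continuous_const.mul hbc).intervalIntegrable _ _
  rw [intervalIntegral.integral_add (by simp) hib,
    intervalIntegral.integral_const_mul, intervalIntegral.integral_const, smul_eq_mul] at hbound
  rw [hEq, norm_neg]
  refine hbound.trans ?_
  have h1 := integral_inv_one_add_sq_le hv s₀
  have h2 : 2 * M * (∫ s in (1 / 8 : ℝ)..2, (1 + (v * (s - s₀)) ^ 2)⁻¹) ≤ 2 * M * (π / v) := by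
    gcongr
  have h3 : 2 * M * (π / v) ≤ 2 * M * (4 / v) := by
    gcongr; exact pi_le_four
  have h4 : (2 - 1 / 8) * (M / (2 * v)) + 2 * M * (4 / v) ≤ 9 * M / v := by
    rw [← sub_nonneg]
    have : 9 * M / v - ((2 - 1 / 8) * (M / (2 * v)) + 2 * M * (4 / v)) = (1 / 16) * (M / v) := by
      field_simp; ring
    rw [this]; positivity
  linarith

theorem hasDerivAt_oscIntegral (hg : ContinuousOn g (Icc (1 / 8 : ℝ) 2)) (T : ℝ) (ζ : ℂ) :
    HasDerivAt (oscIntegral g T) (oscIntegral (fun s => s * g s) T ζ) ζ := by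
  have hsub : uIcc (1 / 8 : ℝ) 2 = Icc (1 / 8 : ℝ) 2 := uIcc_of_le (by norm_num)
  have hsub' : uIoc (1 / 8 : ℝ) 2 ⊆ Icc (1 / 8 : ℝ) 2 := by
    rw [uIoc_of_le (by norm_num)]; exact Ioc_subset_Icc_self
  obtain ⟨M, hM⟩ := isCompact_Icc.exists_bound_of_continuousOn hg
  have hc : ∀ z, ContinuousOn (fun s => oscFactor T z s * g s) (Icc (1 / 8 : ℝ) 2) := fun z =>
    (continuous_oscFactor T z).continuousOn.mul hg
  have hc' : ContinuousOn (fun s : ℝ => oscFactor T ζ s * (s * g s)) (Icc (1 / 8 : ℝ) 2) :=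
    (continuous_oscFactor T ζ).continuousOn.mul (Complex.continuous_ofReal.continuousOn.mul hg)
  have hmeas : ∀ {f : ℝ → ℂ}, ContinuousOn f (Icc (1 / 8 : ℝ) 2) →
      AEStronglyMeasurable f (volume.restrict (uIoc (1 / 8 : ℝ) 2)) := fun hf =>
    (hf.mono hsub').aestronglyMeasurable measurableSet_uIoc
  refine (intervalIntegral.hasDerivAt_integral_of_dominated_loc_of_deriv_le
    (F := fun z s => oscFactor T z s * g s) (F' := fun z s => oscFactor T z s * (s * g s))
    (bound := fun _ => rexp (2 * (‖ζ‖ + 1)) * (2 * M))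
    (Metric.ball_mem_nhds ζ one_pos) (Filter.Eventually.of_forall fun z => hmeas (hc z))
    (ContinuousOn.intervalIntegrable (by rw [hsub]; exact hc ζ)) (hmeas hc')
    (Filter.Eventually.of_forall fun s hs z hz => ?_) (by simp)
    (Filter.Eventually.of_forall fun s hs z hz => ?_)).2
  · have hs' := hsub' hs
    have hs0 : 0 ≤ s := by linarith [hs'.1]
    have hz' : ‖z‖ ≤ ‖ζ‖ + 1 := by
      have h1 : ‖z - ζ‖ < 1 := by simpa [dist_eq_norm] using hz
      linarith [norm_le_norm_add_norm_sub' z ζ]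
    rw [norm_mul, norm_mul, Complex.norm_real, Real.norm_eq_abs, abs_of_nonneg hs0]
    gcongr
    · rw [oscFactor, Complex.norm_exp]
      gcongr
      have : (-Complex.I * T * (s : ℂ) ^ 2 + z * s).re = z.re * s := by
        simp [← Complex.ofReal_pow]
      rw [this]
      have h1 := (Complex.re_le_norm z).trans hz'
      nlinarith [hs'.2, norm_nonneg ζ]
    · exact hs'.2
    · exact hM s hs'
  · have h1 : HasDerivAt (fun z : ℂ => -Complex.I * T * (s : ℂ) ^ 2 + z * s) (s : ℂ) z := by
      simpa using ((hasDerivAt_id z).mul_const (s : ℂ)).const_add (-Complex.I * T * (s : ℂ) ^ 2)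
    refine (h1.cexp.mul_const (g s)).congr_deriv ?_
    simp only [oscFactor]
    ring

theorem norm_oscIntegral_sub_le (hg : ContinuousOn g (Icc (1 / 8 : ℝ) 2)) (T : ℝ) {S : Set ℂ}
    (hS : Convex ℝ S) {B : ℝ} (hB : ∀ ζ ∈ S, ‖oscIntegral (fun s => s * g s) T ζ‖ ≤ B)
    {z w : ℂ} (hz : z ∈ S) (hw : w ∈ S) :
    ‖oscIntegral g T z - oscIntegral g T w‖ ≤ B * ‖z - w‖ :=
  hS.norm_image_sub_le_of_norm_hasDerivWithin_le
    (fun ζ _ => (hasDerivAt_oscIntegral hg T ζ).hasDerivWithinAt) hB hw hz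

/-- Far from the stationary regime `|T| ∼ ρ`, the difference of the oscillatory integrals is
`O(ρ T⁻²)`; in that regime it is `O(ρ |T|^{-3/2})`, and it is always `O(ρ)`. -/
theorem exists_oscIntegral_bounds (hg : ContDiffOn ℝ 2 g (Ioi 0))
    (h0 : ∀ s ∈ Ioo (0 : ℝ) (1 / 4), g s = 0) (h1 : ∀ s, 1 < s → g s = 0) :
    ∃ C : ℝ, 0 ≤ C ∧ ∀ T ρ v σ : ℝ, 0 < v → |T| = v ^ 2 → 0 < ρ → |σ| = 1 →
      let J := oscIntegral g T (Complex.I * (σ * ρ : ℝ)) - oscIntegral g T ((-ρ : ℝ) : ℂ)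
      ‖J‖ ≤ C * ρ ∧
      (1 ≤ v → (ρ ≤ v ^ 2 / 8 ∨ 8 * v ^ 2 ≤ ρ) → ‖J‖ ≤ C * ρ / v ^ 4) ∧
      (1 ≤ v → v ^ 2 / 8 ≤ ρ → ‖J‖ ≤ C * ρ / v ^ 3) := by
  obtain ⟨g₁, g₂, M, h⟩ := IsAmplitude.exists_of_contDiffOn hg h0 h1
  obtain ⟨k₁, k₂, M', h'⟩ := IsAmplitude.exists_of_contDiffOn (g := fun s => s * g s)
    ((Complex.ofRealCLM.contDiff.contDiffOn).mul hg) (fun s hs => by simp [h0 s hs])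
    (fun s hs => by simp [h1 s hs])
  have hM := h.nonneg
  have hM' := h'.nonneg
  refine ⟨1000000 * (M + M'), by positivity, fun T ρ v σ hv hT hρ hσ => ?_⟩
  intro J
  have hT0 : T ≠ 0 := abs_pos.1 (hT ▸ by positivity)
  have hT2 : T ^ 2 = v ^ 4 := by rw [← sq_abs, hT]; ring
  have hσρ : |σ * ρ| = ρ := by rw [abs_mul, hσ, one_mul, abs_of_pos hρ]
  set z : ℂ := Complex.I * (σ * ρ : ℝ) with hz
  set w : ℂ := ((-ρ : ℝ) : ℂ) with hw
  have hzre : z.re = 0 := by simp only [hz, Complex.re_mul_ofReal, Complex.I_re, zero_mul]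
  have hzim : z.im = σ * ρ := by simp only [hz, Complex.im_mul_ofReal, Complex.I_im, one_mul]
  have hwre : w.re = -ρ := Complex.ofReal_re _
  have hwim : w.im = 0 := Complex.ofReal_im _
  have hzw : ‖z - w‖ ≤ 2 * ρ := by
    refine (norm_sub_le _ _).trans ?_
    rw [hz, hw, norm_mul, Complex.norm_I, Complex.norm_real, Complex.norm_real,
      Real.norm_eq_abs, Real.norm_eq_abs, hσρ, abs_neg, abs_of_pos hρ]
    linarith
  have hPim : ∀ (ζ : ℂ) (s : ℝ), (-2 * Complex.I * T * s + ζ).im = -(2 * T * s) + ζ.im := by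
    intro ζ s; simp
  have hP : ∀ (ζ : ℂ) (s : ℝ), |-(2 * T * s) + ζ.im| ≤ ‖-2 * Complex.I * T * s + ζ‖ :=
    fun ζ s => hPim ζ s ▸ Complex.abs_im_le_norm _
  have hTs : ∀ s : ℝ, 0 ≤ s → |2 * T * s| = 2 * v ^ 2 * s := fun s hs => by
    rw [abs_mul, abs_mul, hT, abs_of_nonneg hs, abs_two]
  have hwbound : ‖oscIntegral g T w‖ ≤ 110000 * M / v ^ 4 := by
    rw [← hT2]
    refine norm_oscIntegral_le_div_sq h hT0 (by linarith) fun s hs => ?_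
    refine le_trans ?_ (hP w s)
    have hs0 : 0 ≤ s := by linarith [hs.1]
    rw [hwim, add_zero, abs_neg, hTs s hs0, hT]
    nlinarith [hs.1, sq_nonneg v]
  refine ⟨?_, ?_, ?_⟩
  · have := norm_oscIntegral_sub_le h.continuousOn T (S := {ζ | ζ.re ≤ 0})
      (convex_halfSpace_re_le 0) (B := 2 * M') (fun ζ hζ => norm_oscIntegral_le h' T hζ)
      (z := z) (w := w) hzre.le (show w.re ≤ 0 by linarith)
    refine this.trans ?_
    calc 2 * M' * ‖z - w‖ ≤ 2 * M' * (2 * ρ) := by gcongr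
      _ ≤ _ := by nlinarith [mul_nonneg hM hρ.le, mul_nonneg hM' hρ.le]
  · rintro hv1 (hfar | hfar)
    · have := norm_oscIntegral_sub_le h.continuousOn T
        (S := {ζ | ζ.re ≤ 0} ∩ ({ζ | ζ.im ≤ ρ} ∩ {ζ | -ρ ≤ ζ.im}))
        ((convex_halfSpace_re_le 0).inter ((convex_halfSpace_im_le ρ).inter
          (convex_halfSpace_im_ge (-ρ)))) (B := 110000 * M' / v ^ 4) (fun ζ hζ => by
          rw [← hT2]
          refine norm_oscIntegral_le_div_sq h' hT0 hζ.1 fun s hs => ?_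
          refine le_trans ?_ (hP ζ s)
          have hs0 : 0 ≤ s := by linarith [hs.1]
          have e1 : |ζ.im| ≤ ρ := abs_le.2 ⟨hζ.2.2, hζ.2.1⟩
          have e2 := abs_sub_abs_le_abs_sub (2 * T * s) ζ.im
          rw [hTs s hs0, abs_sub_comm] at e2
          rw [hT, neg_add_eq_sub]
          nlinarith [hs.1, sq_nonneg v])
        (z := z) (w := w)
        ⟨hzre.le, by rw [mem_ofPred_eq, hzim]; exact (le_abs_self _).trans hσρ.le,
          by rw [mem_ofPred_eq, hzim]; exact (abs_le.1 hσρ.le).1⟩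
        ⟨show w.re ≤ 0 by linarith, by rw [mem_ofPred_eq, hwim]; exact hρ.le,
          by rw [mem_ofPred_eq, hwim]; linarith⟩
      refine this.trans ?_
      calc 110000 * M' / v ^ 4 * ‖z - w‖ ≤ 110000 * M' / v ^ 4 * (2 * ρ) := by gcongr
        _ = 220000 * M' * ρ / v ^ 4 := by ring
        _ ≤ _ := by
          refine div_le_div_of_nonneg_right ?_ (by positivity)
          nlinarith [mul_nonneg hM hρ.le, mul_nonneg hM' hρ.le]
    · have hzb : ‖oscIntegral g T z‖ ≤ 110000 * M / v ^ 4 := by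
        rw [← hT2]
        refine norm_oscIntegral_le_div_sq h hT0 hzre.le fun s hs => ?_
        refine le_trans ?_ (hP z s)
        have hs0 : 0 ≤ s := by linarith [hs.1]
        have e2 := abs_sub_abs_le_abs_sub (σ * ρ) (2 * T * s)
        rw [hTs s hs0, hσρ] at e2
        rw [hT, neg_add_eq_sub, hzim]
        nlinarith [hs.2, sq_nonneg v]
      refine (norm_sub_le _ _).trans ((add_le_add hzb hwbound).trans ?_)
      rw [← add_div]
      refine div_le_div_of_nonneg_right ?_ (by positivity)
      have : 1 ≤ ρ := by nlinarith
      nlinarith [mul_nonneg hM (sub_nonneg.2 this), mul_nonneg hM' hρ.le]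
  · intro hv1 hnear
    have hzb := norm_oscIntegral_le_div h hv hT (σ * ρ)
    have hw' : 110000 * M / v ^ 4 ≤ 110000 * M / v := by
      gcongr
      exact le_self_pow₀ hv1 (by norm_num)
    refine (norm_sub_le _ _).trans ((add_le_add hzb (hwbound.trans hw')).trans ?_)
    rw [← add_div, div_le_div_iff₀ hv (by positivity)]
    have h3 : v ^ 2 * M ≤ 8 * ρ * M := by gcongr; linarith
    calc (9 * M + 110000 * M) * v ^ 3 = 110009 * (v ^ 2 * M) * v := by ring
      _ ≤ 110009 * (8 * ρ * M) * v := by gcongr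
      _ ≤ 1000000 * (M + M') * ρ * v := by
        have a1 : 0 ≤ M * ρ * v := by positivity
        have a2 : 0 ≤ M' * ρ * v := by positivity
        nlinarith

/-- Dyadic sums of `min(κ 2^N, (κ 2^N)⁻¹)^δ` are bounded uniformly in the scale `κ`. -/
theorem exists_tsum_min_zpow_le {δ : ℝ} (hδ : 0 < δ) :
    ∃ C : ℝ, 0 ≤ C ∧ ∀ κ : ℝ, 0 < κ →
      Summable (fun N : ℤ => (min (κ * 2 ^ N) (κ * 2 ^ N)⁻¹) ^ δ) ∧
      ∑' N : ℤ, (min (κ * 2 ^ N) (κ * 2 ^ N)⁻¹) ^ δ ≤ C := by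
  set a : ℝ := 2⁻¹ ^ δ with ha
  have ha0 : 0 ≤ a := by positivity
  have ha1 : a < 1 := Real.rpow_lt_one (by norm_num) (by norm_num) hδ
  set f : ℤ → ℝ := fun k => 2 ^ δ * a ^ k.natAbs with hf
  have hfs : Summable f := by
    refine Summable.mul_left _ (Summable.of_nat_of_neg ?_ ?_) <;>
    simpa using summable_geometric_of_lt_one ha0 ha1
  refine ⟨∑' k, f k, tsum_nonneg fun k => by positivity, fun κ hκ => ?_⟩
  obtain ⟨n, hn1, hn2⟩ := exists_mem_Ico_zpow hκ (one_lt_two (α := ℝ))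
  have hle : ∀ N : ℤ, (min (κ * 2 ^ N) (κ * 2 ^ N)⁻¹) ^ δ ≤ f (N + n) := by
    intro N
    have e : f (N + n) = (2 * 2⁻¹ ^ (N + n).natAbs) ^ δ := by
      rw [Real.mul_rpow (by norm_num) (by positivity)]
      simp only [hf, ha]
      rw [← Real.rpow_natCast, ← Real.rpow_natCast, ← Real.rpow_mul (by norm_num), ← Real.rpow_mul (by norm_num),
        mul_comm δ]
    rw [e]
    refine Real.rpow_le_rpow (by positivity) ?_ hδ.le
    have h1 : (2 : ℝ) ^ (N + n) ≤ κ * 2 ^ N := by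
      rw [zpow_add₀ two_ne_zero, mul_comm]; gcongr
    have h2 : κ * 2 ^ N ≤ 2 * 2 ^ (N + n) := by
      rw [zpow_add₀ two_ne_zero]
      rw [zpow_add_one₀ two_ne_zero] at hn2
      calc κ * 2 ^ N ≤ (2 ^ n * 2) * 2 ^ N := by gcongr
        _ = _ := by ring
    rcases le_total 0 (N + n) with hk | hk
    · obtain ⟨k, hk⟩ := Int.eq_ofNat_of_zero_le hk
      rw [hk] at h1 ⊢
      refine (min_le_right _ _).trans ?_
      rw [zpow_natCast] at h1
      calc (κ * 2 ^ N)⁻¹ ≤ ((2 : ℝ) ^ k)⁻¹ := by gcongr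
        _ = 2⁻¹ ^ k := (inv_pow _ _).symm
        _ ≤ 2 * 2⁻¹ ^ k := by linarith [pow_nonneg (by norm_num : (0 : ℝ) ≤ 2⁻¹) k]
        _ = _ := by simp
    · obtain ⟨k, hk⟩ := Int.exists_eq_neg_ofNat hk
      rw [hk] at h2 ⊢
      refine (min_le_left _ _).trans (h2.trans (le_of_eq ?_))
      simp
  have hshift : Summable fun N : ℤ => f (N + n) := (Equiv.addRight n).summable_iff.2 hfs
  have hs := Summable.of_nonneg_of_le (fun N => by positivity) hle hshift
  refine ⟨hs, (hs.tsum_le_tsum hle hshift).trans ?_⟩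
  exact ((Equiv.addRight n).tsum_eq f).le

theorem rpow_mul_le_of_decay {v ρ C q β δ : ℝ} (hv : 0 < v) (hρ : 0 < ρ) (hC : 0 ≤ C)
    (hδ : 0 < δ) (hδ1 : δ ≤ 1) (hδβ : δ ≤ β) (hβ : β ≤ 3) (hq : q ≤ C)
    (hfar : 1 ≤ v → (ρ ≤ v ^ 2 / 8 ∨ 8 * v ^ 2 ≤ ρ) → q ≤ C / v ^ 4)
    (hnear : 1 ≤ v → v ^ 2 / 8 ≤ ρ → q ≤ C / v ^ 3) :
    v ^ β * q ≤ 8 * C * ((min v v⁻¹) ^ δ + (min (v ^ 2 / ρ) (v ^ 2 / ρ)⁻¹) ^ δ) := by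
  have hm1 : 0 ≤ (min v v⁻¹) ^ δ := by positivity
  have hm2 : 0 ≤ (min (v ^ 2 / ρ) (v ^ 2 / ρ)⁻¹) ^ δ := by positivity
  suffices h : v ^ β * q ≤ C * (min v v⁻¹) ^ δ ∨
      v ^ β * q ≤ 8 * C * (min (v ^ 2 / ρ) (v ^ 2 / ρ)⁻¹) ^ δ by
    have a1 := mul_nonneg hC hm1
    have a2 := mul_nonneg hC hm2
    rcases h with h | h <;> nlinarith
  rcases le_total v 1 with hv1 | hv1
  · left
    rw [min_eq_left (hv1.trans ((one_le_inv₀ hv).2 hv1)), mul_comm]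
    have := Real.rpow_le_rpow_of_exponent_ge hv hv1 hδβ
    gcongr
  · by_cases hf : ρ ≤ v ^ 2 / 8 ∨ 8 * v ^ 2 ≤ ρ
    · left
      rw [min_eq_right ((inv_le_one_of_one_le₀ hv1).trans hv1), Real.inv_rpow hv.le,
        ← Real.rpow_neg hv.le]
      calc v ^ β * q ≤ v ^ β * (C / v ^ 4) := by gcongr; exact hfar hv1 hf
        _ = C * v ^ (β - 4) := by
          rw [Real.rpow_sub hv, show (4 : ℝ) = ((4 : ℕ) : ℝ) by norm_num, Real.rpow_natCast]; ring
        _ ≤ C * v ^ (-δ) :=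
          mul_le_mul_of_nonneg_left
            (Real.rpow_le_rpow_of_exponent_le hv1 (by linarith)) hC
    · right
      push Not at hf
      have h8 : (1 / 8 : ℝ) ≤ min (v ^ 2 / ρ) (v ^ 2 / ρ)⁻¹ := by
        rw [inv_div]
        refine le_min ?_ ?_
        · rw [div_le_div_iff₀ (by norm_num) hρ]; linarith
        · rw [div_le_div_iff₀ (by norm_num) (by positivity)]; linarith
      have h9 : (1 / 8 : ℝ) ≤ (min (v ^ 2 / ρ) (v ^ 2 / ρ)⁻¹) ^ δ := by
        calc (1 / 8 : ℝ) = (1 / 8 : ℝ) ^ (1 : ℝ) := (Real.rpow_one _).symm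
          _ ≤ (1 / 8 : ℝ) ^ δ :=
            Real.rpow_le_rpow_of_exponent_ge (by norm_num) (by norm_num) hδ1
          _ ≤ _ := Real.rpow_le_rpow (by norm_num) h8 hδ.le
      calc v ^ β * q ≤ v ^ β * (C / v ^ 3) := by gcongr; exact hnear hv1 hf.1.le
        _ ≤ v ^ (3 : ℝ) * (C / v ^ 3) :=
          mul_le_mul_of_nonneg_right (Real.rpow_le_rpow_of_exponent_le hv1 hβ) (by positivity)
        _ = C := by
          rw [show (3 : ℝ) = ((3 : ℕ) : ℝ) by norm_num, Real.rpow_natCast]; field_simp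
        _ ≤ _ := by nlinarith

/-- The amplitude `s ^ (1 + 2 α) (φ(s) - φ(2 s))` of a rescaled dyadic piece. -/
noncomputable def dyadicAmplitude (φ : ℝ → ℝ) (α : ℝ) (s : ℝ) : ℂ :=
  ((s ^ (1 + 2 * α) * (φ s - φ (2 * s)) : ℝ) : ℂ)

theorem contDiffOn_dyadicAmplitude {φ : ℝ → ℝ} (hφ : ContDiff ℝ (⊤ : ℕ∞) φ) (α : ℝ) :
    ContDiffOn ℝ 2 (dyadicAmplitude φ α) (Ioi 0) := by
  have hφ2 : ContDiff ℝ 2 φ := mod_cast contDiff_infty.1 hφ 2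
  refine Complex.ofRealCLM.contDiff.comp_contDiffOn (ContDiffOn.mul ?_ ?_)
  · exact contDiffOn_id.rpow_const_of_ne fun s hs => ne_of_gt hs
  · exact (hφ2.sub (hφ2.comp (contDiff_const.mul contDiff_id))).contDiffOn

theorem dyadicAmplitude_eq_zero_of_lt {φ : ℝ → ℝ} (hφ1 : ∀ s, |s| ≤ 1 / 2 → φ s = 1) (α : ℝ) :
    ∀ s ∈ Ioo (0 : ℝ) (1 / 4), dyadicAmplitude φ α s = 0 := by
  intro s hs
  have h1 := hφ1 s (by rw [abs_of_pos hs.1]; linarith [hs.2])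
  have h2 := hφ1 (2 * s) (by rw [abs_of_pos (by linarith [hs.1])]; linarith [hs.2])
  simp [dyadicAmplitude, h1, h2]

theorem dyadicAmplitude_eq_zero_of_gt {φ : ℝ → ℝ} (hφ0 : ∀ s, 1 ≤ |s| → φ s = 0) (α : ℝ) :
    ∀ s, 1 < s → dyadicAmplitude φ α s = 0 := by
  intro s hs
  have h1 := hφ0 s (by rw [abs_of_pos (by linarith)]; exact hs.le)
  have h2 := hφ0 (2 * s) (by rw [abs_of_pos (by linarith)]; linarith)
  simp [dyadicAmplitude, h1, h2]

theorem oscIntegral_eq_setIntegral (T : ℝ) (ζ : ℂ)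
    (h0 : ∀ s ∈ Ioo (0 : ℝ) (1 / 4), g s = 0) (h1 : ∀ s, 1 < s → g s = 0) :
    oscIntegral g T ζ = ∫ s in Ioi (0 : ℝ), oscFactor T ζ s * g s := by
  rw [oscIntegral, intervalIntegral.integral_of_le (by norm_num)]
  symm
  refine setIntegral_eq_of_subset_of_forall_sdiff_eq_zero measurableSet_Ioi
    (fun s hs => lt_trans (by norm_num) hs.1) fun s hs => ?_
  rcases lt_or_ge 1 s with h | h
  · rw [h1 s h, mul_zero]
  · rw [h0 s ⟨hs.1, lt_of_not_ge fun h' => hs.2 ⟨by linarith, by linarith⟩⟩, mul_zero]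

theorem integral_dyadic_eq {φ : ℝ → ℝ} (hφ : ContDiff ℝ (⊤ : ℕ∞) φ)
    (hφ1 : ∀ s, |s| ≤ 1 / 2 → φ s = 1) (hφ0 : ∀ s, 1 ≤ |s| → φ s = 0) (α t sgn : ℝ)
    {x y : EuclideanSpace ℝ (Fin 3)} (hxy : x ≠ y) (N : ℤ) {a : ℝ} (ha : a = 2 ^ N) :
    (∫ lam in Set.Ioi (0 : ℝ),
          Complex.exp (-Complex.I * (t : ℂ) * (lam : ℂ) ^ 2) *
            ((lam ^ (3 + 2 * α) : ℝ) : ℂ) *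
            ((φ ((2 : ℝ) ^ (-N) * lam) - φ ((2 : ℝ) ^ (-N + 1) * lam) : ℝ) : ℂ) *
            R0ker sgn lam x y) =
      ((a ^ (2 + 2 * α) / (8 * π * ‖x - y‖) : ℝ) : ℂ) *
        (oscIntegral (dyadicAmplitude φ α) (t * a ^ 2) (Complex.I * (sgn * (a * ‖x - y‖) : ℝ)) -
          oscIntegral (dyadicAmplitude φ α) (t * a ^ 2) ((-(a * ‖x - y‖) : ℝ) : ℂ)) := by
  have ha0 : 0 < a := ha ▸ by positivity
  have hr : 0 < ‖x - y‖ := norm_pos_iff.2 (sub_ne_zero.2 hxy)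
  set r := ‖x - y‖ with hrdef
  set T := t * a ^ 2 with hT
  have hz := dyadicAmplitude_eq_zero_of_lt hφ1 α
  have hz' := dyadicAmplitude_eq_zero_of_gt hφ0 α
  have hcd := contDiffOn_dyadicAmplitude hφ α
  have hsubset : Icc (1 / 8 : ℝ) 2 ⊆ Ioi 0 := fun s hs => lt_of_lt_of_le (by norm_num) hs.1
  set z : ℂ := Complex.I * (sgn * (a * r) : ℝ) with hzdef
  set w : ℂ := ((-(a * r) : ℝ) : ℂ) with hwdef
  have hint : ∀ ζ, IntegrableOn (fun s => oscFactor T ζ s * dyadicAmplitude φ α s) (Ioi 0) := by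
    intro ζ
    have h1 : IntegrableOn (fun s => oscFactor T ζ s * dyadicAmplitude φ α s) (Icc (1 / 8) 2) :=
      ((continuous_oscFactor T ζ).continuousOn.mul
        (hcd.continuousOn.mono hsubset)).integrableOn_compact isCompact_Icc
    refine h1.of_forall_sdiff_eq_zero measurableSet_Ioi fun s hs => ?_
    rcases lt_or_ge 1 s with h | h
    · rw [hz' s h, mul_zero]
    · rw [hz s ⟨hs.1, lt_of_not_ge fun h' => hs.2 ⟨by linarith, by linarith⟩⟩, mul_zero]
  rw [oscIntegral_eq_setIntegral T z hz hz', oscIntegral_eq_setIntegral T w hz hz',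
    ← integral_sub (hint z) (hint w), ← integral_const_mul]
  have hscale := integral_comp_mul_left_Ioi' (fun lam : ℝ =>
          Complex.exp (-Complex.I * (t : ℂ) * (lam : ℂ) ^ 2) *
            ((lam ^ (3 + 2 * α) : ℝ) : ℂ) *
            ((φ ((2 : ℝ) ^ (-N) * lam) - φ ((2 : ℝ) ^ (-N + 1) * lam) : ℝ) : ℂ) *
            R0ker sgn lam x y) 0 ha0
  rw [mul_zero] at hscale
  rw [← hscale, ← integral_smul]
  refine setIntegral_congr_fun measurableSet_Ioi fun s hs => ?_
  have hs0 : 0 < s := hs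
  have e1 : (2 : ℝ) ^ (-N) * (a * s) = s := by
    rw [ha, zpow_neg]; field_simp
  have e2 : (2 : ℝ) ^ (-N + 1) * (a * s) = 2 * s := by
    rw [zpow_add₀ two_ne_zero, zpow_one, mul_right_comm, e1, mul_comm]
  have e3 : (a * s) ^ (3 + 2 * α) = (a ^ (2 + 2 * α) * a) * (s ^ (1 + 2 * α) * s ^ 2) := by
    rw [Real.mul_rpow ha0.le hs0.le, ← Real.rpow_add_one ha0.ne', ← Real.rpow_natCast s 2,
      ← Real.rpow_add hs0]
    congr 2 <;> push_cast <;> ring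
  simp only [e1, e2, e3, R0ker, ← hrdef, Complex.real_smul, oscFactor, dyadicAmplitude,
    Complex.exp_add]
  have x1 : Complex.exp (-Complex.I * t * ((a * s : ℝ) : ℂ) ^ 2) =
      Complex.exp (-Complex.I * T * (s : ℂ) ^ 2) := by
    congr 1; rw [hT]; push_cast; ring
  have x2 : Complex.exp (sgn * Complex.I * ((a * s : ℝ) : ℂ) * r) = Complex.exp (z * s) := by
    congr 1; rw [hzdef]; push_cast; ring
  have x3 : Complex.exp (-(((a * s : ℝ) : ℂ) * r)) = Complex.exp (w * s) := by
    congr 1; rw [hwdef]; push_cast; ring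
  rw [x1, x2, x3]
  have ca : (a : ℂ) ≠ 0 := by exact_mod_cast ha0.ne'
  have cs : (s : ℂ) ≠ 0 := by exact_mod_cast hs0.ne'
  have cr : (r : ℂ) ≠ 0 := by exact_mod_cast hr.ne'
  have cpi : (π : ℂ) ≠ 0 := by exact_mod_cast pi_ne_zero
  push_cast
  field_simp
  ring

/-- summed-up dyadic estimates for the free evolution kernel: the sum over
`N ∈ ℤ` of the absolute values of the dyadic pieces is `≲ |t|^{-(3+2α)/2}`; in particular
the Littlewood–Paley regularized integral (the sum of the dyadic pieces) converges absolutely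
with the same bound, uniformly in `x ≠ y`. -/
theorem stmt2 (φ : ℝ → ℝ) (hφs : ContDiff ℝ (⊤ : ℕ∞) φ) (hφc : HasCompactSupport φ)
    (hφe : ∀ s, φ (-s) = φ s) (hφ1 : ∀ s, |s| ≤ 1 / 2 → φ s = 1)
    (hφ0 : ∀ s, 1 ≤ |s| → φ s = 0)
    (α : ℝ) (hα1 : -(3 / 2 : ℝ) < α) (hα2 : α ≤ 0) :
    ∃ C : ℝ, 0 < C ∧ ∀ t : ℝ, t ≠ 0 →
      ∀ x y : EuclideanSpace ℝ (Fin 3), x ≠ y → ∀ sgn : ℝ, (sgn = 1 ∨ sgn = -1) →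
      let I : ℤ → ℂ := fun N =>
        ∫ lam in Set.Ioi (0 : ℝ),
          Complex.exp (-Complex.I * (t : ℂ) * (lam : ℂ) ^ 2) *
            ((lam ^ (3 + 2 * α) : ℝ) : ℂ) *
            ((φ ((2 : ℝ) ^ (-N) * lam) - φ ((2 : ℝ) ^ (-N + 1) * lam) : ℝ) : ℂ) *
            R0ker sgn lam x y
      Summable (fun N : ℤ => ‖I N‖) ∧
      (∑' N : ℤ, ‖I N‖) ≤ C * |t| ^ (-(3 + 2 * α) / 2) ∧
      ‖∑' N : ℤ, I N‖ ≤ C * |t| ^ (-(3 + 2 * α) / 2) := by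
  set β : ℝ := 3 + 2 * α with hβ
  have hβ0 : 0 < β := by linarith
  set δ : ℝ := min β 1 with hδ
  have hδ0 : 0 < δ := lt_min hβ0 one_pos
  obtain ⟨C, hC, hJ⟩ := exists_oscIntegral_bounds (contDiffOn_dyadicAmplitude hφs α)
    (dyadicAmplitude_eq_zero_of_lt hφ1 α) (dyadicAmplitude_eq_zero_of_gt hφ0 α)
  obtain ⟨S, hS, hsum⟩ := exists_tsum_min_zpow_le hδ0
  refine ⟨8 * C * (S + S) + 1, by positivity, fun t ht x y hxy sgn hsgn => ?_⟩
  intro I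
  have ht0 : 0 < |t| := abs_pos.2 ht
  set r := ‖x - y‖ with hr
  have hr0 : 0 < r := norm_pos_iff.2 (sub_ne_zero.2 hxy)
  set A : ℝ := |t| ^ (-β / 2) with hA
  have hA0 : 0 < A := by positivity
  set m : ℝ → ℝ := fun u => (min u u⁻¹) ^ δ with hm
  have hbound : ∀ N : ℤ, ‖I N‖ ≤
      A * (8 * C * (m (√|t| * 2 ^ N) + m (|t| / r * 2 ^ N))) := by
    intro N
    set a : ℝ := 2 ^ N with ha
    have ha0 : 0 < a := by positivity
    have hv0 : 0 < √|t| * a := by positivity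
    have hv2 : (√|t| * a) ^ 2 = |t| * a ^ 2 := by rw [mul_pow, Real.sq_sqrt ht0.le]
    have hT : |t * a ^ 2| = (√|t| * a) ^ 2 := by rw [hv2, abs_mul, abs_of_pos (pow_pos ha0 2)]
    have hρ0 : 0 < a * r := by positivity
    have hsgn1 : |sgn| = 1 := by rcases hsgn with rfl | rfl <;> simp
    obtain ⟨j0, j1, j2⟩ := hJ (t * a ^ 2) (a * r) (√|t| * a) sgn hv0 hT hρ0 hsgn1
    have hI : I N = _ := integral_dyadic_eq hφs hφ1 hφ0 α t sgn hxy N ha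
    rw [← hr] at hI
    set J := oscIntegral (dyadicAmplitude φ α) (t * a ^ 2) (Complex.I * (sgn * (a * r) : ℝ)) -
          oscIntegral (dyadicAmplitude φ α) (t * a ^ 2) ((-(a * r) : ℝ) : ℂ) with hJdef
    have key := rpow_mul_le_of_decay (q := ‖J‖ / (a * r)) (β := β) hv0 hρ0 hC hδ0
      (min_le_right _ _) (min_le_left _ _) (by linarith) ((div_le_iff₀ hρ0).2 j0)
      (fun h1 h2 => (div_le_iff₀ hρ0).2 ((j1 h1 h2).trans_eq (by ring)))
      (fun h1 h2 => (div_le_iff₀ hρ0).2 ((j2 h1 h2).trans_eq (by ring)))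
    have e1 : (√|t| * a) ^ 2 / (a * r) = |t| / r * a := by rw [hv2]; field_simp
    rw [e1] at key
    have e2 : A * (√|t| * a) ^ β = a ^ β := by
      rw [Real.mul_rpow (Real.sqrt_nonneg _) ha0.le, Real.sqrt_eq_rpow, ← Real.rpow_mul ht0.le,
        ← mul_assoc, hA, ← Real.rpow_add ht0, show -β / 2 + 1 / 2 * β = 0 by ring,
        Real.rpow_zero, one_mul]
    have e3 : a ^ β = a ^ (2 + 2 * α) * a := by
      rw [← Real.rpow_add_one ha0.ne']; congr 1; rw [hβ]; ring
    have h8 : 1 ≤ 8 * π := by linarith [pi_gt_three]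
    calc ‖I N‖ = a ^ (2 + 2 * α) / (8 * π * r) * ‖J‖ := by
          rw [hI, norm_mul, Complex.norm_real, Real.norm_of_nonneg (by positivity)]
      _ ≤ a ^ (2 + 2 * α) / (1 * r) * ‖J‖ := by gcongr
      _ = A * ((√|t| * a) ^ β * (‖J‖ / (a * r))) := by
          rw [← mul_assoc, e2, e3]; field_simp
      _ ≤ _ := by gcongr
  obtain ⟨s1, b1⟩ := hsum (√|t|) (by positivity)
  obtain ⟨s2, b2⟩ := hsum (|t| / r) (by positivity)
  have hs := ((s1.add s2).mul_left (8 * C)).mul_left A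
  have hIs : Summable fun N => ‖I N‖ := Summable.of_nonneg_of_le (fun _ => norm_nonneg _) hbound hs
  have hle : ∑' N, ‖I N‖ ≤ (8 * C * (S + S) + 1) * A := by
    refine (hIs.tsum_le_tsum hbound hs).trans ?_
    rw [tsum_mul_left, tsum_mul_left, s1.tsum_add s2, mul_comm]
    gcongr
    refine le_trans ?_ (le_add_of_nonneg_right zero_le_one)
    gcongr
  exact ⟨hIs, hle, (norm_tsum_le_tsum_norm hIs).trans hle⟩
end
end

section
/- There is a constant C > 0 such that for every t ≠ 0 and every Schwartz function g on ℝ³, the function ((sin(tΔ)/Δ) g)(x) := (2π)^{−3} ∫_{ℝ³} e^{i x·ξ} (sin(t|ξ|²)/|ξ|²) ĝ(ξ) dξ, where ĝ(ξ) := ∫_{ℝ³} e^{−i y·ξ} g(y) dy, satisfies ‖(sin(tΔ)/Δ) g‖_{L^∞(ℝ³)} ≤ C |t|^{−1/2} ‖g‖_{L¹(ℝ³)}. -/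
noncomputable section

open MeasureTheory Real
open scoped RealInnerProductSpace

section OscillatoryGaussian

variable {V : Type*} [NormedAddCommGroup V] [InnerProductSpace ℝ V] [FiniteDimensional ℝ V]
  [MeasurableSpace V] [BorelSpace V]

/-- The Fourier transform of a complex Gaussian `exp(-b‖v‖²)` is bounded by `(π/|b|)^(n/2)`. -/
theorem norm_integral_cexp_neg_mul_sq_norm_add_I_le {b : ℂ} (hb : 0 < b.re) (w : V) :
    ‖∫ v : V, Complex.exp (-b * ‖v‖ ^ 2 + Complex.I * ⟪w, v⟫)‖
      ≤ (π / ‖b‖) ^ ((Module.finrank ℝ V : ℝ) / 2) := by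
  have hpow : ‖(π / b : ℂ) ^ ((Module.finrank ℝ V : ℂ) / 2)‖
      = (π / ‖b‖) ^ ((Module.finrank ℝ V : ℝ) / 2) := by
    have := Complex.norm_cpow_real (π / b : ℂ) ((Module.finrank ℝ V : ℝ) / 2)
    push_cast at this
    rw [this, norm_div, Complex.norm_of_nonneg pi_pos.le]
  have hexp : ‖Complex.exp (Complex.I ^ 2 * (‖w‖ : ℂ) ^ 2 / (4 * b))‖ ≤ 1 := by
    have h : Complex.I ^ 2 * (‖w‖ : ℂ) ^ 2 / (4 * b) = ((-(‖w‖ ^ 2 / 4) : ℝ) : ℂ) * b⁻¹ := by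
      rw [Complex.I_sq, div_eq_mul_inv, mul_inv]
      push_cast
      ring
    rw [Complex.norm_exp, h, Complex.re_ofReal_mul, Complex.inv_re, exp_le_one_iff]
    exact mul_nonpos_of_nonpos_of_nonneg (by simp; positivity)
      (div_nonneg hb.le (Complex.normSq_nonneg _))
  rw [GaussianFourier.integral_cexp_neg_mul_sq_norm_add hb, norm_mul, hpow]
  exact mul_le_of_le_one_right (by positivity) hexp

theorem cexp_I_mul_exp_neg_mul_sin_eq (u t a r : ℝ) :
    Complex.exp (Complex.I * a) * ((exp (-(r ^ 2 * u)) * sin (t * r ^ 2) : ℝ) : ℂ)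
      = (Complex.exp (-(u + t * Complex.I) * r ^ 2 + Complex.I * a)
          - Complex.exp (-(u - t * Complex.I) * r ^ 2 + Complex.I * a)) * (Complex.I / 2) := by
  push_cast
  rw [Complex.sin, show -(u + t * Complex.I) * (r : ℂ) ^ 2 + Complex.I * a
      = Complex.I * a + (-(r ^ 2 * u)) + -(t * r ^ 2) * Complex.I by ring,
    show -(u - t * Complex.I) * (r : ℂ) ^ 2 + Complex.I * a
      = Complex.I * a + (-(r ^ 2 * u)) + (t * r ^ 2) * Complex.I by ring]
  simp only [Complex.exp_add]
  ring

theorem norm_add_mul_I_ge_half {u t : ℝ} (hu : 0 < u) :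
    (u + |t|) / 2 ≤ ‖(u + t * Complex.I : ℂ)‖ := by
  have h₁ := Complex.abs_re_le_norm (u + t * Complex.I : ℂ)
  have h₂ := Complex.abs_im_le_norm (u + t * Complex.I : ℂ)
  simp [abs_of_pos hu] at h₁ h₂
  linarith

theorem integrable_cexp_I_inner_mul_exp_neg_mul_sin {u : ℝ} (hu : 0 < u) (t : ℝ) (w : V) :
    Integrable fun ξ : V ↦ Complex.exp (Complex.I * (⟪w, ξ⟫ : ℝ)) *
      ((exp (-(‖ξ‖ ^ 2 * u)) * sin (t * ‖ξ‖ ^ 2) : ℝ) : ℂ) := by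
  simp_rw [cexp_I_mul_exp_neg_mul_sin_eq]
  exact ((GaussianFourier.integrable_cexp_neg_mul_sq_norm_add (by simpa) _ w).sub
    (GaussianFourier.integrable_cexp_neg_mul_sq_norm_add (by simpa) _ w)).mul_const _

theorem norm_integral_cexp_I_inner_mul_exp_neg_mul_sin_le {u : ℝ} (hu : 0 < u) (t : ℝ) (w : V) :
    ‖∫ ξ : V, Complex.exp (Complex.I * (⟪w, ξ⟫ : ℝ)) *
      ((exp (-(‖ξ‖ ^ 2 * u)) * sin (t * ‖ξ‖ ^ 2) : ℝ) : ℂ)‖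
      ≤ (2 * π / (u + |t|)) ^ ((Module.finrank ℝ V : ℝ) / 2) := by
  have key (s : ℝ) (hs : |s| = |t|) :
      ‖∫ v : V, Complex.exp (-(u + s * Complex.I) * ‖v‖ ^ 2 + Complex.I * ⟪w, v⟫)‖
        ≤ (2 * π / (u + |t|)) ^ ((Module.finrank ℝ V : ℝ) / 2) := by
    refine (norm_integral_cexp_neg_mul_sq_norm_add_I_le (by simpa) w).trans ?_
    refine rpow_le_rpow (by positivity) ?_ (by positivity)
    rw [show 2 * π / (u + |t|) = π / ((u + |t|) / 2) by field_simp, ← hs]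
    gcongr
    exact norm_add_mul_I_ge_half hu
  have h₁ := key t rfl
  have h₂ := key (-t) (abs_neg t)
  simp only [Complex.ofReal_neg, neg_mul (t : ℂ), ← sub_eq_add_neg] at h₂
  simp_rw [cexp_I_mul_exp_neg_mul_sin_eq]
  rw [integral_mul_const, integral_sub
    (GaussianFourier.integrable_cexp_neg_mul_sq_norm_add (by simpa) _ w)
    (GaussianFourier.integrable_cexp_neg_mul_sq_norm_add (by simpa) _ w), norm_mul]
  have h₃ := norm_sub_le
    (∫ v : V, Complex.exp (-(u + t * Complex.I) * ‖v‖ ^ 2 + Complex.I * ⟪w, v⟫))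
    (∫ v : V, Complex.exp (-(u - t * Complex.I) * ‖v‖ ^ 2 + Complex.I * ⟪w, v⟫))
  have h₄ : ‖Complex.I / 2‖ = 1 / 2 := by simp
  rw [h₄]
  linarith

/-- The operator with Fourier symbol `exp(-u|ξ|²) sin(t|ξ|²)` is bounded from `L¹` to `L^∞`. -/
theorem norm_integral_exp_neg_mul_sin_mul_fourier_le {u : ℝ} (hu : 0 < u) (t : ℝ) {g : V → ℂ}
    (hg : Integrable g) (x : V) :
    ‖∫ ξ : V, Complex.exp (Complex.I * (⟪x, ξ⟫ : ℝ)) *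
        ((exp (-(‖ξ‖ ^ 2 * u)) * sin (t * ‖ξ‖ ^ 2) : ℝ) : ℂ) *
        ∫ y : V, Complex.exp (-Complex.I * (⟪y, ξ⟫ : ℝ)) * g y‖
      ≤ (2 * π / (u + |t|)) ^ ((Module.finrank ℝ V : ℝ) / 2) * ∫ y : V, ‖g y‖ := by
  have hprod : Integrable (fun p : V × V ↦
      Complex.exp (Complex.I * (⟪x, p.1⟫ : ℝ)) *
        ((exp (-(‖p.1‖ ^ 2 * u)) * sin (t * ‖p.1‖ ^ 2) : ℝ) : ℂ) *
        (Complex.exp (-Complex.I * (⟪p.2, p.1⟫ : ℝ)) * g p.2)) (volume.prod volume) := by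
    refine (((integrable_cexp_I_inner_mul_exp_neg_mul_sin hu t x).mul_prod hg).bdd_mul
      (f := fun p : V × V ↦ Complex.exp (-Complex.I * (⟪p.2, p.1⟫ : ℝ))) (c := 1)
      (by fun_prop) (.of_forall fun p ↦ ?_)).congr (.of_forall fun p ↦ ?_)
    · simp [Complex.norm_exp]
    · simp only
      ring
  rw [← integral_const_mul]
  simp_rw [← integral_const_mul (Complex.exp _ * _)]
  rw [integral_integral_swap hprod]
  refine norm_integral_le_of_norm_le (hg.norm.const_mul _) (.of_forall fun y ↦ ?_)
  have h : ∀ ξ : V, Complex.exp (Complex.I * (⟪x, ξ⟫ : ℝ)) *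
        ((exp (-(‖ξ‖ ^ 2 * u)) * sin (t * ‖ξ‖ ^ 2) : ℝ) : ℂ) *
        (Complex.exp (-Complex.I * (⟪y, ξ⟫ : ℝ)) * g y)
      = Complex.exp (Complex.I * (⟪x - y, ξ⟫ : ℝ)) *
        ((exp (-(‖ξ‖ ^ 2 * u)) * sin (t * ‖ξ‖ ^ 2) : ℝ) : ℂ) * g y := by
    intro ξ
    rw [inner_sub_left, Complex.ofReal_sub, mul_sub, sub_eq_add_neg, Complex.exp_add,
      neg_mul Complex.I]
    ring
  simp_rw [h]
  rw [integral_mul_const, norm_mul]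
  gcongr
  exact norm_integral_cexp_I_inner_mul_exp_neg_mul_sin_le hu t (x - y)

end OscillatoryGaussian

theorem integral_Ioi_zero_mul_exp_neg_mul {a : ℝ} (ha : 0 < a) :
    ∫ u in Set.Ioi (0 : ℝ), a * exp (-(a * u)) = 1 := by
  simp_rw [← neg_mul]
  rw [integral_const_mul, integral_exp_mul_Ioi (neg_lt_zero.2 ha)]
  simp [ha.ne']

theorem integral_Ioi_zero_add_rpow {s a : ℝ} (hs : s < -1) (ha : 0 < a) :
    ∫ u in Set.Ioi (0 : ℝ), (u + a) ^ s = -a ^ (s + 1) / (s + 1) := by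
  have h := (measurePreserving_add_right (volume : Measure ℝ) a).setIntegral_preimage_emb
    (measurableEmbedding_addRight a) (fun v ↦ v ^ s) (Set.Ioi a)
  rw [integral_Ioi_rpow_of_lt hs ha] at h
  simpa using h

/-- Averaging over the exponential distributions of parameter `ρ x`: if `ρ > 0` almost everywhere
and the integrals of `ρ exp(-u ρ) f` are dominated by an integrable function of `u > 0`, so is the
integral of `f`. -/
theorem norm_integral_le_of_exp_average {X : Type*} [MeasurableSpace X] {μ : Measure X} [SFinite μ]
    {f : X → ℂ} (hf : Integrable f μ) {ρ : X → ℝ} (hρ : Measurable ρ) (hpos : ∀ᵐ x ∂μ, 0 < ρ x)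
    {B : ℝ → ℝ} (hB : IntegrableOn B (Set.Ioi 0))
    (hle : ∀ u, 0 < u → ‖∫ x, ((ρ x * exp (-(ρ x * u)) : ℝ) : ℂ) * f x ∂μ‖ ≤ B u) :
    ‖∫ x, f x ∂μ‖ ≤ ∫ u in Set.Ioi 0, B u := by
  have hint : Integrable (fun p : X × ℝ ↦ ((ρ p.1 * exp (-(ρ p.1 * p.2)) : ℝ) : ℂ) * f p.1)
      (μ.prod (volume.restrict (Set.Ioi 0))) := by
    rw [integrable_prod_iff]
    · constructor
      · filter_upwards [hpos] with x hx
        refine Integrable.mul_const (Integrable.ofReal (Integrable.const_mul ?_ _)) _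
        simpa [IntegrableOn] using integrableOn_exp_mul_Ioi (neg_lt_zero.2 hx) 0
      · refine hf.norm.congr ?_
        filter_upwards [hpos] with x hx
        have h : ∀ u, ‖((ρ x * exp (-(ρ x * u)) : ℝ) : ℂ) * f x‖
            = ρ x * exp (-(ρ x * u)) * ‖f x‖ := fun u ↦ by
          rw [norm_mul, Complex.norm_of_nonneg (by positivity)]
        simp_rw [h]
        rw [integral_mul_const, integral_Ioi_zero_mul_exp_neg_mul hx, one_mul]
    · refine AEStronglyMeasurable.mul (Measurable.aestronglyMeasurable (by fun_prop)) ?_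
      exact hf.aestronglyMeasurable.comp_fst
  have hrep : ∫ x, f x ∂μ
      = ∫ x, (∫ u : ℝ in Set.Ioi 0, ((ρ x * exp (-(ρ x * u)) : ℝ) : ℂ) * f x) ∂μ := by
    refine integral_congr_ae ?_
    filter_upwards [hpos] with x hx
    rw [integral_mul_const, integral_complex_ofReal, integral_Ioi_zero_mul_exp_neg_mul hx]
    simp
  rw [hrep, integral_integral_swap hint]
  refine norm_integral_le_of_norm_le hB ?_
  filter_upwards [ae_restrict_mem measurableSet_Ioi] with u hu using hle u hu

/-- the free beam propagator `sin(tΔ)/Δ`, defined on Schwartz functions via the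
Fourier multiplier with symbol `sin(t|ξ|²)/|ξ|²`, maps `L¹(ℝ³) → L^∞(ℝ³)` with norm
`≲ |t|^{-1/2}`. -/
theorem stmt4 :
    ∃ C : ℝ, 0 < C ∧ ∀ t : ℝ, t ≠ 0 →
      ∀ g : SchwartzMap (EuclideanSpace ℝ (Fin 3)) ℂ, ∀ x : EuclideanSpace ℝ (Fin 3),
      ‖((((2 * Real.pi) ^ 3)⁻¹ : ℝ) : ℂ) *
          ∫ ξ : EuclideanSpace ℝ (Fin 3),
            Complex.exp (Complex.I * ((⟪x, ξ⟫ : ℝ) : ℂ)) *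
              ((Real.sin (t * ‖ξ‖ ^ 2) / ‖ξ‖ ^ 2 : ℝ) : ℂ) *
              ∫ y : EuclideanSpace ℝ (Fin 3),
                Complex.exp (-Complex.I * ((⟪y, ξ⟫ : ℝ) : ℂ)) * g y‖
        ≤ C * |t| ^ (-(1 : ℝ) / 2) * ∫ y : EuclideanSpace ℝ (Fin 3), ‖g y‖ := by
  refine ⟨((2 * π) ^ 3)⁻¹ * (2 * (2 * π) ^ ((3 : ℝ) / 2)), by positivity, fun t ht g x ↦ ?_⟩
  have ht' : 0 < |t| := abs_pos.2 ht
  rw [norm_mul, Complex.norm_of_nonneg (by positivity), mul_assoc, mul_assoc]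
  refine mul_le_mul_of_nonneg_left ?_ (by positivity)
  have hN : 0 ≤ ∫ y : EuclideanSpace ℝ (Fin 3), ‖g y‖ := integral_nonneg fun _ ↦ norm_nonneg _
  set N := ∫ y : EuclideanSpace ℝ (Fin 3), ‖g y‖
  by_cases hf : Integrable fun ξ : EuclideanSpace ℝ (Fin 3) ↦
      Complex.exp (Complex.I * ((⟪x, ξ⟫ : ℝ) : ℂ)) *
        ((Real.sin (t * ‖ξ‖ ^ 2) / ‖ξ‖ ^ 2 : ℝ) : ℂ) *
        ∫ y : EuclideanSpace ℝ (Fin 3), Complex.exp (-Complex.I * ((⟪y, ξ⟫ : ℝ) : ℂ)) * g y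
  swap
  · rw [integral_undef hf, norm_zero]
    positivity
  have hne : ∀ᵐ ξ : EuclideanSpace ℝ (Fin 3), 0 < ‖ξ‖ ^ 2 := by
    filter_upwards [Measure.ae_ne volume 0] with ξ hξ
    positivity
  have hB : IntegrableOn (fun u : ℝ ↦ (2 * π) ^ ((3 : ℝ) / 2) * N * (u + |t|) ^ (-(3 : ℝ) / 2))
      (Set.Ioi 0) :=
    (integrableOn_add_rpow_Ioi_of_lt (by norm_num) (by linarith)).const_mul _
  refine (norm_integral_le_of_exp_average hf (by fun_prop) hne hB fun u hu ↦ ?_).trans_eq ?_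
  · have h := norm_integral_exp_neg_mul_sin_mul_fourier_le hu t (g.integrable (μ := volume)) x
    rw [finrank_euclideanSpace_fin, div_rpow (by positivity) (by positivity)] at h
    convert h using 1
    · congr 1
      refine integral_congr_ae ?_
      filter_upwards [hne] with ξ hξ
      rw [← mul_assoc, mul_left_comm, ← Complex.ofReal_mul]
      have hξ' : ‖ξ‖ ≠ 0 := fun h₀ ↦ by simp [h₀] at hξ
      congr 3
      field_simp
    · rw [neg_div, rpow_neg (by positivity)]
      push_cast
      ring
  · rw [integral_const_mul, integral_Ioi_zero_add_rpow (by norm_num) ht',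
      show -(3 : ℝ) / 2 + 1 = -1 / 2 by norm_num]
    ring
end
end

section
/- Let ε > 0 and let v : ℝ³ → [0, ∞) be measurable with v(x) ≤ C₀ (1+|x|)^{−7/2−ε}. Let λ₀ ∈ (0,1) and let Γ : (0, 2λ₀) → B(L²(ℝ³)) be twice continuously differentiable in operator norm with ‖Γ(λ)‖_{L²→L²} + λ ‖Γ'(λ)‖_{L²→L²} + λ² ‖Γ''(λ)‖_{L²→L²} ≤ C₁ λ for all λ ∈ (0, 2λ₀). For λ ∈ (0, 2λ₀) and x, y ∈ ℝ³ define K(λ; x, y) := ∫_{ℝ³} R₀^±(λ⁴)(x, u) v(u) (Γ(λ) h_{λ,y})(u) du, where h_{λ,y}(u') := v(u') R₀^±(λ⁴)(u', y) (so that K(λ;·,·) is the integral kernel of R₀^±(λ⁴) v Γ(λ) v R₀^±(λ⁴)). Then for every α with −3/2 < α ≤ 0 there is a constant C > 0 such that for all t ≠ 0 and either choice of sign: sup_{x,y∈ℝ³} | ∫₀^∞ χ(λ) e^{−i t λ²} λ^{3+2α} K(λ; x, y) dλ | ≤ C |t|^{−(3+2α)/2}. -/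
noncomputable section

open MeasureTheory Real

/-! ### One-dimensional oscillatory integrals -/

/-- The quadratic phase `e^{iτs²}`. -/
def quadPhase (τ s : ℝ) : ℂ := Complex.exp (Complex.I * (τ : ℂ) * (s : ℂ) ^ 2)

lemma norm_quadPhase (τ s : ℝ) : ‖quadPhase τ s‖ = 1 := by
  rw [quadPhase, show Complex.I * (τ : ℂ) * (s : ℂ) ^ 2 = ((τ * s ^ 2 : ℝ) : ℂ) * Complex.I by
    push_cast; ring]
  exact Complex.norm_exp_ofReal_mul_I _

lemma continuous_quadPhase (τ c : ℝ) : Continuous fun l : ℝ ↦ quadPhase τ (l - c) := by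
  unfold quadPhase
  fun_prop

lemma hasDerivAt_ofReal_sub (c l : ℝ) : HasDerivAt (fun l : ℝ ↦ ((l - c : ℝ) : ℂ)) 1 l := by
  simpa using ((hasDerivAt_id l).sub_const c).ofReal_comp

lemma hasDerivAt_quadPhase (τ c l : ℝ) : HasDerivAt (fun l : ℝ ↦ quadPhase τ (l - c))
    (2 * Complex.I * τ * ((l - c : ℝ) : ℂ) * quadPhase τ (l - c)) l := by
  have h := (((hasDerivAt_ofReal_sub c l).pow 2).const_mul (Complex.I * (τ : ℂ))).cexp
  refine h.congr_deriv ?_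
  simp only [quadPhase, Pi.pow_apply]
  push_cast
  ring

lemma norm_one_add_two_I_mul {τ : ℝ} (hτ : τ = 1 ∨ τ = -1) (s : ℝ) :
    ‖(1 + 2 * Complex.I * τ * (s : ℂ) ^ 2 : ℂ)‖ ^ 2 = 1 + 4 * s ^ 4 := by
  rw [Complex.sq_norm, Complex.normSq_apply]
  rcases hτ with rfl | rfl <;> simp [← Complex.ofReal_pow] <;> ring

/-- Second-derivative test of van der Corput for a quadratic phase. -/
lemma norm_integral_quadPhase_mul_le {τ : ℝ} (hτ : τ = 1 ∨ τ = -1) (c : ℝ) {p q M M' : ℝ}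
    (hpq : p ≤ q) (hM : 0 ≤ M) {b b' : ℝ → ℂ}
    (hb : ∀ l ∈ Set.Icc p q, HasDerivAt b (b' l) l) (hb' : ContinuousOn b' (Set.Icc p q))
    (hbM : ∀ l ∈ Set.Icc p q, ‖b l‖ ≤ M) (hbM' : ∀ l ∈ Set.Icc p q, ‖b' l‖ ≤ M') :
    ‖∫ l in p..q, quadPhase τ (l - c) * b l‖ ≤ (2 + 2 * π) * M + M' * (q - p) := by
  set D : ℝ → ℂ := fun l ↦ 1 + 2 * Complex.I * τ * ((l - c : ℝ) : ℂ) ^ 2 with hD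
  have hDn : ∀ l, ‖D l‖ ^ 2 = 1 + 4 * (l - c) ^ 4 := fun l ↦ norm_one_add_two_I_mul hτ (l - c)
  have hD1 : ∀ l, 1 ≤ ‖D l‖ := fun l ↦ by
    have := hDn l
    nlinarith [norm_nonneg (D l), sq_nonneg ((l - c) ^ 2)]
  have hD0 : ∀ l, D l ≠ 0 := fun l h ↦ by
    have := hD1 l
    rw [h, norm_zero] at this
    linarith
  have hDd : ∀ l, HasDerivAt D (4 * Complex.I * τ * ((l - c : ℝ) : ℂ)) l := fun l ↦ by
    have h := (((hasDerivAt_ofReal_sub c l).pow 2).const_mul (2 * Complex.I * (τ : ℂ))).const_add 1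
    refine h.congr_deriv ?_
    push_cast
    ring
  have hDc : Continuous D := continuous_iff_continuousAt.2 fun l ↦ (hDd l).continuousAt
  have hsD : ∀ l, ‖((l - c : ℝ) : ℂ) / D l‖ ≤ 1 := fun l ↦ by
    rw [norm_div, div_le_one (by linarith [hD1 l]), Complex.norm_real, Real.norm_eq_abs]
    refine abs_le_of_sq_le_sq ?_ (norm_nonneg _)
    rw [hDn l]
    nlinarith [sq_nonneg ((l - c) ^ 2 - 1)]
  set W : ℝ → ℂ := fun l ↦ ((l - c : ℝ) : ℂ) * quadPhase τ (l - c) / D l * b l with hW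
  set r : ℝ → ℂ := fun l ↦ quadPhase τ (l - c) * (((l - c : ℝ) : ℂ) / D l * b' l
    - 4 * Complex.I * τ * ((l - c : ℝ) : ℂ) ^ 2 / D l ^ 2 * b l) with hr
  have hWd : ∀ l ∈ Set.uIcc p q, HasDerivAt W (quadPhase τ (l - c) * b l + r l) l := by
    intro l hl
    rw [Set.uIcc_of_le hpq] at hl
    have h := ((((hasDerivAt_ofReal_sub c l).mul (hasDerivAt_quadPhase τ c l)).div
      (hDd l) (hD0 l)).mul (hb l hl))
    refine h.congr_deriv ?_
    simp only [hr, Pi.mul_apply, Pi.div_apply]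
    have := hD0 l
    field_simp
    simp only [hD]
    ring
  have hbc : ContinuousOn b (Set.Icc p q) := fun l hl ↦ (hb l hl).continuousAt.continuousWithinAt
  have hEc := continuous_quadPhase τ c
  have hsc : Continuous fun l : ℝ ↦ ((l - c : ℝ) : ℂ) := by fun_prop
  have hrc : ContinuousOn r (Set.Icc p q) := by
    refine hEc.continuousOn.mul (((hsc.div hDc hD0).continuousOn.mul hb').sub
      (ContinuousOn.mul (Continuous.continuousOn ?_) hbc))
    exact (continuous_const.mul (hsc.pow 2)).div (hDc.pow 2) fun l ↦ pow_ne_zero 2 (hD0 l)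
  have hi1 : IntervalIntegrable (fun l ↦ quadPhase τ (l - c) * b l) volume p q :=
    ContinuousOn.intervalIntegrable_of_Icc hpq (hEc.continuousOn.mul hbc)
  have hi2 : IntervalIntegrable r volume p q := ContinuousOn.intervalIntegrable_of_Icc hpq hrc
  have hftc := intervalIntegral.integral_eq_sub_of_hasDerivAt hWd (hi1.add hi2)
  rw [intervalIntegral.integral_add hi1 hi2] at hftc
  have hWn : ∀ l ∈ Set.Icc p q, ‖W l‖ ≤ M := fun l hl ↦ by
    have : W l = quadPhase τ (l - c) * (((l - c : ℝ) : ℂ) / D l) * b l := by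
      simp only [hW]; ring
    rw [this, norm_mul, norm_mul, norm_quadPhase, one_mul]
    calc _ ≤ 1 * M := mul_le_mul (hsD l) (hbM l hl) (norm_nonneg _) zero_le_one
      _ = M := one_mul M
  have hrn : ∀ l ∈ Set.Icc p q, ‖r l‖ ≤ M' + 2 * M * (1 + (l - c) ^ 2)⁻¹ := fun l hl ↦ by
    rw [hr]
    simp only
    rw [norm_mul, norm_quadPhase, one_mul]
    refine (norm_sub_le _ _).trans (add_le_add ?_ ?_)
    · rw [norm_mul]
      calc _ ≤ 1 * M' := mul_le_mul (hsD l) (hbM' l hl) (norm_nonneg _) zero_le_one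
        _ = M' := one_mul M'
    · have hτn : ‖(τ : ℂ)‖ = 1 := by rcases hτ with rfl | rfl <;> simp
      rw [norm_mul, norm_div, norm_mul, norm_mul, norm_mul, hτn, norm_pow, norm_pow, hDn,
        Complex.norm_real, Real.norm_eq_abs, sq_abs]
      simp only [Complex.norm_I, Complex.norm_ofNat, mul_one]
      have h1 : 4 * (l - c) ^ 2 / (1 + 4 * (l - c) ^ 4) ≤ 2 * (1 + (l - c) ^ 2)⁻¹ := by
        rw [← div_eq_mul_inv, div_le_div_iff₀ (by positivity) (by positivity)]
        nlinarith [sq_nonneg (2 * (l - c) ^ 2 - 1)]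
      calc _ ≤ 2 * (1 + (l - c) ^ 2)⁻¹ * M :=
            mul_le_mul h1 (hbM l hl) (norm_nonneg _) (by positivity)
        _ = _ := by ring
  have hgi : IntervalIntegrable (fun l : ℝ ↦ (1 + (l - c) ^ 2)⁻¹) volume p q := by
    refine Continuous.intervalIntegrable (Continuous.inv₀ (by fun_prop) fun l ↦ ?_) _ _
    positivity
  have hrint : ‖∫ l in p..q, r l‖ ≤ M' * (q - p) + 2 * M * π := by
    refine (intervalIntegral.norm_integral_le_of_norm_le hpq
      (Filter.Eventually.of_forall fun l hl ↦ hrn l (Set.Ioc_subset_Icc_self hl))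
      (intervalIntegrable_const.add (hgi.const_mul _))).trans ?_
    rw [intervalIntegral.integral_add intervalIntegrable_const (hgi.const_mul _),
      intervalIntegral.integral_const, intervalIntegral.integral_const_mul,
      intervalIntegral.integral_comp_sub_right (fun l ↦ (1 + l ^ 2)⁻¹), integral_inv_one_add_sq]
    have h1 := arctan_lt_pi_div_two (q - c)
    have h2 := neg_pi_div_two_lt_arctan (p - c)
    have h3 : 2 * M * (arctan (q - c) - arctan (p - c)) ≤ 2 * M * π := by
      gcongr; linarith
    rw [smul_eq_mul]
    linarith
  have heq : ∫ l in p..q, quadPhase τ (l - c) * b l = W q - W p - ∫ l in p..q, r l := by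
    rw [← hftc]; ring
  rw [heq]
  have h1 := hWn q (Set.right_mem_Icc.2 hpq)
  have h2 := hWn p (Set.left_mem_Icc.2 hpq)
  have h3 := norm_sub_le (W q - W p) (∫ l in p..q, r l)
  have h4 := norm_sub_le (W q) (W p)
  linarith

/-- Integrating by parts twice against a quadratic phase, away from the stationary point. -/
lemma norm_integral_quadPhase_mul_le_of_two_mul_le {τ : ℝ} (hτ : τ = 1 ∨ τ = -1)
    {c R N M : ℝ} (hR : 1 ≤ R) (hRN : R ≤ N) (hc : 2 * c ≤ R) {b b₁ b₂ : ℝ → ℂ}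
    (hb : ∀ l ∈ Set.Icc R N, HasDerivAt b (b₁ l) l)
    (hb₁ : ∀ l ∈ Set.Icc R N, HasDerivAt b₁ (b₂ l) l)
    (hb₂ : IntervalIntegrable b₂ volume R N)
    (hM : ∀ l ∈ Set.Icc R N, ‖b l‖ ≤ M * l ^ 2) (hM₁ : ∀ l ∈ Set.Icc R N, ‖b₁ l‖ ≤ M * l)
    (hM₂ : ∀ l ∈ Set.Icc R N, ‖b₂ l‖ ≤ M) (hMR : ‖b R‖ ≤ M) (hM₁R : ‖b₁ R‖ ≤ M)
    (hN : b N = 0) (hN₁ : b₁ N = 0) :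
    ‖∫ l in R..N, quadPhase τ (l - c) * b l‖ ≤ 23 * M := by
  have hM0 : 0 ≤ M := (norm_nonneg _).trans hMR
  have hτn : ‖(τ : ℂ)‖ = 1 := by rcases hτ with rfl | rfl <;> simp
  have hτ2 : (τ : ℂ) ^ 2 = 1 := by rcases hτ with rfl | rfl <;> simp
  have hτ0 : (τ : ℂ) ≠ 0 := by rcases hτ with rfl | rfl <;> simp
  have hs : ∀ l ∈ Set.Icc R N, l / 2 ≤ l - c := fun l hl ↦ by linarith [hl.1]
  have hs0 : ∀ l ∈ Set.Icc R N, ((l - c : ℝ) : ℂ) ≠ 0 := fun l hl ↦ by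
    have := hs l hl
    have := hl.1
    exact Complex.ofReal_ne_zero.2 (by linarith)
  set V : ℝ → ℂ := fun l ↦ quadPhase τ (l - c) * (b l / (2 * Complex.I * τ * ((l - c : ℝ) : ℂ))
    + (b₁ l / ((l - c : ℝ) : ℂ) ^ 2 - b l / ((l - c : ℝ) : ℂ) ^ 3) / 4) with hV
  set r : ℝ → ℂ := fun l ↦ quadPhase τ (l - c) * ((b₂ l / ((l - c : ℝ) : ℂ) ^ 2
    - 3 * b₁ l / ((l - c : ℝ) : ℂ) ^ 3 + 3 * b l / ((l - c : ℝ) : ℂ) ^ 4) / 4) with hr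
  have hVd : ∀ l ∈ Set.uIcc R N, HasDerivAt V (quadPhase τ (l - c) * b l + r l) l := by
    intro l hl
    rw [Set.uIcc_of_le hRN] at hl
    have hsd := hasDerivAt_ofReal_sub c l
    have hl0 := hs0 l hl
    have h := (hasDerivAt_quadPhase τ c l).mul
      (((hb l hl).div (hsd.const_mul (2 * Complex.I * τ)) (mul_ne_zero (mul_ne_zero
        (mul_ne_zero two_ne_zero Complex.I_ne_zero) hτ0) hl0)).add
      ((((hb₁ l hl).div (hsd.pow 2) (pow_ne_zero 2 hl0)).sub
        ((hb l hl).div (hsd.pow 3) (pow_ne_zero 3 hl0))).div_const 4))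
    refine h.congr_deriv ?_
    simp only [hr, Pi.div_apply, Pi.add_apply, Pi.sub_apply, Pi.pow_apply]
    field_simp
    push_cast
    ring_nf
    simp only [Complex.I_sq, hτ2]
    ring
  have hbc : ContinuousOn b (Set.Icc R N) := fun l hl ↦ (hb l hl).continuousAt.continuousWithinAt
  have hb₁c : ContinuousOn b₁ (Set.Icc R N) :=
    fun l hl ↦ (hb₁ l hl).continuousAt.continuousWithinAt
  have hEc := continuous_quadPhase τ c
  have hsc : Continuous fun l : ℝ ↦ ((l - c : ℝ) : ℂ) := by fun_prop
  have hi1 : IntervalIntegrable (fun l ↦ quadPhase τ (l - c) * b l) volume R N :=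
    ContinuousOn.intervalIntegrable_of_Icc hRN (hEc.continuousOn.mul hbc)
  have hi2 : IntervalIntegrable r volume R N := by
    have h1 : IntervalIntegrable (fun l ↦ (quadPhase τ (l - c) / ((l - c : ℝ) : ℂ) ^ 2 / 4) * b₂ l)
        volume R N := by
      refine hb₂.continuousOn_mul ?_
      rw [Set.uIcc_of_le hRN]
      exact (hEc.continuousOn.div (hsc.pow 2).continuousOn
        fun l hl ↦ pow_ne_zero 2 (hs0 l hl)).div_const 4
    have h2 : IntervalIntegrable (fun l ↦ quadPhase τ (l - c) * ((
        - (3 * b₁ l / ((l - c : ℝ) : ℂ) ^ 3) + 3 * b l / ((l - c : ℝ) : ℂ) ^ 4) / 4))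
        volume R N := by
      refine ContinuousOn.intervalIntegrable_of_Icc hRN (hEc.continuousOn.mul ?_)
      refine ((((continuousOn_const.mul hb₁c).div (hsc.pow 3).continuousOn
        fun l hl ↦ pow_ne_zero 3 (hs0 l hl)).neg).add ((continuousOn_const.mul hbc).div
          (hsc.pow 4).continuousOn fun l hl ↦ pow_ne_zero 4 (hs0 l hl))).div_const 4
    refine (h1.add h2).congr (fun l _ ↦ ?_)
    simp only [hr]
    ring
  have hftc := intervalIntegral.integral_eq_sub_of_hasDerivAt hVd (hi1.add hi2)
  rw [intervalIntegral.integral_add hi1 hi2] at hftc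
  have hVN : V N = 0 := by simp [hV, hN, hN₁]
  have hsn : ∀ l ∈ Set.Icc R N, ∀ n : ℕ, ‖((l - c : ℝ) : ℂ) ^ n‖⁻¹ ≤ (2 / l) ^ n := by
    intro l hl n
    have h1 := hs l hl
    have h2 := hl.1
    rw [norm_pow, Complex.norm_real, Real.norm_eq_abs, abs_of_pos (by linarith), ← inv_pow]
    refine pow_le_pow_left₀ (by rw [inv_nonneg]; linarith) ?_ n
    rw [← inv_div]
    exact inv_anti₀ (by linarith) h1
  have hVR : ‖V R‖ ≤ 4 * M := by
    have hR0 := Set.left_mem_Icc.2 hRN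
    have hp : ∀ n : ℕ, ‖((R - c : ℝ) : ℂ) ^ n‖⁻¹ ≤ 2 ^ n := fun n ↦ by
      refine (hsn R hR0 n).trans (pow_le_pow_left₀ (by positivity) ?_ n)
      rw [div_le_iff₀ (by linarith)]
      linarith
    have h1 := hp 1
    rw [pow_one] at h1
    have h2 := hp 2
    have h3 := hp 3
    rw [hV]
    simp only
    rw [norm_mul, norm_quadPhase, one_mul]
    refine (norm_add_le _ _).trans ?_
    rw [norm_div, norm_div, norm_mul, norm_mul, norm_mul, hτn]
    simp only [Complex.norm_I, Complex.norm_ofNat, mul_one]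
    have h4 : ‖b R‖ / (2 * ‖((R - c : ℝ) : ℂ)‖) ≤ M := by
      calc _ = ‖b R‖ * ‖((R - c : ℝ) : ℂ)‖⁻¹ / 2 := by
            rw [div_eq_mul_inv, mul_inv]; ring
        _ ≤ M * 2 ^ 1 / 2 := by gcongr
        _ = M := by ring
    have h5 : ‖b₁ R / ((R - c : ℝ) : ℂ) ^ 2 - b R / ((R - c : ℝ) : ℂ) ^ 3‖ ≤ 12 * M := by
      refine (norm_sub_le _ _).trans ?_
      rw [norm_div, norm_div, div_eq_mul_inv, div_eq_mul_inv]
      calc _ ≤ M * 2 ^ 2 + M * 2 ^ 3 := by gcongr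
        _ = _ := by ring
    linarith
  have hrn : ∀ l ∈ Set.Icc R N, ‖r l‖ ≤ 19 * M * l ^ (-2 : ℝ) := by
    intro l hl
    have hl0 : 0 < l := by linarith [hl.1]
    rw [hr]
    simp only
    rw [norm_mul, norm_quadPhase, one_mul, norm_div, Complex.norm_ofNat]
    have hn : ‖b₂ l / ((l - c : ℝ) : ℂ) ^ 2 - 3 * b₁ l / ((l - c : ℝ) : ℂ) ^ 3
        + 3 * b l / ((l - c : ℝ) : ℂ) ^ 4‖
        ≤ M * (2 / l) ^ 2 + 3 * (M * l) * (2 / l) ^ 3 + 3 * (M * l ^ 2) * (2 / l) ^ 4 := by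
      refine (norm_add_le _ _).trans (add_le_add ((norm_sub_le _ _).trans (add_le_add ?_ ?_)) ?_)
      · rw [norm_div, div_eq_mul_inv]
        exact mul_le_mul (hM₂ l hl) (hsn l hl 2) (by positivity) hM0
      · rw [norm_div, div_eq_mul_inv, norm_mul, Complex.norm_ofNat]
        exact mul_le_mul (by linarith [hM₁ l hl]) (hsn l hl 3) (by positivity) (by positivity)
      · rw [norm_div, div_eq_mul_inv, norm_mul, Complex.norm_ofNat]
        exact mul_le_mul (by linarith [hM l hl]) (hsn l hl 4) (by positivity) (by positivity)
    have h2 : l ^ (-2 : ℝ) = (l ^ 2)⁻¹ := by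
      rw [Real.rpow_neg hl0.le]; norm_cast
    rw [h2]
    calc _ ≤ _ := div_le_div_of_nonneg_right hn (by norm_num)
      _ = _ := by field_simp; ring
  have hgi : IntervalIntegrable (fun l : ℝ ↦ 19 * M * l ^ (-2 : ℝ)) volume R N := by
    refine (intervalIntegral.intervalIntegrable_rpow (Or.inr ?_)).const_mul _
    rw [Set.uIcc_of_le hRN]
    intro h
    linarith [h.1]
  have hrint : ‖∫ l in R..N, r l‖ ≤ 19 * M := by
    refine (intervalIntegral.norm_integral_le_of_norm_le hRN
      (Filter.Eventually.of_forall fun l hl ↦ hrn l (Set.Ioc_subset_Icc_self hl)) hgi).trans ?_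
    rw [intervalIntegral.integral_const_mul, integral_rpow (Or.inr ⟨by norm_num, ?_⟩)]
    · have h1 : R ^ (-2 + 1 : ℝ) ≤ 1 := Real.rpow_le_one_of_one_le_of_nonpos hR (by norm_num)
      have h2 : 0 ≤ N ^ (-2 + 1 : ℝ) := Real.rpow_nonneg (by linarith) _
      have h3 : (N ^ (-2 + 1 : ℝ) - R ^ (-2 + 1 : ℝ)) / (-2 + 1) ≤ 1 := by
        rw [div_le_iff_of_neg (by norm_num)]
        linarith
      calc _ ≤ 19 * M * 1 := by gcongr
        _ = _ := mul_one _
    · rw [Set.uIcc_of_le hRN]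
      intro h
      linarith [h.1]
  have heq : ∫ l in R..N, quadPhase τ (l - c) * b l = V N - V R - ∫ l in R..N, r l := by
    rw [← hftc]; ring
  rw [heq, hVN, zero_sub]
  have h3 := norm_sub_le (-V R) (∫ l in R..N, r l)
  rw [norm_neg] at h3
  linarith

/-- Uniform bound for an oscillatory integral with the phase `±(l - c)²` and a symbol-type
amplitude which gains a factor `(1 + 2|c|l)⁻¹`. -/
lemma norm_integral_Ioi_quadPhase_mul_le {β : ℝ} (hβ : -1 < β) (hβ2 : β ≤ 2) {τ : ℝ}
    (hτ : τ = 1 ∨ τ = -1) {c N M : ℝ} (hM0 : 0 ≤ M) {b b₁ b₂ : ℝ → ℂ}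
    (hb : ∀ l, 0 < l → HasDerivAt b (b₁ l) l) (hb₁ : ∀ l, 0 < l → HasDerivAt b₁ (b₂ l) l)
    (hM : ∀ l, 0 < l → ‖b l‖ ≤ M * l ^ β / (1 + l * (2 * |c|)))
    (hM₁ : ∀ l, 0 < l → ‖b₁ l‖ ≤ M * l ^ (β - 1) / (1 + l * (2 * |c|)))
    (hM₂ : ∀ l, 0 < l → ‖b₂ l‖ ≤ M * l ^ (β - 2)) (hN : ∀ l, N ≤ l → b l = 0) :
    ‖∫ l in Set.Ioi (0 : ℝ), quadPhase τ (l - c) * b l‖ ≤ (1 / (β + 1) + (26 + 2 * π)) * M := by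
  set ρ := 2 * |c| with hρ
  have hρ0 : 0 ≤ ρ := by positivity
  set R := max 1 ρ with hRdef
  have hR1 : 1 ≤ R := le_max_left _ _
  have hRρ : ρ ≤ R := le_max_right _ _
  set K := max N R + 1 with hK
  have hKR : R ≤ K := by linarith [le_max_right N R]
  have hKN : N < K := by linarith [le_max_left N R]
  have hrpow : ∀ l : ℝ, 1 ≤ l → ∀ e : ℝ, ∀ n : ℕ, e ≤ n → l ^ e ≤ l ^ n := fun l hl e n hen ↦ by
    rw [← Real.rpow_natCast]
    exact Real.rpow_le_rpow_of_exponent_le hl hen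
  have hdrop : ∀ l a : ℝ, 0 < l → 0 ≤ a → a / (1 + l * ρ) ≤ a := fun l a hl ha ↦
    div_le_self ha (by nlinarith [mul_nonneg hl.le hρ0])
  have hbc : ContinuousOn b (Set.Ioi 0) :=
    fun l hl ↦ (hb l hl).continuousAt.continuousWithinAt
  have hb₁c : ContinuousOn b₁ (Set.Ioi 0) :=
    fun l hl ↦ (hb₁ l hl).continuousAt.continuousWithinAt
  have hEc := continuous_quadPhase τ c
  have hbeta : ∀ l, 0 < l → ‖quadPhase τ (l - c) * b l‖ ≤ M * l ^ β := fun l hl ↦ by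
    rw [norm_mul, norm_quadPhase, one_mul]
    exact (hM l hl).trans (hdrop l _ hl (by positivity))
  have hinteg : IntegrableOn (fun l ↦ quadPhase τ (l - c) * b l) (Set.Ioc 0 K) := by
    have h1 : IntegrableOn (fun l : ℝ ↦ M * l ^ β) (Set.Ioc 0 K) := by
      have := (intervalIntegral.intervalIntegrable_rpow' (a := 0) (b := K) hβ).const_mul M
      rwa [intervalIntegrable_iff_integrableOn_Ioc_of_le (by linarith)] at this
    refine Integrable.mono' h1 ?_ ?_
    · exact ((hEc.continuousOn.mul hbc).mono Set.Ioc_subset_Ioi_self).aestronglyMeasurable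
        measurableSet_Ioc
    · exact (ae_restrict_iff' measurableSet_Ioc).2
        (Filter.Eventually.of_forall fun l hl ↦ hbeta l hl.1)
  have hII : ∀ p q, 0 ≤ p → p ≤ q → q ≤ K →
      IntervalIntegrable (fun l ↦ quadPhase τ (l - c) * b l) volume p q := by
    intro p q hp hpq hq
    rw [intervalIntegrable_iff_integrableOn_Ioc_of_le hpq]
    exact hinteg.mono_set (Set.Ioc_subset_Ioc hp hq)
  have hsplit : ∫ l in Set.Ioi (0 : ℝ), quadPhase τ (l - c) * b l
      = (∫ l in (0 : ℝ)..1, quadPhase τ (l - c) * b l)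
        + (∫ l in (1 : ℝ)..R, quadPhase τ (l - c) * b l)
        + ∫ l in R..K, quadPhase τ (l - c) * b l := by
    rw [intervalIntegral.integral_add_adjacent_intervals
        (hII 0 1 le_rfl zero_le_one (by linarith)) (hII 1 R zero_le_one hR1 hKR),
      intervalIntegral.integral_add_adjacent_intervals
        (hII 0 R le_rfl (by linarith) hKR) (hII R K (by linarith) hKR le_rfl),
      intervalIntegral.integral_of_le (by linarith)]
    refine (setIntegral_eq_of_subset_of_forall_sdiff_eq_zero measurableSet_Ioi
      Set.Ioc_subset_Ioi_self fun l hl ↦ ?_)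
    have : K < l := by
      by_contra! h
      exact hl.2 ⟨hl.1, h⟩
    rw [hN l (by linarith), mul_zero]
  have hfirst : ‖∫ l in (0 : ℝ)..1, quadPhase τ (l - c) * b l‖ ≤ 1 / (β + 1) * M := by
    refine (intervalIntegral.norm_integral_le_of_norm_le zero_le_one
      (Filter.Eventually.of_forall fun l hl ↦ hbeta l hl.1)
      ((intervalIntegral.intervalIntegrable_rpow' hβ).const_mul M)).trans ?_
    rw [intervalIntegral.integral_const_mul, integral_rpow (Or.inl hβ),
      Real.zero_rpow (by linarith), Real.one_rpow]
    apply le_of_eq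
    ring
  have hmid : ‖∫ l in (1 : ℝ)..R, quadPhase τ (l - c) * b l‖ ≤ (3 + 2 * π) * M := by
    rcases le_total ρ 1 with h | h
    · have : R = 1 := max_eq_left h
      rw [this, intervalIntegral.integral_same, norm_zero]
      positivity
    · have hRe : R = ρ := max_eq_right h
      have hpos : ∀ l ∈ Set.Icc 1 R, 0 < l := fun l hl ↦ by linarith [hl.1]
      have hden : ∀ l, 0 < l → 0 < 1 + l * ρ := fun l hl ↦ by positivity
      have key := norm_integral_quadPhase_mul_le hτ c hR1 hM0 (b := b) (b' := b₁) (M' := M / R)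
        (fun l hl ↦ hb l (hpos l hl)) (hb₁c.mono fun l hl ↦ hpos l hl) ?_ ?_
      · refine key.trans ?_
        have : M / R * (R - 1) ≤ M := by
          rw [div_mul_eq_mul_div, div_le_iff₀ (by linarith)]
          gcongr
          linarith
        linarith
      · intro l hl
        have hl0 := hpos l hl
        refine (hM l hl0).trans ((div_le_iff₀ (hden l hl0)).2 ?_)
        gcongr
        calc l ^ β ≤ l ^ 2 := hrpow l hl.1 β 2 (by exact_mod_cast hβ2)
          _ = l * l := sq l
          _ ≤ l * ρ := by gcongr; exact hRe ▸ hl.2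
          _ ≤ 1 + l * ρ := by linarith
      · intro l hl
        have hl0 := hpos l hl
        refine (hM₁ l hl0).trans ((div_le_iff₀ (hden l hl0)).2 ?_)
        rw [div_mul_eq_mul_div, mul_div_assoc]
        gcongr
        rw [le_div_iff₀ (by linarith), hRe]
        have h1 : l ^ (β - 1) ≤ l ^ 1 := hrpow l hl.1 _ 1 (by push_cast; linarith)
        calc l ^ (β - 1) * ρ ≤ l ^ 1 * ρ := by gcongr
          _ ≤ 1 + l * ρ := by rw [pow_one]; linarith
  have hlast : ‖∫ l in R..K, quadPhase τ (l - c) * b l‖ ≤ 23 * M := by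
    have hpos : ∀ l ∈ Set.Icc R K, 0 < l := fun l hl ↦ by linarith [hl.1]
    have hle1 : ∀ l ∈ Set.Icc R K, 1 ≤ l := fun l hl ↦ by linarith [hl.1]
    have hbK₁ : b₁ K = 0 := by
      refine (hb K (by linarith)).unique ((hasDerivAt_const K (0 : ℂ)).congr_of_eventuallyEq ?_)
      filter_upwards [Ioi_mem_nhds hKN] with l hl using hN l (le_of_lt hl)
    have hM₂' : ∀ l ∈ Set.Icc R K, ‖b₂ l‖ ≤ M := fun l hl ↦ by
      refine (hM₂ l (hpos l hl)).trans ?_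
      calc M * l ^ (β - 2) ≤ M * 1 := by
            gcongr
            exact Real.rpow_le_one_of_one_le_of_nonpos (hle1 l hl) (by linarith)
        _ = M := mul_one M
    have hb₂i : IntervalIntegrable b₂ volume R K := by
      rw [intervalIntegrable_iff_integrableOn_Icc_of_le hKR]
      have hae : deriv b₁ =ᵐ[volume.restrict (Set.Icc R K)] b₂ :=
        (ae_restrict_iff' measurableSet_Icc).2
          (Filter.Eventually.of_forall fun l hl ↦ (hb₁ l (hpos l hl)).deriv)
      refine Integrable.mono' (g := fun _ ↦ M) (integrableOn_const (by simp))
        ((measurable_deriv b₁).aestronglyMeasurable.congr hae) ?_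
      exact (ae_restrict_iff' measurableSet_Icc).2 (Filter.Eventually.of_forall hM₂')
    have hRR : R ≤ 1 + R * ρ ∧ R ^ 2 ≤ 1 + R * ρ := by
      rcases le_total ρ 1 with h | h
      · have : R = 1 := max_eq_left h
        rw [this]
        constructor <;> linarith
      · have : R = ρ := max_eq_right h
        rw [this]
        constructor <;> nlinarith
    refine norm_integral_quadPhase_mul_le_of_two_mul_le hτ hR1 hKR ?_
      (fun l hl ↦ hb l (hpos l hl)) (fun l hl ↦ hb₁ l (hpos l hl)) hb₂i ?_ ?_ hM₂' ?_ ?_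
      (hN K hKN.le) hbK₁
    · linarith [le_abs_self c]
    · intro l hl
      refine (hM l (hpos l hl)).trans ((hdrop l _ (hpos l hl) ?_).trans ?_)
      · have := (hpos l hl).le
        positivity
      · gcongr
        exact hrpow l (hle1 l hl) β 2 (by exact_mod_cast hβ2)
    · intro l hl
      refine (hM₁ l (hpos l hl)).trans ((hdrop l _ (hpos l hl) ?_).trans ?_)
      · have := (hpos l hl).le
        positivity
      · gcongr
        calc l ^ (β - 1) ≤ l ^ 1 := hrpow l (hle1 l hl) _ 1 (by push_cast; linarith)
          _ = l := pow_one l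
    · refine (hM R (by linarith)).trans ((div_le_iff₀ (by positivity)).2 ?_)
      gcongr
      exact (hrpow R hR1 β 2 (by exact_mod_cast hβ2)).trans hRR.2
    · refine (hM₁ R (by linarith)).trans ((div_le_iff₀ (by positivity)).2 ?_)
      gcongr
      refine (hrpow R hR1 _ 1 (by push_cast; linarith)).trans ?_
      rw [pow_one]
      exact hRR.1
  rw [hsplit]
  refine (norm_add₃_le).trans ?_
  linarith

/-- Dispersive bound for a quadratic phase with a linear term of size `ω` and a symbol-type
amplitude which gains a factor `(1 + l|ω|)⁻¹`. -/
lemma norm_integral_Ioi_exp_mul_le {β : ℝ} (hβ : -1 < β) (hβ2 : β ≤ 2) {t ω N M : ℝ} (ht : t ≠ 0)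
    (hM0 : 0 ≤ M) {b b₁ b₂ : ℝ → ℂ}
    (hb : ∀ l, 0 < l → HasDerivAt b (b₁ l) l) (hb₁ : ∀ l, 0 < l → HasDerivAt b₁ (b₂ l) l)
    (hM : ∀ l, 0 < l → ‖b l‖ ≤ M * l ^ β / (1 + l * |ω|))
    (hM₁ : ∀ l, 0 < l → ‖b₁ l‖ ≤ M * l ^ (β - 1) / (1 + l * |ω|))
    (hM₂ : ∀ l, 0 < l → ‖b₂ l‖ ≤ M * l ^ (β - 2)) (hN : ∀ l, N ≤ l → b l = 0) :
    ‖∫ l in Set.Ioi (0 : ℝ), Complex.exp (-Complex.I * t * (l : ℂ) ^ 2 + Complex.I * ω * l) * b l‖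
      ≤ (1 / (β + 1) + (26 + 2 * π)) * M * |t| ^ (-(β + 1) / 2) := by
  have hT : 0 < |t| := abs_pos.2 ht
  set k : ℝ := |t| ^ (-(1 / 2) : ℝ) with hk
  have hk0 : 0 < k := Real.rpow_pos_of_pos hT _
  have hk2 : k ^ 2 * |t| = 1 := by
    rw [hk, ← Real.rpow_natCast, ← Real.rpow_mul hT.le]
    norm_num
    rw [Real.rpow_neg_one]
    exact inv_mul_cancel₀ hT.ne'
  obtain ⟨τ, hτ, hτt⟩ : ∃ τ : ℝ, (τ = 1 ∨ τ = -1) ∧ -t = τ * |t| := by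
    rcases abs_choice t with h | h
    · exact ⟨-1, Or.inr rfl, by rw [h]; ring⟩
    · exact ⟨1, Or.inl rfl, by rw [h]; ring⟩
  have hτ2 : τ * τ = 1 := by rcases hτ with rfl | rfl <;> norm_num
  set c : ℝ := -(τ * ω * k / 2) with hc
  have hcω : 2 * |c| = k * |ω| := by
    rw [hc, abs_neg, abs_div, abs_mul, abs_mul, abs_of_pos hk0]
    rcases hτ with rfl | rfl <;> simp <;> ring
  have hscale := integral_comp_mul_left_Ioi
    (fun l : ℝ ↦ Complex.exp (-Complex.I * t * (l : ℂ) ^ 2 + Complex.I * ω * l) * b l) 0 hk0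
  rw [mul_zero] at hscale
  have heq : ∀ l : ℝ, Complex.exp (-Complex.I * t * ((k * l : ℝ) : ℂ) ^ 2
      + Complex.I * ω * (k * l : ℝ)) * b (k * l)
      = Complex.exp (-Complex.I * τ * (c : ℂ) ^ 2) * (quadPhase τ (l - c) * b (k * l)) := by
    intro l
    rw [← mul_assoc, quadPhase, ← Complex.exp_add]
    congr 2
    have h1 : -t * (k * l) ^ 2 + ω * (k * l) = -τ * c ^ 2 + τ * (l - c) ^ 2 := by
      rw [hτt, hc]
      linear_combination (τ * l ^ 2) * hk2 - (ω * k * l) * hτ2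
    have h2 := congrArg (fun s : ℝ ↦ Complex.I * (s : ℂ)) h1
    push_cast at h2 ⊢
    linear_combination h2
  simp only [heq] at hscale
  rw [integral_const_mul] at hscale
  have hcomp : ∀ (f : ℝ → ℂ) (f' : ℂ) (l : ℝ), HasDerivAt f f' (k * l) →
      HasDerivAt (fun l ↦ f (k * l)) (k • f') l := fun f f' l hf ↦
    (hf.scomp l ((hasDerivAt_id l).const_mul k)).congr_deriv (by simp)
  have hunit := norm_integral_Ioi_quadPhase_mul_le hβ hβ2 hτ (c := c) (N := N / k)
    (M := M * k ^ β) (by positivity) (b := fun l ↦ b (k * l)) (b₁ := fun l ↦ k • b₁ (k * l))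
    (b₂ := fun l ↦ k • k • b₂ (k * l)) ?_ ?_ ?_ ?_ ?_ ?_
  · have hsol : ∫ l in Set.Ioi (0 : ℝ),
        Complex.exp (-Complex.I * t * (l : ℂ) ^ 2 + Complex.I * ω * l) * b l
        = k • (Complex.exp (-Complex.I * τ * (c : ℂ) ^ 2) *
          ∫ l in Set.Ioi (0 : ℝ), quadPhase τ (l - c) * b (k * l)) := by
      rw [hscale, smul_smul, mul_inv_cancel₀ hk0.ne', one_smul]
    have hun : ‖Complex.exp (-Complex.I * τ * (c : ℂ) ^ 2)‖ = 1 := by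
      rw [show -Complex.I * (τ : ℂ) * (c : ℂ) ^ 2 = ((-τ * c ^ 2 : ℝ) : ℂ) * Complex.I by
        push_cast; ring]
      exact Complex.norm_exp_ofReal_mul_I _
    rw [hsol, norm_smul, norm_mul, hun, one_mul, Real.norm_eq_abs, abs_of_pos hk0]
    calc _ ≤ k * ((1 / (β + 1) + (26 + 2 * π)) * (M * k ^ β)) := by gcongr
      _ = (1 / (β + 1) + (26 + 2 * π)) * M * (k ^ β * k) := by ring
      _ = _ := by
        rw [← Real.rpow_add_one hk0.ne', hk, ← Real.rpow_mul hT.le]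
        congr 2
        ring
  · exact fun l hl ↦ hcomp _ _ l (hb (k * l) (by positivity))
  · exact fun l hl ↦ (hcomp _ _ l (hb₁ (k * l) (by positivity))).const_smul k
  · intro l hl
    refine (hM (k * l) (by positivity)).trans (le_of_eq ?_)
    rw [Real.mul_rpow hk0.le hl.le, hcω]
    ring
  · intro l hl
    rw [norm_smul, Real.norm_eq_abs, abs_of_pos hk0]
    refine (mul_le_mul_of_nonneg_left (hM₁ (k * l) (by positivity)) hk0.le).trans (le_of_eq ?_)
    rw [Real.mul_rpow hk0.le hl.le, hcω, Real.rpow_sub_one hk0.ne']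
    field_simp
  · intro l hl
    rw [norm_smul, norm_smul, Real.norm_eq_abs, abs_of_pos hk0]
    refine (mul_le_mul_of_nonneg_left (mul_le_mul_of_nonneg_left
      (hM₂ (k * l) (by positivity)) hk0.le) hk0.le).trans (le_of_eq ?_)
    rw [Real.mul_rpow hk0.le hl.le, Real.rpow_sub hk0 β 2, Real.rpow_two]
    field_simp
  · intro l hl
    exact hN _ (by rw [div_le_iff₀ hk0] at hl; linarith)

/-! ### The free resolvent kernel with its phase removed -/

/-- The `n`-th derivative of `l ↦ e^{pl} - e^{ql}`. -/
def expDiff (n : ℕ) (p q : ℂ) (l : ℝ) : ℂ :=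
  p ^ n * Complex.exp (p * l) - q ^ n * Complex.exp (q * l)

lemma hasDerivAt_expDiff (n : ℕ) (p q : ℂ) (l : ℝ) :
    HasDerivAt (expDiff n p q) (expDiff (n + 1) p q l) l := by
  have h1 : ∀ z : ℂ, HasDerivAt (fun l : ℝ ↦ z ^ n * Complex.exp (z * l))
      (z ^ (n + 1) * Complex.exp (z * l)) l := fun z ↦ by
    have h := ((((hasDerivAt_id l).ofReal_comp).const_mul z).cexp).const_mul (z ^ n)
    refine h.congr_deriv ?_
    simp only [id, Complex.ofReal_one]
    ring
  exact (h1 p).sub (h1 q)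

lemma expDiff_succ (n : ℕ) (p q : ℂ) (l : ℝ) :
    expDiff (n + 1) p q l = p * expDiff n p q l + (p - q) * (q ^ n * Complex.exp (q * l)) := by
  simp only [expDiff]
  ring

/-- `e^{-iσld}` times the free resolvent kernel at energy `l⁴` and distance `r`. -/
def modKer (σ r d l : ℝ) : ℂ :=
  1 / (8 * π * r) * (expDiff 0 (Complex.I * σ * (r - d)) (-(r + Complex.I * σ * d)) l / l ^ 2)

/-- The first derivative of `modKer` in `l`. -/
def modKer₁ (σ r d l : ℝ) : ℂ :=
  1 / (8 * π * r) * (expDiff 1 (Complex.I * σ * (r - d)) (-(r + Complex.I * σ * d)) l / l ^ 2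
    - 2 * expDiff 0 (Complex.I * σ * (r - d)) (-(r + Complex.I * σ * d)) l / l ^ 3)

/-- The second derivative of `modKer` in `l`. -/
def modKer₂ (σ r d l : ℝ) : ℂ :=
  1 / (8 * π * r) * (expDiff 2 (Complex.I * σ * (r - d)) (-(r + Complex.I * σ * d)) l / l ^ 2
    - 4 * expDiff 1 (Complex.I * σ * (r - d)) (-(r + Complex.I * σ * d)) l / l ^ 3
    + 6 * expDiff 0 (Complex.I * σ * (r - d)) (-(r + Complex.I * σ * d)) l / l ^ 4)

lemma hasDerivAt_modKer (σ r d : ℝ) {l : ℝ} (hl : l ≠ 0) :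
    HasDerivAt (modKer σ r d) (modKer₁ σ r d l) l := by
  have hl' : (l : ℂ) ≠ 0 := Complex.ofReal_ne_zero.2 hl
  have hid : HasDerivAt (fun l : ℝ ↦ (l : ℂ)) 1 l := by
    simpa using (hasDerivAt_id l).ofReal_comp
  have h := (((hasDerivAt_expDiff 0 (Complex.I * σ * (r - d)) (-(r + Complex.I * σ * d)) l).div
    (hid.pow 2) (pow_ne_zero 2 hl')).const_mul (1 / (8 * π * r) : ℂ))
  refine h.congr_deriv ?_
  simp only [modKer₁, Pi.pow_apply]
  congr 1
  field_simp
  push_cast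
  ring

lemma hasDerivAt_modKer₁ (σ r d : ℝ) {l : ℝ} (hl : l ≠ 0) :
    HasDerivAt (modKer₁ σ r d) (modKer₂ σ r d l) l := by
  have hl' : (l : ℂ) ≠ 0 := Complex.ofReal_ne_zero.2 hl
  have hid : HasDerivAt (fun l : ℝ ↦ (l : ℂ)) 1 l := by
    simpa using (hasDerivAt_id l).ofReal_comp
  have h := ((((hasDerivAt_expDiff 1 (Complex.I * σ * (r - d)) (-(r + Complex.I * σ * d)) l).div
    (hid.pow 2) (pow_ne_zero 2 hl')).sub
    (((hasDerivAt_expDiff 0 (Complex.I * σ * (r - d)) (-(r + Complex.I * σ * d)) l).const_mul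
      2).div (hid.pow 3) (pow_ne_zero 3 hl'))).const_mul (1 / (8 * π * r) : ℂ))
  refine h.congr_deriv ?_
  simp only [modKer₂, Pi.pow_apply]
  congr 1
  field_simp
  push_cast
  ring

lemma one_add_sq_mul_exp_neg_le {s : ℝ} (hs : 0 ≤ s) : (1 + s) ^ 2 * Real.exp (-s) ≤ 2 := by
  have h := Real.quadratic_le_exp_of_nonneg hs
  rw [Real.exp_neg, ← div_eq_mul_inv, div_le_iff₀ (Real.exp_pos s)]
  nlinarith

section Bounds

variable {σ r d l w : ℝ}

lemma norm_expDiff_le (hσ : σ = 1 ∨ σ = -1) (hr : 0 ≤ r) (hl : 0 < l) (hl2 : l ≤ 2)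
    (hw : 1 ≤ w) (hrd : |r - d| ≤ w) :
    ‖expDiff 0 (Complex.I * σ * (r - d)) (-(r + Complex.I * σ * d)) l‖ ≤ 6 * (l * r / (1 + l * r))
    ∧ l * ‖expDiff 1 (Complex.I * σ * (r - d)) (-(r + Complex.I * σ * d)) l‖
      ≤ 14 * w * (l * r / (1 + l * r))
    ∧ l ^ 2 * ‖expDiff 2 (Complex.I * σ * (r - d)) (-(r + Complex.I * σ * d)) l‖
      ≤ 36 * w ^ 2 * (l * r / (1 + l * r)) := by
  have hσn : ‖(σ : ℂ)‖ = 1 := by rcases hσ with rfl | rfl <;> simp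
  have hσre : ‖(1 + Complex.I * σ : ℂ)‖ ≤ 2 := by
    refine (norm_add_le _ _).trans ?_
    rw [norm_mul, hσn, Complex.norm_I, norm_one]
    norm_num
  set p : ℂ := Complex.I * σ * (r - d) with hp
  set q : ℂ := -(r + Complex.I * σ * d) with hq
  have hpq : p - q = (1 + Complex.I * σ) * r := by rw [hp, hq]; ring
  have hpqn : ‖p - q‖ ≤ 2 * r := by
    rw [hpq, norm_mul, Complex.norm_real, Real.norm_eq_abs, abs_of_nonneg hr]
    gcongr
  have hpn : ‖p‖ ≤ w := by
    rw [hp, norm_mul, norm_mul, Complex.norm_I, hσn, ← Complex.ofReal_sub, Complex.norm_real]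
    simpa using hrd
  have hqn : ‖q‖ ≤ w + 2 * r := by
    have : q = p - (p - q) := by ring
    rw [this]
    exact (norm_sub_le _ _).trans (add_le_add hpn hpqn)
  have hep : ‖Complex.exp (p * l)‖ = 1 := by
    rw [Complex.norm_exp, hp]
    simp [Complex.mul_re]
  have heq : ‖Complex.exp (q * l)‖ = Real.exp (-(l * r)) := by
    rw [Complex.norm_exp, hq]
    simp [Complex.mul_re]
    ring
  set s := l * r with hs
  have hs0 : 0 ≤ s := by positivity
  set m := s / (1 + s) with hm
  have hm0 : 0 ≤ m := by positivity
  have h2 := one_add_sq_mul_exp_neg_le hs0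
  have hse2 : s * (1 + s) * Real.exp (-s) ≤ 2 * m := by
    rw [hm, mul_div_assoc', le_div_iff₀ (by positivity)]
    nlinarith
  have hse1 : s * Real.exp (-s) ≤ m := by
    rw [hm, le_div_iff₀ (by positivity), mul_assoc]
    have h3 := Real.add_one_le_exp s
    have h4 : Real.exp (-s) * (1 + s) ≤ 1 := by
      rw [Real.exp_neg, inv_mul_le_iff₀ (Real.exp_pos s)]
      linarith
    exact mul_le_of_le_one_right hs0 h4
  have hD0 : ‖expDiff 0 p q l‖ ≤ 6 * m := by
    have hfac : expDiff 0 p q l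
        = -(Complex.exp (p * l) * (Complex.exp (-((p - q) * l)) - 1)) := by
      simp only [expDiff, pow_zero, one_mul]
      rw [mul_sub, ← Complex.exp_add]
      ring_nf
    have hx : ‖-((p - q) * (l : ℂ))‖ ≤ 2 * s := by
      rw [norm_neg, norm_mul, Complex.norm_real, Real.norm_eq_abs, abs_of_pos hl, hs]
      nlinarith
    rcases le_total s (1 / 2) with h | h
    · rw [hfac, norm_neg, norm_mul, hep, one_mul]
      refine (Complex.norm_exp_sub_one_le (hx.trans (by linarith))).trans ?_
      rw [hm, mul_div_assoc', le_div_iff₀ (by positivity)]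
      nlinarith
    · have h1 : ‖expDiff 0 p q l‖ ≤ 2 := by
        simp only [expDiff, pow_zero, one_mul]
        refine (norm_sub_le _ _).trans ?_
        rw [hep, heq]
        have : Real.exp (-s) ≤ 1 := Real.exp_le_one_iff.2 (by linarith)
        linarith
      refine h1.trans ?_
      rw [hm, mul_div_assoc', le_div_iff₀ (by positivity)]
      linarith
  have hD1 : l * ‖expDiff 1 p q l‖ ≤ 14 * w * m := by
    have h1 : ‖expDiff 1 p q l‖ ≤ w * (6 * m) + 2 * r * Real.exp (-s) := by
      rw [expDiff_succ 0]
      refine (norm_add_le _ _).trans (add_le_add ?_ ?_)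
      · rw [norm_mul]; gcongr
      · rw [norm_mul, pow_zero, one_mul, heq]; gcongr
    calc l * ‖expDiff 1 p q l‖ ≤ l * (w * (6 * m) + 2 * r * Real.exp (-s)) := by gcongr
      _ = l * (w * (6 * m)) + 2 * (s * Real.exp (-s)) := by rw [hs]; ring
      _ ≤ 2 * (w * (6 * m)) + 2 * (w * m) := by
        have := hse1.trans (le_mul_of_one_le_left hm0 hw)
        gcongr
      _ = 14 * w * m := by ring
  refine ⟨hD0, hD1, ?_⟩
  have h1 : ‖expDiff 2 p q l‖
      ≤ w * ‖expDiff 1 p q l‖ + 2 * r * ((w + 2 * r) * Real.exp (-s)) := by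
    rw [expDiff_succ 1]
    refine (norm_add_le _ _).trans (add_le_add ?_ ?_)
    · rw [norm_mul]; gcongr
    · rw [norm_mul, pow_one, norm_mul, heq]; gcongr
  have h3 : l * (w + 2 * r) ≤ 2 * w * (1 + s) := by
    rw [hs]
    nlinarith [mul_nonneg hl.le hr]
  calc l ^ 2 * ‖expDiff 2 p q l‖
      ≤ l ^ 2 * (w * ‖expDiff 1 p q l‖ + 2 * r * ((w + 2 * r) * Real.exp (-s))) := by gcongr
    _ = l * w * (l * ‖expDiff 1 p q l‖) + 2 * s * (l * (w + 2 * r)) * Real.exp (-s) := by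
      rw [hs]; ring
    _ ≤ 2 * w * (14 * w * m) + 2 * s * (2 * w * (1 + s)) * Real.exp (-s) := by gcongr
    _ = 28 * w ^ 2 * m + 4 * w * (s * (1 + s) * Real.exp (-s)) := by ring
    _ ≤ 28 * w ^ 2 * m + 4 * (w * w) * (2 * m) := by
      gcongr
      exact le_mul_of_one_le_left (by linarith) hw
    _ = 36 * w ^ 2 * m := by ring

lemma inv_mul_le_of_dist (hr : 0 ≤ r) (hl : 0 < l) {n : ℕ} {a z : ℝ} (hz : 0 ≤ z)
    (ha : a ≤ z * (l * r / (1 + l * r))) :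
    1 / (8 * π * r) * (a / l ^ (n + 1)) ≤ z / 24 * (l ^ n)⁻¹ / (1 + l * r) := by
  have hpi := Real.pi_gt_three
  rcases hr.eq_or_lt with rfl | hr
  · simp only [mul_zero, div_zero, zero_mul]
    positivity
  · have h1 : 1 / (8 * π * r) ≤ 1 / (24 * r) := by
      gcongr
      linarith
    have hs : 0 < 1 + l * r := by positivity
    calc 1 / (8 * π * r) * (a / l ^ (n + 1))
        ≤ 1 / (8 * π * r) * (z * (l * r / (1 + l * r)) / l ^ (n + 1)) := by gcongr
      _ ≤ 1 / (24 * r) * (z * (l * r / (1 + l * r)) / l ^ (n + 1)) := by gcongr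
      _ = _ := by
        rw [pow_succ]
        field_simp

lemma norm_modKer_le (hσ : σ = 1 ∨ σ = -1) (hr : 0 ≤ r) (hd : 0 ≤ d) (hl : 0 < l) (hl2 : l ≤ 2)
    (hw : 1 ≤ w) (hrd : |r - d| ≤ w - 1) :
    ‖modKer σ r d l‖ ≤ 6 * l⁻¹ / (1 + l * d) * w ^ 2
    ∧ ‖modKer₁ σ r d l‖ ≤ 6 * (l ^ 2)⁻¹ / (1 + l * d) * w ^ 2
    ∧ ‖modKer₂ σ r d l‖ ≤ 6 * (l ^ 3)⁻¹ * w ^ 2 := by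
  obtain ⟨h0, h1, h2⟩ := norm_expDiff_le hσ hr hl hl2 hw (hrd.trans (by linarith))
  set p : ℂ := Complex.I * σ * (r - d) with hp
  set q : ℂ := -(r + Complex.I * σ * d) with hq
  set m := l * r / (1 + l * r) with hm
  have hm0 : 0 ≤ m := by positivity
  have hln : ∀ n : ℕ, ‖(l : ℂ) ^ n‖ = l ^ n := fun n ↦ by
    rw [norm_pow, Complex.norm_real, Real.norm_eq_abs, abs_of_pos hl]
  have hcn : ‖(1 / (8 * π * r) : ℂ)‖ = 1 / (8 * π * r) := by
    rw [show (1 / (8 * π * r) : ℂ) = ((1 / (8 * π * r) : ℝ) : ℂ) by push_cast; rfl,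
      Complex.norm_real, Real.norm_eq_abs, abs_of_nonneg (by positivity)]
  have hcomp : 1 / (1 + l * r) ≤ 2 * w / (1 + l * d) := by
    rw [div_le_div_iff₀ (by positivity) (by positivity)]
    have h3 : d ≤ r + (w - 1) := by linarith [(abs_le.1 hrd).1]
    nlinarith [mul_nonneg hl.le hr, mul_nonneg hl.le (sub_nonneg.2 hw)]
  have hdrop : 1 / (1 + l * r) ≤ 1 := by
    rw [div_le_one (by positivity)]
    linarith [mul_nonneg hl.le hr]
  have hww : w ≤ w ^ 2 := by nlinarith
  refine ⟨?_, ?_, ?_⟩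
  · rw [modKer, norm_mul, hcn, norm_div, hln]
    refine (inv_mul_le_of_dist (n := 1) hr hl (by norm_num) h0).trans ?_
    calc 6 / 24 * (l ^ 1)⁻¹ / (1 + l * r) = 1 / 4 * l⁻¹ * (1 / (1 + l * r)) := by
          rw [pow_one]; ring
      _ ≤ 1 / 4 * l⁻¹ * (2 * w / (1 + l * d)) := by gcongr
      _ = 1 / 2 * (l⁻¹ / (1 + l * d) * w) := by ring
      _ ≤ 6 * (l⁻¹ / (1 + l * d) * w ^ 2) := by
        refine mul_le_mul (by norm_num) ?_ (by positivity) (by norm_num)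
        gcongr
      _ = _ := by ring
  · have hn : ‖expDiff 1 p q l / l ^ 2 - 2 * expDiff 0 p q l / l ^ 3‖
        ≤ (l * ‖expDiff 1 p q l‖ + 2 * ‖expDiff 0 p q l‖) / l ^ (2 + 1) := by
      refine (norm_sub_le _ _).trans (le_of_eq ?_)
      rw [norm_div, norm_div, norm_mul, hln, hln, Complex.norm_ofNat]
      field_simp
      ring
    have ha : l * ‖expDiff 1 p q l‖ + 2 * ‖expDiff 0 p q l‖ ≤ 26 * w * m := by
      nlinarith [mul_nonneg (sub_nonneg.2 hw) hm0]
    rw [modKer₁, norm_mul, hcn]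
    refine (mul_le_mul_of_nonneg_left hn (by positivity)).trans
      ((inv_mul_le_of_dist (n := 2) hr hl (by positivity) ha).trans ?_)
    calc 26 * w / 24 * (l ^ 2)⁻¹ / (1 + l * r)
        = 26 / 24 * w * (l ^ 2)⁻¹ * (1 / (1 + l * r)) := by ring
      _ ≤ 26 / 24 * w * (l ^ 2)⁻¹ * (2 * w / (1 + l * d)) := by gcongr
      _ = 26 / 12 * ((l ^ 2)⁻¹ / (1 + l * d) * w ^ 2) := by ring
      _ ≤ 6 * ((l ^ 2)⁻¹ / (1 + l * d) * w ^ 2) := by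
        gcongr
        norm_num
      _ = _ := by ring
  · have hn : ‖expDiff 2 p q l / l ^ 2 - 4 * expDiff 1 p q l / l ^ 3 + 6 * expDiff 0 p q l / l ^ 4‖
        ≤ (l ^ 2 * ‖expDiff 2 p q l‖ + 4 * (l * ‖expDiff 1 p q l‖) + 6 * ‖expDiff 0 p q l‖)
          / l ^ (3 + 1) := by
      refine (norm_add_le _ _).trans ((add_le_add_left (norm_sub_le _ _) _).trans (le_of_eq ?_))
      rw [norm_div, norm_div, norm_div, norm_mul, norm_mul, hln, hln, hln, Complex.norm_ofNat,
        Complex.norm_ofNat]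
      field_simp
      ring
    have ha : l ^ 2 * ‖expDiff 2 p q l‖ + 4 * (l * ‖expDiff 1 p q l‖) + 6 * ‖expDiff 0 p q l‖
        ≤ 128 * w ^ 2 * m := by
      nlinarith [mul_nonneg (sub_nonneg.2 hww) hm0,
        mul_nonneg (sub_nonneg.2 (hw.trans hww)) hm0]
    rw [modKer₂, norm_mul, hcn]
    refine (mul_le_mul_of_nonneg_left hn (by positivity)).trans
      ((inv_mul_le_of_dist (n := 3) hr hl (by positivity) ha).trans ?_)
    calc 128 * w ^ 2 / 24 * (l ^ 3)⁻¹ / (1 + l * r)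
        = 128 / 24 * w ^ 2 * (l ^ 3)⁻¹ * (1 / (1 + l * r)) := by ring
      _ ≤ 128 / 24 * w ^ 2 * (l ^ 3)⁻¹ * 1 := by gcongr
      _ = 128 / 24 * ((l ^ 3)⁻¹ * w ^ 2) := by ring
      _ ≤ 6 * ((l ^ 3)⁻¹ * w ^ 2) := by
        gcongr
        norm_num
      _ = _ := by ring

end Bounds

/-! ### Differentiation in `L²` -/

section LTwo

variable {X : Type*} [MeasurableSpace X] {μ : Measure X}

lemma norm_sq_Lp_two_eq_integral (f : Lp ℂ 2 μ) : ‖f‖ ^ 2 = ∫ u, ‖f u‖ ^ 2 ∂μ := by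
  have h := @inner_self_eq_norm_sq_to_K ℂ _ _ _ _ f
  rw [L2.inner_def] at h
  simp only [inner_self_eq_norm_sq_to_K] at h
  have h2 : ((∫ u, ‖f u‖ ^ 2 ∂μ : ℝ) : ℂ) = ((‖f‖ ^ 2 : ℝ) : ℂ) := by
    rw [← integral_complex_ofReal]
    push_cast
    exact h
  exact (Complex.ofReal_injective h2).symm

/-- Differentiation under the `L²` norm, by dominated convergence. -/
lemma hasDerivAt_Lp_two_of_dominated {F F' : ℝ → X → ℂ} {g : X → ℝ} (hg : MemLp g 2 μ) {a b : ℝ}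
    (hd : ∀ l ∈ Set.Ioo a b, ∀ u, HasDerivAt (fun l ↦ F l u) (F' l u) l)
    (hbd : ∀ l ∈ Set.Ioo a b, ∀ u, ‖F' l u‖ ≤ g u)
    {f : ℝ → Lp ℂ 2 μ} (hf : ∀ l ∈ Set.Ioo a b, f l =ᵐ[μ] F l) {l : ℝ} (hl : l ∈ Set.Ioo a b)
    {f' : Lp ℂ 2 μ} (hf' : f' =ᵐ[μ] F' l) : HasDerivAt f f' l := by
  have hmem : ∀ᶠ s in nhdsWithin l {l}ᶜ, s ∈ Set.Ioo a b ∧ s ≠ l := by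
    refine Filter.Eventually.and ?_ self_mem_nhdsWithin
    exact nhdsWithin_le_nhds (Ioo_mem_nhds hl.1 hl.2)
  have hslope : ∀ s, slope f l s =ᵐ[μ] fun u ↦ (s - l)⁻¹ • (f s u - f l u) := fun s ↦ by
    rw [slope_def_module]
    filter_upwards [Lp.coeFn_smul ((s - l)⁻¹) (f s - f l), Lp.coeFn_sub (f s) (f l)] with u h1 h2
    rw [h1, Pi.smul_apply, h2, Pi.sub_apply]
  rw [hasDerivAt_iff_tendsto_slope, tendsto_iff_norm_sub_tendsto_zero]
  have hae : ∀ s ∈ Set.Ioo a b, (fun u ↦ ‖(slope f l s - f' : Lp ℂ 2 μ) u‖ ^ 2)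
      =ᵐ[μ] fun u ↦ ‖slope (fun s ↦ F s u) l s - F' l u‖ ^ 2 := fun s hs ↦ by
    filter_upwards [hslope s, Lp.coeFn_sub (slope f l s) f', hf s hs, hf l hl, hf'] with
      u h1 h2 h3 h4 h5
    rw [h2, Pi.sub_apply, h1, h3, h4, h5, slope_def_module]
  have hsq : Filter.Tendsto (fun s ↦ ‖slope f l s - f'‖ ^ 2) (nhdsWithin l {l}ᶜ) (nhds 0) := by
    simp only [norm_sq_Lp_two_eq_integral]
    have hlim : Filter.Tendsto (fun s ↦ ∫ u, ‖slope (fun s ↦ F s u) l s - F' l u‖ ^ 2 ∂μ)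
        (nhdsWithin l {l}ᶜ) (nhds (∫ _, (0 : ℝ) ∂μ)) := by
      refine tendsto_integral_filter_of_dominated_convergence (fun u ↦ (2 * g u) ^ 2) ?_ ?_ ?_ ?_
      · filter_upwards [hmem] with s hs
        exact ((Lp.aestronglyMeasurable _).norm.pow 2).congr (hae s hs.1)
      · filter_upwards [hmem] with s hs
        refine Filter.Eventually.of_forall fun u ↦ ?_
        rw [norm_pow, norm_norm]
        refine pow_le_pow_left₀ (norm_nonneg _) ((norm_sub_le _ _).trans ?_) 2
        have hmv : ‖F s u - F l u‖ ≤ g u * ‖s - l‖ :=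
          (convex_Ioo a b).norm_image_sub_le_of_norm_hasDerivWithin_le
            (fun z hz ↦ (hd z hz u).hasDerivWithinAt) (fun z hz ↦ hbd z hz u) hl hs.1
        have hsl : 0 < ‖s - l‖ := norm_pos_iff.2 (sub_ne_zero.2 hs.2)
        have : ‖slope (fun s ↦ F s u) l s‖ ≤ g u := by
          rw [slope_def_module, norm_smul, norm_inv, inv_mul_le_iff₀ hsl]
          linarith
        linarith [hbd l hl u]
      · simp only [mul_pow]
        exact hg.integrable_sq.const_mul _
      · refine Filter.Eventually.of_forall fun u ↦ ?_
        have h := hasDerivAt_iff_tendsto_slope.1 (hd l hl u)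
        rw [tendsto_iff_norm_sub_tendsto_zero] at h
        simpa using h.pow 2
    rw [integral_zero] at hlim
    refine hlim.congr' ?_
    filter_upwards [hmem] with s hs using (integral_congr_ae (hae s hs.1)).symm
  have := hsq.sqrt
  simpa [Real.sqrt_sq (norm_nonneg _)] using this

/-- The class in `L²` of a function, or `0` if the function is not square integrable. -/
def toLTwo (μ : Measure X) (f : X → ℂ) : Lp ℂ 2 μ :=
  open Classical in if h : MemLp f 2 μ then h.toLp f else 0

lemma coeFn_toLTwo {f : X → ℂ} (h : MemLp f 2 μ) : toLTwo μ f =ᵐ[μ] f := by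
  rw [toLTwo, dif_pos h]
  exact h.coeFn_toLp

lemma norm_toLTwo_le {f : X → ℂ} (hf : AEStronglyMeasurable f μ) {g : X → ℝ} (hg : MemLp g 2 μ)
    {c : ℝ} (hc : 0 ≤ c)
    (h : ∀ u, ‖f u‖ ≤ c * g u) : ‖toLTwo μ f‖ ≤ c * ‖hg.toLp g‖ := by
  have hmem : MemLp f 2 μ := (hg.const_mul c).mono' hf (Filter.Eventually.of_forall h)
  refine Lp.norm_le_mul_norm_of_ae_le_mul ?_
  filter_upwards [coeFn_toLTwo hmem, hg.coeFn_toLp] with u h1 h2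
  rw [h1, h2]
  exact (h u).trans (mul_le_mul_of_nonneg_left (le_abs_self _) hc)

end LTwo

/-! ### Sesquilinear pairings with symbol-type bounds -/

section Pairing

variable {H : Type*} [NormedAddCommGroup H] [InnerProductSpace ℂ H]

lemma hasDerivAt_clm_apply_restrictScalars {T : ℝ → H →L[ℂ] H} {T' : H →L[ℂ] H} {g : ℝ → H}
    {g' : H} {l : ℝ} (hT : HasDerivAt T T' l) (hg : HasDerivAt g g' l) :
    HasDerivAt (fun l ↦ T l (g l)) (T' (g l) + T l g') l := by
  have hT' : HasDerivAt (fun l ↦ (T l).restrictScalars ℝ) (T'.restrictScalars ℝ) l :=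
    (ContinuousLinearMap.restrictScalarsL ℂ H H ℝ ℝ).hasFDerivAt.comp_hasDerivAt l hT
  exact hT'.clm_apply hg

/-- The formal first derivative of `⟪f, T g⟫`. -/
def pairing₁ (f f₁ g g₁ : H) (T T₁ : H →L[ℂ] H) : ℂ :=
  inner ℂ f (T₁ g + T g₁) + inner ℂ f₁ (T g)

/-- The formal second derivative of `⟪f, T g⟫`. -/
def pairing₂ (f f₁ f₂ g g₁ g₂ : H) (T T₁ T₂ : H →L[ℂ] H) : ℂ :=
  inner ℂ f (T₂ g + T₁ g₁ + (T₁ g₁ + T g₂)) + inner ℂ f₁ (T₁ g + T g₁)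
    + (inner ℂ f₁ (T₁ g + T g₁) + inner ℂ f₂ (T g))

variable {f f₁ f₂ g g₁ g₂ : ℝ → H} {T T₁ T₂ : ℝ → H →L[ℂ] H} {l : ℝ}

lemma hasDerivAt_pairing (hf : HasDerivAt f (f₁ l) l) (hg : HasDerivAt g (g₁ l) l)
    (hT : HasDerivAt T (T₁ l) l) :
    HasDerivAt (fun l ↦ inner ℂ (f l) (T l (g l)))
      (pairing₁ (f l) (f₁ l) (g l) (g₁ l) (T l) (T₁ l)) l :=
  hf.inner ℂ (hasDerivAt_clm_apply_restrictScalars hT hg)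

lemma hasDerivAt_pairing₁ (hf : HasDerivAt f (f₁ l) l) (hf₁ : HasDerivAt f₁ (f₂ l) l)
    (hg : HasDerivAt g (g₁ l) l) (hg₁ : HasDerivAt g₁ (g₂ l) l)
    (hT : HasDerivAt T (T₁ l) l) (hT₁ : HasDerivAt T₁ (T₂ l) l) :
    HasDerivAt (fun l ↦ pairing₁ (f l) (f₁ l) (g l) (g₁ l) (T l) (T₁ l))
      (pairing₂ (f l) (f₁ l) (f₂ l) (g l) (g₁ l) (g₂ l) (T l) (T₁ l) (T₂ l)) l :=
  (hf.inner ℂ ((hasDerivAt_clm_apply_restrictScalars hT₁ hg).add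
    (hasDerivAt_clm_apply_restrictScalars hT hg₁))).add
    (hf₁.inner ℂ (hasDerivAt_clm_apply_restrictScalars hT hg))

lemma norm_inner_clm_le (f g : H) (T : H →L[ℂ] H) {a b c : ℝ} (hf : ‖f‖ ≤ a) (hg : ‖g‖ ≤ b)
    (hT : ‖T‖ ≤ c) : ‖inner ℂ f (T g)‖ ≤ a * (c * b) := by
  have ha := (norm_nonneg _).trans hf
  refine (norm_inner_le_norm _ _).trans (mul_le_mul hf ?_ (norm_nonneg _) ha)
  exact (T.le_opNorm g).trans (mul_le_mul hT hg (norm_nonneg _) ((norm_nonneg _).trans hT))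

lemma norm_pairing_le {f f₁ f₂ g g₁ g₂ : H} {T T₁ T₂ : H →L[ℂ] H} {G C l x y : ℝ} (hl : 0 < l)
    (hG : 0 ≤ G) (hC : 0 ≤ C) (hx : 0 ≤ x) (hy : 0 ≤ y)
    (hf : ‖f‖ ≤ G * l⁻¹ / (1 + l * x)) (hf₁ : ‖f₁‖ ≤ G * (l ^ 2)⁻¹ / (1 + l * x))
    (hf₂ : ‖f₂‖ ≤ G * (l ^ 3)⁻¹)
    (hg : ‖g‖ ≤ G * l⁻¹ / (1 + l * y)) (hg₁ : ‖g₁‖ ≤ G * (l ^ 2)⁻¹ / (1 + l * y))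
    (hg₂ : ‖g₂‖ ≤ G * (l ^ 3)⁻¹)
    (hT : ‖T‖ ≤ C * l) (hT₁ : ‖T₁‖ ≤ C) (hT₂ : ‖T₂‖ ≤ C * l⁻¹) :
    ‖inner ℂ f (T g)‖ ≤ 9 * C * G ^ 2 * l⁻¹ / (1 + l * (x + y))
    ∧ ‖pairing₁ f f₁ g g₁ T T₁‖ ≤ 9 * C * G ^ 2 * (l ^ 2)⁻¹ / (1 + l * (x + y))
    ∧ ‖pairing₂ f f₁ f₂ g g₁ g₂ T T₁ T₂‖ ≤ 9 * C * G ^ 2 * (l ^ 3)⁻¹ := by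
  have hxy : (1 + l * x)⁻¹ * (1 + l * y)⁻¹ ≤ (1 + l * (x + y))⁻¹ := by
    rw [← mul_inv]
    refine inv_anti₀ (by positivity) ?_
    nlinarith [mul_nonneg (mul_nonneg hl.le hx) (mul_nonneg hl.le hy)]
  have hdrop : ∀ a z : ℝ, 0 ≤ a → 0 ≤ z → a / (1 + l * z) ≤ a := fun a z ha hz ↦
    div_le_self ha (by nlinarith [mul_nonneg hl.le hz])
  have hf' := hf.trans (hdrop _ _ (by positivity) hx)
  have hf₁' := hf₁.trans (hdrop _ _ (by positivity) hx)
  have hg' := hg.trans (hdrop _ _ (by positivity) hy)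
  have hg₁' := hg₁.trans (hdrop _ _ (by positivity) hy)
  have hfin : ∀ k : ℕ, ∀ c : ℝ, c ≤ 9 →
      c * C * G ^ 2 * (l ^ k)⁻¹ * ((1 + l * x)⁻¹ * (1 + l * y)⁻¹)
        ≤ 9 * C * G ^ 2 * (l ^ k)⁻¹ / (1 + l * (x + y)) := fun k c hc ↦ by
    rw [div_eq_mul_inv]
    gcongr
  refine ⟨?_, ?_, ?_⟩
  · have h := hfin 1 1 (by norm_num)
    rw [pow_one] at h
    refine (norm_inner_clm_le f g T hf hg hT).trans (le_trans (le_of_eq ?_) h)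
    field_simp
  · refine le_trans ?_ (hfin 2 3 (by norm_num))
    rw [pairing₁, inner_add_right]
    refine norm_add₃_le.trans ?_
    have e1 := norm_inner_clm_le f g T₁ hf hg hT₁
    have e2 := norm_inner_clm_le f g₁ T hf hg₁ hT
    have e3 := norm_inner_clm_le f₁ g T hf₁ hg hT
    refine (add_le_add (add_le_add e1 e2) e3).trans (le_of_eq ?_)
    field_simp
    ring
  · rw [pairing₂]
    simp only [inner_add_right]
    have e1 := norm_inner_clm_le f g T₂ hf' hg' hT₂
    have e2 := norm_inner_clm_le f g₁ T₁ hf' hg₁' hT₁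
    have e3 := norm_inner_clm_le f g₂ T hf' hg₂ hT
    have e4 := norm_inner_clm_le f₁ g T₁ hf₁' hg' hT₁
    have e5 := norm_inner_clm_le f₁ g₁ T hf₁' hg₁' hT
    have e6 := norm_inner_clm_le f₂ g T hf₂ hg' hT
    have hsum : ∀ a b c d e i : ℂ, ‖a + b + (b + c) + (d + e) + (d + e + i)‖
        ≤ ‖a‖ + 2 * ‖b‖ + ‖c‖ + 2 * ‖d‖ + 2 * ‖e‖ + ‖i‖ := fun a b c d e i ↦ by
      have h1 := norm_add_le (a + b + (b + c) + (d + e)) (d + e + i)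
      have h2 := norm_add₃_le (a := a + b) (b := b + c) (c := d + e)
      have h3 := norm_add₃_le (a := d) (b := e) (c := i)
      have h4 := norm_add_le a b
      have h5 := norm_add_le b c
      have h6 := norm_add_le d e
      linarith
    refine (hsum _ _ _ _ _ _).trans ?_
    refine (add_le_add (add_le_add (add_le_add (add_le_add (add_le_add e1
      (mul_le_mul_of_nonneg_left e2 zero_le_two)) e3) (mul_le_mul_of_nonneg_left e4 zero_le_two))
      (mul_le_mul_of_nonneg_left e5 zero_le_two)) e6).trans (le_of_eq ?_)
    field_simp
    ring

end Pairing

/-! ### Multiplication by a cutoff -/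

lemma eq_zero_of_hasDerivAt_of_eq_zero_Ici {E : Type*} [NormedAddCommGroup E] [NormedSpace ℝ E]
    {f : ℝ → E} {f' : E} {c l : ℝ} (hf : HasDerivAt f f' l) (h0 : ∀ s, c ≤ s → f s = 0)
    (hl : c ≤ l) : f' = 0 := by
  have h1 : HasDerivWithinAt f 0 (Set.Ici c) l :=
    (hasDerivWithinAt_const l (Set.Ici c) (0 : E)).congr (fun s hs ↦ h0 s hs) (h0 l hl)
  exact (uniqueDiffOn_Ici c l hl).eq_deriv _ hf.hasDerivWithinAt h1

/-- The product of a function vanishing to second order at `c` and beyond with a function which is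
only controlled below `c` is differentiable. -/
lemma hasDerivAt_mul_of_eq_zero_Ici {φ φ₁ A A₁ : ℝ → ℂ} {c B : ℝ} (hc : 0 < c)
    (hφ : ∀ l, 0 < l → HasDerivAt φ (φ₁ l) l) (h0 : ∀ l, c ≤ l → φ l = 0)
    (hA : ∀ l ∈ Set.Ioo 0 c, HasDerivAt A (A₁ l) l) (hB : ∀ l ∈ Set.Ioo (c / 2) c, ‖A l‖ ≤ B)
    {l : ℝ} (hl : 0 < l) : HasDerivAt (fun l ↦ φ l * A l) (φ₁ l * A l + φ l * A₁ l) l := by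
  have h1 : ∀ l, c ≤ l → φ₁ l = 0 := fun l hl ↦
    eq_zero_of_hasDerivAt_of_eq_zero_Ici (hφ l (hc.trans_le hl)) h0 hl
  rcases lt_trichotomy l c with h | rfl | h
  · exact (hφ l hl).mul (hA l ⟨hl, h⟩)
  · rw [h1 l le_rfl, h0 l le_rfl, zero_mul, zero_mul, add_zero, hasDerivAt_iff_isLittleO]
    have h2 := hasDerivAt_iff_isLittleO.1 (hφ l hl)
    simp only [h1 l le_rfl, h0 l le_rfl, smul_zero, sub_zero, zero_mul] at h2 ⊢
    refine Asymptotics.IsBigO.trans_isLittleO (Asymptotics.IsBigO.of_bound B ?_) h2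
    filter_upwards [Ioi_mem_nhds (half_lt_self hl)] with s hs
    rcases lt_or_ge s l with h | h
    · rw [norm_mul, mul_comm]
      exact mul_le_mul_of_nonneg_right (hB s ⟨hs, h⟩) (norm_nonneg _)
    · simp [h0 s h]
  · rw [h1 l h.le, h0 l h.le, zero_mul, zero_mul, add_zero]
    refine (hasDerivAt_const l (0 : ℂ)).congr_of_eventuallyEq ?_
    filter_upwards [Ioi_mem_nhds h] with s hs
    rw [h0 s (le_of_lt hs), zero_mul]

lemma hasDerivAt_mul_rpow {χ : ℝ → ℝ} {χ' l : ℝ} (h : HasDerivAt χ χ' l) (hl : 0 < l) (p : ℝ) :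
    HasDerivAt (fun l ↦ χ l * l ^ p) (χ' * l ^ p + p * (χ l * l ^ (p - 1))) l :=
  (h.mul (Real.hasDerivAt_rpow_const (p := p) (Or.inl hl.ne'))).congr_deriv (by ring)

lemma exists_symbol_bounds {χ : ℝ → ℝ} (hχ : ContDiff ℝ (⊤ : ℕ∞) χ) {c : ℝ} (hc2 : c ≤ 2)
    (hχ0 : ∀ l, c ≤ l → χ l = 0) {p : ℝ} (hp : 0 < p) (hp3 : p ≤ 3) :
    ∃ K : ℝ, 0 ≤ K ∧ ∃ ψ₁ ψ₂ : ℝ → ℝ,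
      (∀ l, 0 < l → HasDerivAt (fun l ↦ χ l * l ^ p) (ψ₁ l) l) ∧
      (∀ l, 0 < l → HasDerivAt ψ₁ (ψ₂ l) l) ∧
      (∀ l, 0 < l → |χ l * l ^ p| ≤ K * l ^ p) ∧
      (∀ l, 0 < l → |ψ₁ l| ≤ K * l ^ (p - 1)) ∧
      (∀ l, 0 < l → |ψ₂ l| ≤ K * l ^ (p - 2)) := by
  have hχ1 := contDiff_infty_iff_deriv.1 hχ
  have hχ2 := contDiff_infty_iff_deriv.1 hχ1.2
  have hd1 : ∀ l, HasDerivAt χ (deriv χ l) l := fun l ↦ (hχ1.1 l).hasDerivAt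
  have hd2 : ∀ l, HasDerivAt (deriv χ) (deriv (deriv χ) l) l := fun l ↦ (hχ2.1 l).hasDerivAt
  have hz1 : ∀ l, c ≤ l → deriv χ l = 0 := fun l hl ↦
    eq_zero_of_hasDerivAt_of_eq_zero_Ici (hd1 l) hχ0 hl
  have hz2 : ∀ l, c ≤ l → deriv (deriv χ) l = 0 := fun l hl ↦
    eq_zero_of_hasDerivAt_of_eq_zero_Ici (hd2 l) hz1 hl
  have hbd : ∀ f : ℝ → ℝ, Continuous f → (∀ l, c ≤ l → f l = 0) →
      ∃ B, 0 ≤ B ∧ ∀ l, 0 < l → |f l| ≤ B := fun f hf h0 ↦ by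
    obtain ⟨B, hB⟩ := (isCompact_Icc (a := (0 : ℝ)) (b := 2)).exists_bound_of_continuousOn
      hf.continuousOn
    refine ⟨B, (norm_nonneg _).trans (hB 0 ⟨le_rfl, by norm_num⟩), fun l hl ↦ ?_⟩
    rcases le_total l 2 with h | h
    · exact hB l ⟨hl.le, h⟩
    · rw [h0 l (hc2.trans h), abs_zero]
      exact (norm_nonneg _).trans (hB 0 ⟨le_rfl, by norm_num⟩)
  obtain ⟨B0, hB0, hb0⟩ := hbd χ hχ.continuous hχ0
  obtain ⟨B1, hB1, hb1⟩ := hbd _ hχ1.2.continuous hz1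
  obtain ⟨B2, hB2, hb2⟩ := hbd _ hχ2.2.continuous hz2
  have hpow : ∀ l : ℝ, 0 < l → ∀ q : ℝ, l ^ q = l * l ^ (q - 1) := fun l hl q ↦ by
    rw [Real.rpow_sub_one hl.ne']
    field_simp
  have hX0 : ∀ l, 0 < l → ∀ q : ℝ, |χ l * l ^ q| ≤ B0 * l ^ q := fun l hl q ↦ by
    rw [abs_mul, abs_of_pos (Real.rpow_pos_of_pos hl q)]
    exact mul_le_mul_of_nonneg_right (hb0 l hl) (Real.rpow_nonneg hl.le q)
  have hX1 : ∀ l, 0 < l → ∀ q : ℝ, |deriv χ l * l ^ q| ≤ 2 * B1 * l ^ (q - 1) := fun l hl q ↦ by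
    have hq := Real.rpow_nonneg hl.le (q - 1)
    rcases le_total l 2 with h | h
    · rw [abs_mul, abs_of_pos (Real.rpow_pos_of_pos hl q), hpow l hl q]
      calc |deriv χ l| * (l * l ^ (q - 1)) ≤ B1 * (2 * l ^ (q - 1)) := by
            gcongr
            exact hb1 l hl
        _ = _ := by ring
    · rw [hz1 l (hc2.trans h), zero_mul, abs_zero]
      positivity
  have hX2 : ∀ l, 0 < l → ∀ q : ℝ, |deriv (deriv χ) l * l ^ q| ≤ 4 * B2 * l ^ (q - 2) :=
    fun l hl q ↦ by
    have hq := Real.rpow_nonneg hl.le (q - 2)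
    rcases le_total l 2 with h | h
    · rw [abs_mul, abs_of_pos (Real.rpow_pos_of_pos hl q), hpow l hl q, hpow l hl (q - 1),
        show q - 1 - 1 = q - 2 by ring]
      calc |deriv (deriv χ) l| * (l * (l * l ^ (q - 2))) ≤ B2 * (2 * (2 * l ^ (q - 2))) := by
            gcongr
            exact hb2 l hl
        _ = _ := by ring
    · rw [hz2 l (hc2.trans h), zero_mul, abs_zero]
      positivity
  have hp1 : |p - 1| ≤ 2 := abs_le.2 ⟨by linarith, by linarith⟩
  refine ⟨4 * B2 + 12 * B1 + 6 * B0, by positivity,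
    fun l ↦ deriv χ l * l ^ p + p * (χ l * l ^ (p - 1)),
    fun l ↦ deriv (deriv χ) l * l ^ p + p * (deriv χ l * l ^ (p - 1))
      + p * (deriv χ l * l ^ (p - 1) + (p - 1) * (χ l * l ^ (p - 2))),
    fun l hl ↦ hasDerivAt_mul_rpow (hd1 l) hl p, fun l hl ↦ ?_, fun l hl ↦ ?_, fun l hl ↦ ?_,
    fun l hl ↦ ?_⟩
  · have h := (hasDerivAt_mul_rpow (hd2 l) hl p).add
      ((hasDerivAt_mul_rpow (hd1 l) hl (p - 1)).const_mul p)
    rw [show p - 1 - 1 = p - 2 by ring] at h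
    exact h
  · refine (hX0 l hl p).trans (mul_le_mul_of_nonneg_right ?_ (Real.rpow_nonneg hl.le p))
    linarith
  · have h1 := hX1 l hl p
    have h0 := hX0 l hl (p - 1)
    have hq := Real.rpow_nonneg hl.le (p - 1)
    have h2 : |p * (χ l * l ^ (p - 1))| ≤ 3 * (B0 * l ^ (p - 1)) := by
      rw [abs_mul, abs_of_pos hp]
      gcongr
    refine (abs_add_le _ _).trans ((add_le_add h1 h2).trans ?_)
    have e1 := mul_nonneg hB0 hq
    have e2 := mul_nonneg hB1 hq
    have e3 := mul_nonneg hB2 hq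
    linarith
  · have h2 := hX2 l hl p
    have h1 := hX1 l hl (p - 1)
    have h0 := hX0 l hl (p - 2)
    rw [show p - 1 - 1 = p - 2 by ring] at h1
    have hq := Real.rpow_nonneg hl.le (p - 2)
    have h3 : |p * (deriv χ l * l ^ (p - 1))| ≤ 3 * (2 * B1 * l ^ (p - 2)) := by
      rw [abs_mul, abs_of_pos hp]
      gcongr
    have h4 : |p * (deriv χ l * l ^ (p - 1) + (p - 1) * (χ l * l ^ (p - 2)))|
        ≤ 3 * (2 * B1 * l ^ (p - 2) + 2 * (B0 * l ^ (p - 2))) := by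
      rw [abs_mul, abs_of_pos hp]
      gcongr
      refine (abs_add_le _ _).trans (add_le_add h1 ?_)
      rw [abs_mul]
      gcongr
    refine (abs_add_le _ _).trans ((add_le_add ((abs_add_le _ _).trans (add_le_add h2 h3))
      h4).trans (le_of_eq ?_))
    ring

/-- The oscillatory integral bound for a smooth cutoff times `l ^ p` times an amplitude of symbol
type of order `-1` with decay. -/
lemma exists_norm_integral_cutoff_le {χ : ℝ → ℝ} (hχ : ContDiff ℝ (⊤ : ℕ∞) χ) {c : ℝ}
    (hc : 0 < c) (hc2 : c ≤ 2) (hχ0 : ∀ l, c ≤ l → χ l = 0) {p : ℝ} (hp : 0 < p) (hp3 : p ≤ 3) :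
    ∃ C : ℝ, 0 ≤ C ∧ ∀ Q : ℝ, 0 ≤ Q → ∀ ω t : ℝ, t ≠ 0 → ∀ A A₁ A₂ : ℝ → ℂ,
      (∀ l ∈ Set.Ioo 0 c, HasDerivAt A (A₁ l) l) →
      (∀ l ∈ Set.Ioo 0 c, HasDerivAt A₁ (A₂ l) l) →
      (∀ l ∈ Set.Ioo 0 c, ‖A l‖ ≤ Q * l⁻¹ / (1 + l * |ω|)) →
      (∀ l ∈ Set.Ioo 0 c, ‖A₁ l‖ ≤ Q * (l ^ 2)⁻¹ / (1 + l * |ω|)) →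
      (∀ l ∈ Set.Ioo 0 c, ‖A₂ l‖ ≤ Q * (l ^ 3)⁻¹) →
      ‖∫ l in Set.Ioi (0 : ℝ), Complex.exp (-Complex.I * t * (l : ℂ) ^ 2 + Complex.I * ω * l) *
        (((χ l * l ^ p : ℝ) : ℂ) * A l)‖ ≤ C * Q * |t| ^ (-p / 2) := by
  obtain ⟨K, hK, ψ₁, ψ₂, hd, hd₁, hb, hb₁, hb₂⟩ := exists_symbol_bounds hχ hc2 hχ0 hp hp3
  refine ⟨(1 / p + (26 + 2 * π)) * (4 * K), by positivity, ?_⟩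
  intro Q hQ ω t ht A A₁ A₂ hA hA₁ hbA hbA₁ hbA₂
  have hz : ∀ l, c ≤ l → χ l * l ^ p = 0 := fun l hl ↦ by rw [hχ0 l hl, zero_mul]
  have hz₁ : ∀ l, c ≤ l → ψ₁ l = 0 := fun l hl ↦
    eq_zero_of_hasDerivAt_of_eq_zero_Ici (hd l (hc.trans_le hl)) hz hl
  have hz₂ : ∀ l, c ≤ l → ψ₂ l = 0 := fun l hl ↦
    eq_zero_of_hasDerivAt_of_eq_zero_Ici (hd₁ l (hc.trans_le hl)) hz₁ hl
  have hcast : ∀ f : ℝ → ℝ, (∀ l, c ≤ l → f l = 0) → ∀ l, c ≤ l → (f l : ℂ) = 0 :=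
    fun f hf l hl ↦ by rw [hf l hl, Complex.ofReal_zero]
  have hloc : ∀ n : ℕ, ∀ l ∈ Set.Ioo (c / 2) c, Q * (l ^ n)⁻¹ ≤ Q * ((c / 2) ^ n)⁻¹ :=
    fun n l hl ↦ by
    have := hl.1
    gcongr
  have hdec : ∀ l, 0 < l → ∀ a, 0 ≤ a → a / (1 + l * |ω|) ≤ a := fun l hl a ha ↦
    div_le_self ha (by nlinarith [abs_nonneg ω])
  have hBA : ∀ l ∈ Set.Ioo (c / 2) c, ‖A l‖ ≤ Q * ((c / 2) ^ 1)⁻¹ := fun l hl ↦ by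
    have hl0 : 0 < l := (half_pos hc).trans hl.1
    refine ((hbA l ⟨hl0, hl.2⟩).trans (hdec l hl0 _ (by positivity))).trans ?_
    simpa using hloc 1 l hl
  have hBA₁ : ∀ l ∈ Set.Ioo (c / 2) c, ‖A₁ l‖ ≤ Q * ((c / 2) ^ 2)⁻¹ := fun l hl ↦ by
    have hl0 : 0 < l := (half_pos hc).trans hl.1
    exact ((hbA₁ l ⟨hl0, hl.2⟩).trans (hdec l hl0 _ (by positivity))).trans (hloc 2 l hl)
  have hdφ := fun l hl ↦ (hd l hl).ofReal_comp
  have hdφ₁ := fun l hl ↦ (hd₁ l hl).ofReal_comp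
  have hkey := norm_integral_Ioi_exp_mul_le (β := p - 1) (N := c) (M := 4 * K * Q) (ω := ω)
    (by linarith) (by linarith) ht (by positivity)
    (b := fun l ↦ ((χ l * l ^ p : ℝ) : ℂ) * A l)
    (b₁ := fun l ↦ (ψ₁ l : ℂ) * A l + ((χ l * l ^ p : ℝ) : ℂ) * A₁ l)
    (b₂ := fun l ↦ ((ψ₂ l : ℂ) * A l + (ψ₁ l : ℂ) * A₁ l)
      + ((ψ₁ l : ℂ) * A₁ l + ((χ l * l ^ p : ℝ) : ℂ) * A₂ l))
    (fun l hl ↦ hasDerivAt_mul_of_eq_zero_Ici hc hdφ (hcast _ hz) hA hBA hl)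
    (fun l hl ↦ (hasDerivAt_mul_of_eq_zero_Ici hc hdφ₁ (hcast _ hz₁) hA hBA hl).add
      (hasDerivAt_mul_of_eq_zero_Ici hc hdφ (hcast _ hz) hA₁ hBA₁ hl))
    ?_ ?_ ?_ (fun l hl ↦ by rw [hcast _ hz l hl, zero_mul])
  · rw [show p - 1 + 1 = p by ring] at hkey
    refine hkey.trans (le_of_eq ?_)
    ring
  all_goals
    intro l hl
    have hw : 0 < 1 + l * |ω| := by positivity
    have hq : ∀ q : ℝ, 0 ≤ l ^ q := fun q ↦ Real.rpow_nonneg hl.le q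
    have e1 : l ^ (p - 1) = l ^ p * l⁻¹ := by rw [Real.rpow_sub_one hl.ne', div_eq_mul_inv]
    have e2 : l ^ (p - 2) = l ^ p * (l ^ 2)⁻¹ := by
      rw [Real.rpow_sub hl, Real.rpow_two, div_eq_mul_inv]
    have e3 : l ^ (p - 3) = l ^ p * (l ^ 3)⁻¹ := by
      rw [Real.rpow_sub hl, show (3 : ℝ) = ((3 : ℕ) : ℝ) by norm_num, Real.rpow_natCast,
        div_eq_mul_inv]
    have hprod : ∀ {z w : ℂ} {a b : ℝ}, ‖z‖ ≤ a → ‖w‖ ≤ b → ‖z * w‖ ≤ a * b :=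
      fun hz hw ↦ by
      rw [norm_mul]
      exact mul_le_mul hz hw (norm_nonneg _) ((norm_nonneg _).trans hz)
    have n0 : ‖((χ l * l ^ p : ℝ) : ℂ)‖ ≤ K * l ^ p := by
      rw [Complex.norm_real]
      exact hb l hl
    have n1 : ‖(ψ₁ l : ℂ)‖ ≤ K * l ^ (p - 1) := by
      rw [Complex.norm_real]
      exact hb₁ l hl
    have n2 : ‖(ψ₂ l : ℂ)‖ ≤ K * l ^ (p - 2) := by
      rw [Complex.norm_real]
      exact hb₂ l hl
    rw [e1] at n1
    rw [e2] at n2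
    have hX := hq p
  · rcases lt_or_ge l c with h | h
    · refine (hprod n0 (hbA l ⟨hl, h⟩)).trans ?_
      rw [e1, show K * l ^ p * (Q * l⁻¹ / (1 + l * |ω|))
        = K * Q * (l ^ p * l⁻¹) / (1 + l * |ω|) by ring]
      gcongr
      nlinarith [mul_nonneg hK hQ]
    · rw [hcast _ hz l h, zero_mul, norm_zero]
      have := hq (p - 1)
      positivity
  · rw [show p - 1 - 1 = p - 2 by ring]
    rcases lt_or_ge l c with h | h
    · refine (norm_add_le _ _).trans ((add_le_add (hprod n1 (hbA l ⟨hl, h⟩))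
        (hprod n0 (hbA₁ l ⟨hl, h⟩))).trans ?_)
      rw [e2, show K * (l ^ p * l⁻¹) * (Q * l⁻¹ / (1 + l * |ω|))
        + K * l ^ p * (Q * (l ^ 2)⁻¹ / (1 + l * |ω|))
        = 2 * K * Q * (l ^ p * (l ^ 2)⁻¹) / (1 + l * |ω|) by ring]
      gcongr
      norm_num
    · rw [hcast _ hz l h, hcast _ hz₁ l h, zero_mul, zero_mul, add_zero, norm_zero]
      have := hq (p - 2)
      positivity
  · rw [show p - 1 - 2 = p - 3 by ring]
    rcases lt_or_ge l c with h | h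
    · have hA0 := (hbA l ⟨hl, h⟩).trans (hdec l hl _ (by positivity))
      have hA1 := (hbA₁ l ⟨hl, h⟩).trans (hdec l hl _ (by positivity))
      have hA2 := hbA₂ l ⟨hl, h⟩
      refine (norm_add_le _ _).trans ((add_le_add ((norm_add_le _ _).trans (add_le_add
        (hprod n2 hA0) (hprod n1 hA1))) ((norm_add_le _ _).trans (add_le_add
        (hprod n1 hA1) (hprod n0 hA2)))).trans (le_of_eq ?_))
      rw [e3]
      ring
    · rw [hcast _ hz l h, hcast _ hz₁ l h, hcast _ hz₂ l h]
      simp only [zero_mul, add_zero, norm_zero]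
      have := hq (p - 3)
      positivity

/-- The oscillatory integral bound for a cutoff pairing of Hilbert space valued symbols. -/
lemma exists_norm_integral_pairing_le {H : Type*} [NormedAddCommGroup H] [InnerProductSpace ℂ H]
    {χ : ℝ → ℝ} (hχ : ContDiff ℝ (⊤ : ℕ∞) χ) {c : ℝ} (hc : 0 < c) (hc2 : c ≤ 2)
    (hχ0 : ∀ l, c ≤ l → χ l = 0) {p : ℝ} (hp : 0 < p) (hp3 : p ≤ 3) :
    ∃ C : ℝ, 0 ≤ C ∧ ∀ G D a b σ t : ℝ, 0 ≤ G → 0 ≤ D → 0 ≤ a → 0 ≤ b → (σ = 1 ∨ σ = -1) →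
      t ≠ 0 → ∀ (f f₁ f₂ g g₁ g₂ : ℝ → H) (T T₁ T₂ : ℝ → H →L[ℂ] H),
      (∀ l ∈ Set.Ioo 0 c, HasDerivAt f (f₁ l) l ∧ HasDerivAt f₁ (f₂ l) l) →
      (∀ l ∈ Set.Ioo 0 c, HasDerivAt g (g₁ l) l ∧ HasDerivAt g₁ (g₂ l) l) →
      (∀ l ∈ Set.Ioo 0 c, HasDerivAt T (T₁ l) l ∧ HasDerivAt T₁ (T₂ l) l) →
      (∀ l ∈ Set.Ioo 0 c, ‖f l‖ ≤ G * l⁻¹ / (1 + l * a) ∧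
        ‖f₁ l‖ ≤ G * (l ^ 2)⁻¹ / (1 + l * a) ∧ ‖f₂ l‖ ≤ G * (l ^ 3)⁻¹) →
      (∀ l ∈ Set.Ioo 0 c, ‖g l‖ ≤ G * l⁻¹ / (1 + l * b) ∧
        ‖g₁ l‖ ≤ G * (l ^ 2)⁻¹ / (1 + l * b) ∧ ‖g₂ l‖ ≤ G * (l ^ 3)⁻¹) →
      (∀ l ∈ Set.Ioo 0 c, ‖T l‖ ≤ D * l ∧ ‖T₁ l‖ ≤ D ∧ ‖T₂ l‖ ≤ D * l⁻¹) →
      ‖∫ l in Set.Ioi (0 : ℝ), Complex.exp (-Complex.I * t * (l : ℂ) ^ 2 +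
          Complex.I * (σ * (a + b) : ℝ) * l) *
        (((χ l * l ^ p : ℝ) : ℂ) * inner ℂ (f l) (T l (g l)))‖
        ≤ C * (9 * D * G ^ 2) * |t| ^ (-p / 2) := by
  obtain ⟨C, hC, hmain⟩ := exists_norm_integral_cutoff_le hχ hc hc2 hχ0 hp hp3
  refine ⟨C, hC, ?_⟩
  intro G D a b σ t hG hD ha hb hσ ht f f₁ f₂ g g₁ g₂ T T₁ T₂ hf hg hT bf bg bT
  have hω : |σ * (a + b)| = a + b := by
    have : |σ| = 1 := by rcases hσ with rfl | rfl <;> simp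
    rw [abs_mul, this, one_mul, abs_of_nonneg (by positivity)]
  have hbd := fun l (hl : l ∈ Set.Ioo 0 c) ↦ norm_pairing_le hl.1 hG hD ha hb (bf l hl).1
    (bf l hl).2.1 (bf l hl).2.2 (bg l hl).1 (bg l hl).2.1 (bg l hl).2.2 (bT l hl).1 (bT l hl).2.1
    (bT l hl).2.2
  refine hmain (9 * D * G ^ 2) (by positivity) (σ * (a + b)) t ht
    (fun l ↦ inner ℂ (f l) (T l (g l)))
    (fun l ↦ pairing₁ (f l) (f₁ l) (g l) (g₁ l) (T l) (T₁ l))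
    (fun l ↦ pairing₂ (f l) (f₁ l) (f₂ l) (g l) (g₁ l) (g₂ l) (T l) (T₁ l) (T₂ l))
    (fun l hl ↦ hasDerivAt_pairing (hf l hl).1 (hg l hl).1 (hT l hl).1)
    (fun l hl ↦ hasDerivAt_pairing₁ (hf l hl).1 (hf l hl).2 (hg l hl).1 (hg l hl).2
      (hT l hl).1 (hT l hl).2) ?_ ?_ fun l hl ↦ (hbd l hl).2.2
  · rw [hω]
    exact fun l hl ↦ (hbd l hl).1
  · rw [hω]
    exact fun l hl ↦ (hbd l hl).2.1

/-! ### The free resolvent kernel multiplied by the potential -/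

section Potential

variable {v : EuclideanSpace ℝ (Fin 3) → ℝ}

lemma memLp_two_mul_one_add_norm_sq {ε C₀ : ℝ} (hε : 0 < ε) (hvmeas : Measurable v)
    (hvnn : ∀ x, 0 ≤ v x) (hvdecay : ∀ x, v x ≤ C₀ * (1 + ‖x‖) ^ (-(7 / 2 + ε))) :
    MemLp (fun u ↦ v u * (1 + ‖u‖) ^ 2) 2 volume := by
  have hmeas : Measurable fun u ↦ v u * (1 + ‖u‖) ^ 2 := by fun_prop
  rw [memLp_two_iff_integrable_sq hmeas.aestronglyMeasurable]
  have hinteg : Integrable (fun u : EuclideanSpace ℝ (Fin 3) ↦ (1 + ‖u‖) ^ (-(3 + 2 * ε))) volume :=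
    integrable_one_add_norm (by
      rw [finrank_euclideanSpace_fin]
      push_cast
      linarith)
  refine (hinteg.const_mul (C₀ ^ 2)).mono' (hmeas.pow_const 2).aestronglyMeasurable
    (Filter.Eventually.of_forall fun u ↦ ?_)
  have hw : 0 < 1 + ‖u‖ := by positivity
  have hle : v u * (1 + ‖u‖) ^ 2 ≤ C₀ * (1 + ‖u‖) ^ (-(3 / 2 + ε)) := by
    refine (mul_le_mul_of_nonneg_right (hvdecay u) (sq_nonneg _)).trans (le_of_eq ?_)
    rw [mul_assoc, ← Real.rpow_two, ← Real.rpow_add hw]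
    ring_nf
  rw [Real.norm_eq_abs, abs_of_nonneg (sq_nonneg _)]
  refine (pow_le_pow_left₀ (mul_nonneg (hvnn u) (sq_nonneg _)) hle 2).trans (le_of_eq ?_)
  rw [mul_pow, ← Real.rpow_natCast ((1 + ‖u‖) ^ _) 2, ← Real.rpow_mul hw.le]
  push_cast
  ring_nf

/-- The potential times one of the kernels `modKer`, `modKer₁`, `modKer₂` centred at `x`. -/
def potKer (v : EuclideanSpace ℝ (Fin 3) → ℝ) (k : ℝ → ℝ → ℝ → ℂ) (x : EuclideanSpace ℝ (Fin 3))
    (l : ℝ) (u : EuclideanSpace ℝ (Fin 3)) : ℂ :=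
  (v u : ℂ) * k ‖x - u‖ ‖x‖ l

lemma measurable_potKer (hv : Measurable v) {k : ℝ → ℝ → ℝ → ℂ}
    (hk : ∀ d l, Measurable fun r ↦ k r d l) (x : EuclideanSpace ℝ (Fin 3)) (l : ℝ) :
    Measurable (potKer v k x l) := by
  have h : Measurable fun u : EuclideanSpace ℝ (Fin 3) ↦ ‖x - u‖ := by fun_prop
  exact (Complex.measurable_ofReal.comp hv).mul ((hk ‖x‖ l).comp h)

lemma measurable_modKer (σ d l : ℝ) : Measurable fun r ↦ modKer σ r d l := by
  unfold modKer expDiff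
  fun_prop

lemma measurable_modKer₁ (σ d l : ℝ) : Measurable fun r ↦ modKer₁ σ r d l := by
  unfold modKer₁ expDiff
  fun_prop

lemma measurable_modKer₂ (σ d l : ℝ) : Measurable fun r ↦ modKer₂ σ r d l := by
  unfold modKer₂ expDiff
  fun_prop

lemma norm_potKer_le (hvnn : ∀ x, 0 ≤ v x) {σ : ℝ} (hσ : σ = 1 ∨ σ = -1) {l : ℝ} (hl : 0 < l)
    (hl2 : l ≤ 2) (x u : EuclideanSpace ℝ (Fin 3)) :
    ‖potKer v (modKer σ) x l u‖ ≤ 6 * l⁻¹ / (1 + l * ‖x‖) * (v u * (1 + ‖u‖) ^ 2)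
    ∧ ‖potKer v (modKer₁ σ) x l u‖ ≤ 6 * (l ^ 2)⁻¹ / (1 + l * ‖x‖) * (v u * (1 + ‖u‖) ^ 2)
    ∧ ‖potKer v (modKer₂ σ) x l u‖ ≤ 6 * (l ^ 3)⁻¹ * (v u * (1 + ‖u‖) ^ 2) := by
  have hrd : |‖x - u‖ - ‖x‖| ≤ 1 + ‖u‖ - 1 := by
    simpa using abs_norm_sub_norm_le (x - u) x
  obtain ⟨h0, h1, h2⟩ := norm_modKer_le hσ (norm_nonneg (x - u)) (norm_nonneg x) hl hl2
    (w := 1 + ‖u‖) (by linarith [norm_nonneg u]) hrd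
  have hmul : ∀ {z : ℂ} {a : ℝ}, ‖z‖ ≤ a * (1 + ‖u‖) ^ 2 →
      ‖(v u : ℂ) * z‖ ≤ a * (v u * (1 + ‖u‖) ^ 2) := fun {z a} hz ↦ by
    rw [norm_mul, Complex.norm_real, Real.norm_eq_abs, abs_of_nonneg (hvnn u)]
    exact (mul_le_mul_of_nonneg_left hz (hvnn u)).trans (le_of_eq (by ring))
  exact ⟨hmul h0, hmul h1, hmul h2⟩

lemma memLp_potKer (hvmeas : Measurable v) (hvnn : ∀ x, 0 ≤ v x)
    (hg : MemLp (fun u ↦ v u * (1 + ‖u‖) ^ 2) 2 volume)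
    {σ : ℝ} (hσ : σ = 1 ∨ σ = -1) {l : ℝ} (hl : 0 < l) (hl2 : l ≤ 2)
    (x : EuclideanSpace ℝ (Fin 3)) :
    MemLp (potKer v (modKer σ) x l) 2 volume ∧ MemLp (potKer v (modKer₁ σ) x l) 2 volume
      ∧ MemLp (potKer v (modKer₂ σ) x l) 2 volume := by
  have hb := norm_potKer_le hvnn hσ hl hl2 x
  exact ⟨(hg.const_mul _).mono' (measurable_potKer hvmeas (measurable_modKer σ) x
      l).aestronglyMeasurable (Filter.Eventually.of_forall fun u ↦ (hb u).1),
    (hg.const_mul _).mono' (measurable_potKer hvmeas (measurable_modKer₁ σ) x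
      l).aestronglyMeasurable (Filter.Eventually.of_forall fun u ↦ (hb u).2.1),
    (hg.const_mul _).mono' (measurable_potKer hvmeas (measurable_modKer₂ σ) x
      l).aestronglyMeasurable (Filter.Eventually.of_forall fun u ↦ (hb u).2.2)⟩

lemma norm_toLTwo_potKer_le (hvmeas : Measurable v) (hvnn : ∀ x, 0 ≤ v x)
    (hg : MemLp (fun u ↦ v u * (1 + ‖u‖) ^ 2) 2 volume)
    {σ : ℝ} (hσ : σ = 1 ∨ σ = -1) {l : ℝ} (hl : 0 < l) (hl2 : l ≤ 2)
    (x : EuclideanSpace ℝ (Fin 3)) :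
    ‖toLTwo volume (potKer v (modKer σ) x l)‖ ≤ 6 * ‖hg.toLp _‖ * l⁻¹ / (1 + l * ‖x‖)
    ∧ ‖toLTwo volume (potKer v (modKer₁ σ) x l)‖
      ≤ 6 * ‖hg.toLp _‖ * (l ^ 2)⁻¹ / (1 + l * ‖x‖)
    ∧ ‖toLTwo volume (potKer v (modKer₂ σ) x l)‖ ≤ 6 * ‖hg.toLp _‖ * (l ^ 3)⁻¹ := by
  have hb := norm_potKer_le hvnn hσ hl hl2 x
  refine ⟨?_, ?_, ?_⟩
  · refine (norm_toLTwo_le (measurable_potKer hvmeas (measurable_modKer σ) x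
      l).aestronglyMeasurable hg (by positivity) fun u ↦ (hb u).1).trans (le_of_eq ?_)
    ring
  · refine (norm_toLTwo_le (measurable_potKer hvmeas (measurable_modKer₁ σ) x
      l).aestronglyMeasurable hg (by positivity) fun u ↦ (hb u).2.1).trans (le_of_eq ?_)
    ring
  · refine (norm_toLTwo_le (measurable_potKer hvmeas (measurable_modKer₂ σ) x
      l).aestronglyMeasurable hg (by positivity) fun u ↦ (hb u).2.2).trans (le_of_eq ?_)
    ring

lemma hasDerivAt_toLTwo_potKer (hvmeas : Measurable v) (hvnn : ∀ x, 0 ≤ v x)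
    (hg : MemLp (fun u ↦ v u * (1 + ‖u‖) ^ 2) 2 volume)
    {σ : ℝ} (hσ : σ = 1 ∨ σ = -1) {l : ℝ} (hl : 0 < l) (hl2 : l < 2)
    (x : EuclideanSpace ℝ (Fin 3)) :
    HasDerivAt (fun l ↦ toLTwo volume (potKer v (modKer σ) x l))
      (toLTwo volume (potKer v (modKer₁ σ) x l)) l
    ∧ HasDerivAt (fun l ↦ toLTwo volume (potKer v (modKer₁ σ) x l))
      (toLTwo volume (potKer v (modKer₂ σ) x l)) l := by
  have hpos : ∀ s ∈ Set.Ioo (l / 2) 2, 0 < s := fun s hs ↦ (half_pos hl).trans hs.1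
  have hmem : l ∈ Set.Ioo (l / 2) 2 := ⟨half_lt_self hl, hl2⟩
  have hLp : ∀ s ∈ Set.Ioo (l / 2) 2, _ := fun s hs ↦
    memLp_potKer hvmeas hvnn hg hσ (hpos s hs) hs.2.le x
  have hw : ∀ u : EuclideanSpace ℝ (Fin 3), 0 ≤ v u * (1 + ‖u‖) ^ 2 := fun u ↦
    mul_nonneg (hvnn u) (sq_nonneg _)
  constructor
  · refine hasDerivAt_Lp_two_of_dominated (hg.const_mul (6 * ((l / 2) ^ 2)⁻¹))
      (F := fun l ↦ potKer v (modKer σ) x l) (F' := fun l ↦ potKer v (modKer₁ σ) x l)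
      (fun s hs u ↦ (hasDerivAt_modKer σ _ _ (hpos s hs).ne').const_mul _)
      (fun s hs u ↦ ?_) (fun s hs ↦ coeFn_toLTwo (hLp s hs).1) hmem
      (coeFn_toLTwo (hLp l hmem).2.1)
    have hs0 := hpos s hs
    have hs1 := hs.1
    refine (norm_potKer_le hvnn hσ hs0 hs.2.le x u).2.1.trans
      (mul_le_mul_of_nonneg_right ?_ (hw u))
    refine (div_le_self (by positivity) (by nlinarith [norm_nonneg x])).trans ?_
    gcongr
  · refine hasDerivAt_Lp_two_of_dominated (hg.const_mul (6 * ((l / 2) ^ 3)⁻¹))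
      (F := fun l ↦ potKer v (modKer₁ σ) x l) (F' := fun l ↦ potKer v (modKer₂ σ) x l)
      (fun s hs u ↦ (hasDerivAt_modKer₁ σ _ _ (hpos s hs).ne').const_mul _)
      (fun s hs u ↦ ?_) (fun s hs ↦ coeFn_toLTwo (hLp s hs).2.1) hmem
      (coeFn_toLTwo (hLp l hmem).2.2)
    have hs1 := hs.1
    refine (norm_potKer_le hvnn hσ (hpos s hs) hs.2.le x u).2.2.trans
      (mul_le_mul_of_nonneg_right ?_ (hw u))
    gcongr

lemma R0ker_eq_exp_mul_modKer (σ l : ℝ) (x u : EuclideanSpace ℝ (Fin 3)) :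
    R0ker σ l x u = Complex.exp (Complex.I * (σ * ‖x‖ : ℝ) * l) * modKer σ ‖x - u‖ ‖x‖ l := by
  simp only [R0ker, modKer, expDiff, pow_zero, one_mul]
  rw [show (σ : ℂ) * Complex.I * l * (‖x - u‖ : ℂ) = Complex.I * (σ * ‖x‖ : ℝ) * l
      + Complex.I * σ * (‖x - u‖ - ‖x‖) * l by push_cast; ring,
    show -((l : ℂ) * (‖x - u‖ : ℂ)) = Complex.I * (σ * ‖x‖ : ℝ) * l
      + -(‖x - u‖ + Complex.I * σ * ‖x‖) * l by push_cast; ring,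
    Complex.exp_add, Complex.exp_add]
  ring

lemma R0ker_comm (σ l : ℝ) (x u : EuclideanSpace ℝ (Fin 3)) : R0ker σ l x u = R0ker σ l u x := by
  simp only [R0ker, norm_sub_rev x u]

lemma conj_modKer_neg (σ r d l : ℝ) :
    (starRingEnd ℂ) (modKer (-σ) r d l) = modKer σ r d l := by
  simp only [modKer, expDiff, pow_zero, one_mul, map_mul, map_div₀, map_sub, map_pow,
    ← Complex.exp_conj, map_neg, map_add, Complex.conj_I, Complex.conj_ofReal, map_one,
    map_ofNat, Complex.ofReal_neg]
  ring_nf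

lemma integral_R0ker_mul (hvmeas : Measurable v) (hvnn : ∀ x, 0 ≤ v x)
    (hg : MemLp (fun u ↦ v u * (1 + ‖u‖) ^ 2) 2 volume)
    {σ : ℝ} (hσ : σ = 1 ∨ σ = -1) {l : ℝ} (hl : 0 < l) (hl2 : l ≤ 2)
    (x y : EuclideanSpace ℝ (Fin 3))
    (T : Lp ℂ 2 (volume : Measure (EuclideanSpace ℝ (Fin 3))) →L[ℂ]
      Lp ℂ 2 (volume : Measure (EuclideanSpace ℝ (Fin 3))))
    {h : Lp ℂ 2 (volume : Measure (EuclideanSpace ℝ (Fin 3)))}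
    (hh : h =ᵐ[volume] fun u ↦ (v u : ℂ) * R0ker σ l u y) :
    ∫ u : EuclideanSpace ℝ (Fin 3), R0ker σ l x u * (v u : ℂ) * (T h) u
      = Complex.exp (Complex.I * (σ * (‖x‖ + ‖y‖) : ℝ) * l) *
        inner ℂ (toLTwo volume (potKer v (modKer (-σ)) x l))
          (T (toLTwo volume (potKer v (modKer σ) y l))) := by
  have hσ' : -σ = 1 ∨ -σ = -1 := by
    rcases hσ with rfl | rfl <;> simp
  have hx := coeFn_toLTwo (memLp_potKer hvmeas hvnn hg hσ' hl hl2 x).1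
  have hy := coeFn_toLTwo (memLp_potKer hvmeas hvnn hg hσ hl hl2 y).1
  have hheq : h = Complex.exp (Complex.I * (σ * ‖y‖ : ℝ) * l) •
      toLTwo volume (potKer v (modKer σ) y l) := by
    refine Lp.ext ?_
    filter_upwards [hh, hy, Lp.coeFn_smul (Complex.exp (Complex.I * (σ * ‖y‖ : ℝ) * l))
      (toLTwo volume (potKer v (modKer σ) y l))] with u h1 h2 h3
    rw [h1, h3, Pi.smul_apply, h2, R0ker_comm, R0ker_eq_exp_mul_modKer, potKer, smul_eq_mul]
    ring
  have hexp : Complex.exp (Complex.I * (σ * (‖x‖ + ‖y‖) : ℝ) * l)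
      = Complex.exp (Complex.I * (σ * ‖x‖ : ℝ) * l)
        * Complex.exp (Complex.I * (σ * ‖y‖ : ℝ) * l) := by
    rw [← Complex.exp_add]
    congr 1
    push_cast
    ring
  rw [hexp, L2.inner_def, ← integral_const_mul, hheq, map_smul]
  refine integral_congr_ae ?_
  filter_upwards [hx, Lp.coeFn_smul (Complex.exp (Complex.I * (σ * ‖y‖ : ℝ) * l))
    (T (toLTwo volume (potKer v (modKer σ) y l)))] with u h1 h2
  rw [h2, Pi.smul_apply, h1, R0ker_eq_exp_mul_modKer, potKer, RCLike.inner_apply, smul_eq_mul,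
    map_mul, conj_modKer_neg, Complex.conj_ofReal]
  ring

end Potential

/-- Proposition 3.7, error term: low-energy dispersive bound for the
contribution of `R₀^±(λ⁴) v Γ(λ) v R₀^±(λ⁴)`, where `Γ : (0, 2λ₀) → B(L²)` is twice
continuously differentiable in operator norm with
`‖Γ(λ)‖ + λ‖Γ'(λ)‖ + λ²‖Γ''(λ)‖ ≤ C₁ λ`, and `v(x) ≲ (1+|x|)^{-7/2-ε}`.
The family `h lam y ∈ L²` represents the function `u' ↦ v(u') R₀^±(λ⁴)(u', y)`, so that
`K(λ; x, y)` is the integral kernel of `R₀^±(λ⁴) v Γ(λ) v R₀^±(λ⁴)`. -/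
theorem stmt12 (ε C₀ C₁ : ℝ) (hε : 0 < ε) (v : EuclideanSpace ℝ (Fin 3) → ℝ)
    (hvmeas : Measurable v) (hvnn : ∀ x, 0 ≤ v x)
    (hvdecay : ∀ x, v x ≤ C₀ * (1 + ‖x‖) ^ (-(7 / 2 + ε)))
    (lam₀ : ℝ) (hlam₀ : 0 < lam₀) (hlam₀' : lam₀ < 1)
    (χ : ℝ → ℝ) (hχs : ContDiff ℝ (⊤ : ℕ∞) χ) (hχe : ∀ s, χ (-s) = χ s)
    (hχ1 : ∀ s, |s| ≤ lam₀ → χ s = 1) (hχ0 : ∀ s, 2 * lam₀ ≤ |s| → χ s = 0)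
    (Γ : ℝ → (Lp ℂ 2 (volume : Measure (EuclideanSpace ℝ (Fin 3))) →L[ℂ]
      Lp ℂ 2 (volume : Measure (EuclideanSpace ℝ (Fin 3)))))
    (hΓd1 : ∀ lam ∈ Set.Ioo (0 : ℝ) (2 * lam₀), DifferentiableAt ℝ Γ lam)
    (hΓd2 : ∀ lam ∈ Set.Ioo (0 : ℝ) (2 * lam₀), DifferentiableAt ℝ (deriv Γ) lam)
    (hΓc : ContinuousOn (deriv (deriv Γ)) (Set.Ioo (0 : ℝ) (2 * lam₀)))
    (hΓbd : ∀ lam ∈ Set.Ioo (0 : ℝ) (2 * lam₀),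
      ‖Γ lam‖ + lam * ‖deriv Γ lam‖ + lam ^ 2 * ‖deriv (deriv Γ) lam‖ ≤ C₁ * lam)
    (α : ℝ) (hα1 : -(3 / 2 : ℝ) < α) (hα2 : α ≤ 0) :
    ∃ C : ℝ, 0 < C ∧ ∀ sgn : ℝ, (sgn = 1 ∨ sgn = -1) →
      ∀ h : ℝ → EuclideanSpace ℝ (Fin 3) →
        Lp ℂ 2 (volume : Measure (EuclideanSpace ℝ (Fin 3))),
      (∀ lam ∈ Set.Ioo (0 : ℝ) (2 * lam₀), ∀ y : EuclideanSpace ℝ (Fin 3),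
        (h lam y : EuclideanSpace ℝ (Fin 3) → ℂ) =ᵐ[volume]
          fun u' => (v u' : ℂ) * R0ker sgn lam u' y) →
      ∀ t : ℝ, t ≠ 0 → ∀ x y : EuclideanSpace ℝ (Fin 3),
      ‖∫ lam in Set.Ioi (0 : ℝ),
          ((χ lam : ℝ) : ℂ) * Complex.exp (-Complex.I * (t : ℂ) * (lam : ℂ) ^ 2) *
            ((lam ^ (3 + 2 * α) : ℝ) : ℂ) *
            ∫ u : EuclideanSpace ℝ (Fin 3),
              R0ker sgn lam x u * (v u : ℂ) * (Γ lam (h lam y)) u‖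
        ≤ C * |t| ^ (-(3 + 2 * α) / 2) := by
  have hg := memLp_two_mul_one_add_norm_sq hε hvmeas hvnn hvdecay
  have hC₁ : 0 ≤ C₁ := by
    have h := hΓbd lam₀ ⟨hlam₀, by linarith⟩
    have h' : 0 ≤ C₁ * lam₀ := le_trans (by positivity) h
    exact nonneg_of_mul_nonneg_left h' hlam₀
  obtain ⟨C, hC, hmain⟩ := exists_norm_integral_pairing_le
    (H := Lp ℂ 2 (volume : Measure (EuclideanSpace ℝ (Fin 3)))) hχs (c := 2 * lam₀) (by linarith)
    (by linarith) (fun l hl ↦ hχ0 l (hl.trans (le_abs_self l))) (p := 3 + 2 * α)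
    (by linarith) (by linarith)
  have hΓbds : ∀ l ∈ Set.Ioo 0 (2 * lam₀),
      ‖Γ l‖ ≤ C₁ * l ∧ ‖deriv Γ l‖ ≤ C₁ ∧ ‖deriv (deriv Γ) l‖ ≤ C₁ * l⁻¹ := fun l hl ↦ by
    have hl0 := hl.1
    have hb := hΓbd l hl
    have b0 := norm_nonneg (Γ l)
    have b1 := mul_nonneg hl0.le (norm_nonneg (deriv Γ l))
    have b2 := mul_nonneg (sq_nonneg l) (norm_nonneg (deriv (deriv Γ) l))
    have hcancel : l ^ 2 * (C₁ * l⁻¹) = C₁ * l := by field_simp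
    exact ⟨by linarith, le_of_mul_le_mul_left (by linarith) hl0,
      le_of_mul_le_mul_left (by linarith) (pow_pos hl0 2)⟩
  refine ⟨C * (9 * C₁ * (6 * ‖hg.toLp _‖) ^ 2) + 1, by positivity, ?_⟩
  intro σ hσ h hh t ht x y
  have hσ' : -σ = 1 ∨ -σ = -1 := by
    rcases hσ with rfl | rfl <;> simp
  have hbound := hmain (6 * ‖hg.toLp _‖) C₁ ‖x‖ ‖y‖ σ t (by positivity) hC₁ (norm_nonneg x)
    (norm_nonneg y) hσ ht
    (fun l ↦ toLTwo volume (potKer v (modKer (-σ)) x l))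
    (fun l ↦ toLTwo volume (potKer v (modKer₁ (-σ)) x l))
    (fun l ↦ toLTwo volume (potKer v (modKer₂ (-σ)) x l))
    (fun l ↦ toLTwo volume (potKer v (modKer σ) y l))
    (fun l ↦ toLTwo volume (potKer v (modKer₁ σ) y l))
    (fun l ↦ toLTwo volume (potKer v (modKer₂ σ) y l)) Γ (deriv Γ) (deriv (deriv Γ))
    (fun l hl ↦ hasDerivAt_toLTwo_potKer hvmeas hvnn hg hσ' hl.1 (by linarith [hl.2]) x)
    (fun l hl ↦ hasDerivAt_toLTwo_potKer hvmeas hvnn hg hσ hl.1 (by linarith [hl.2]) y)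
    (fun l hl ↦ ⟨(hΓd1 l hl).hasDerivAt, (hΓd2 l hl).hasDerivAt⟩)
    (fun l hl ↦ norm_toLTwo_potKer_le hvmeas hvnn hg hσ' hl.1 (by linarith [hl.2]) x)
    (fun l hl ↦ norm_toLTwo_potKer_le hvmeas hvnn hg hσ hl.1 (by linarith [hl.2]) y) hΓbds
  have ht' : 0 ≤ |t| ^ (-(3 + 2 * α) / 2) := Real.rpow_nonneg (abs_nonneg t) _
  refine le_trans (le_of_eq ?_) (hbound.trans (mul_le_mul_of_nonneg_right (by linarith) ht'))
  congr 1
  refine setIntegral_congr_fun measurableSet_Ioi fun l hl ↦ ?_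
  have hl0 : 0 < l := hl
  rcases lt_or_ge l (2 * lam₀) with hlt | hge
  · have hk := integral_R0ker_mul hvmeas hvnn hg hσ hl0 (by linarith) x y (Γ l)
      (hh l ⟨hl0, hlt⟩ y)
    simp only [hk, Complex.exp_add, Complex.ofReal_mul]
    ring
  · simp only [hχ0 l (hge.trans (le_abs_self l)), Complex.ofReal_zero, zero_mul, mul_zero]
end
end
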